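/- arXiv:2602.15352 — 2 statements merged into one kernel-verified Lean document; each statement's English description precedes it below -/
import Mathlib

section
/- Let Q = {q_1,…,q_N} ⊆ ℝ^2, N>1, be a uniform contraction of P = {p_1,…,p_N} ⊆ ℝ^2 (i.e., there exists λ>0 with |q_i−q_j| ≤ λ ≤ |p_i−p_j| for all i<j). Then for every r>0, the first intrinsic volume (equivalently, up to a factor, the perimeter/mean width) satisfies V_1(P^r) ≤ V_1(Q^r). -/
open MeasureTheory Metric Pointwise

/-- Volume of the unit ball in `ℝ^m`. -/
noncomputable def ballVolume (m : ℕ) : ℝ :=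
  (volume (closedBall (0 : EuclideanSpace ℝ (Fin m)) 1)).toReal

/-- The `k`-th intrinsic volume of a set in `ℝ^d`, defined via the Steiner formula:
`vol(A + εB) = Σ_i ω_{d-i} V_i(A) ε^{d-i}`; the Steiner polynomial is recovered by
Lagrange interpolation of `ε ↦ vol(A + εB)` at `ε = 0, 1, …, d`. -/
noncomputable def intrinsicVolume (d k : ℕ) (A : Set (EuclideanSpace ℝ (Fin d))) : ℝ :=
  ((Lagrange.interpolate (Finset.range (d + 1)) (fun j => (j : ℝ)))
      (fun j =>
        (volume (A + closedBall (0 : EuclideanSpace ℝ (Fin d)) (j : ℝ))).toReal)).coeff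
      (d - k) / ballVolume (d - k)

/-- The circumradius of a set. -/
noncomputable def circumradius {d : ℕ} (A : Set (EuclideanSpace ℝ (Fin d))) : ℝ :=
  sInf {r : ℝ | 0 < r ∧ ∃ p, A ⊆ closedBall p r}

/-- The `r`-dual (`r`-ball body generated by `A`): `A^r = ⋂_{p ∈ A} B[p,r]`. -/
def rDual {d : ℕ} (r : ℝ) (A : Set (EuclideanSpace ℝ (Fin d))) : Set (EuclideanSpace ℝ (Fin d)) :=
  ⋂ p ∈ A, closedBall p r

/-- The `r`-ball convex hull: intersection of all closed balls of radius `r` containing `A`. -/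
def rHull {d : ℕ} (r : ℝ) (A : Set (EuclideanSpace ℝ (Fin d))) : Set (EuclideanSpace ℝ (Fin d)) :=
  ⋂ p ∈ {p : EuclideanSpace ℝ (Fin d) | A ⊆ closedBall p r}, closedBall p r


/-! ### Part A: adding a segment to a planar convex body -/

/-- The Euclidean plane. -/
abbrev E2 := EuclideanSpace ℝ (Fin 2)

/-- The width of `K` with respect to the vector `u`. -/
noncomputable def wd (K : Set E2) (u : E2) : ℝ :=
  sSup ((fun x : E2 => inner ℝ u x) '' K) - sInf ((fun x : E2 => inner ℝ u x) '' K)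

/-- Rotation by a right angle. -/
noncomputable def rot (v : E2) : E2 := !₂[-(v 1), v 0]

lemma inner2 (x y : E2) : inner ℝ x y = x 0 * y 0 + x 1 * y 1 := by
  simp [PiLp.inner_apply, Fin.sum_univ_two]
  ring

lemma normsq2 (x : E2) : ‖x‖ ^ 2 = x 0 ^ 2 + x 1 ^ 2 := by
  rw [← real_inner_self_eq_norm_sq, inner2]; ring

lemma compact_convex_real {s : Set ℝ} (hc : IsCompact s) (hx : Convex ℝ s) (hn : s.Nonempty) :
    s = Set.Icc (sInf s) (sSup s) :=
  eq_Icc_of_connected_compact ⟨hn, hx.isPreconnected⟩ hc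

lemma Icc_add_Icc_real {a b s : ℝ} (hab : a ≤ b) (hs : 0 ≤ s) :
    Set.Icc a b + Set.Icc (-s) s = Set.Icc (a - s) (b + s) := by
  ext x
  rw [Set.mem_add]
  constructor
  · rintro ⟨y, hy, z, hz, rfl⟩
    exact ⟨by linarith [hy.1, hz.1], by linarith [hy.2, hz.2]⟩
  · rintro ⟨h1, h2⟩
    refine ⟨max a (min b x), ⟨le_max_left _ _, max_le hab (min_le_left _ _)⟩,
      x - max a (min b x), ⟨?_, ?_⟩, by ring⟩
    · have : max a (min b x) ≤ x + s := max_le (by linarith) ((min_le_right _ _).trans (by linarith))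
      linarith
    · have : x - s ≤ max a (min b x) := by
        rcases le_total b x with h | h
        · rw [min_eq_left h]; exact le_trans (by linarith) (le_max_right _ _)
        · rw [min_eq_right h]; exact le_trans (by linarith) (le_max_right _ _)
      linarith

lemma vol_add_vert {C : Set (ℝ × ℝ)} (hc : IsCompact C) (hx : Convex ℝ C) {s : ℝ} (hs : 0 ≤ s) :
    volume (C + ({0} ×ˢ Set.Icc (-s) s)) =
      volume C + ENNReal.ofReal (2 * s) * volume (Prod.fst '' C) := by
  have hc2 : IsCompact (C + (({0} : Set ℝ) ×ˢ Set.Icc (-s) s)) :=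
    hc.add (isCompact_singleton.prod isCompact_Icc)
  rw [Measure.volume_eq_prod, Measure.prod_apply hc2.isClosed.measurableSet,
    Measure.prod_apply hc.isClosed.measurableSet]
  have hfst : MeasurableSet (Prod.fst '' C) := (hc.image continuous_fst).isClosed.measurableSet
  have key : ∀ x : ℝ, volume (Prod.mk x ⁻¹' (C + (({0} : Set ℝ) ×ˢ Set.Icc (-s) s))) =
      volume (Prod.mk x ⁻¹' C) +
        (Prod.fst '' C).indicator (fun _ => ENNReal.ofReal (2 * s)) x := by
    intro x
    have hsl : Prod.mk x ⁻¹' (C + (({0} : Set ℝ) ×ˢ Set.Icc (-s) s)) =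
        Prod.mk x ⁻¹' C + Set.Icc (-s) s := by
      ext y
      simp only [Set.mem_preimage, Set.mem_add, Set.mem_prod, Set.mem_singleton_iff, Prod.exists,
        Prod.mk_add_mk, Prod.mk.injEq]
      constructor
      · rintro ⟨a, b, hab, c, d, ⟨rfl, hd⟩, h1, h2⟩
        rw [add_zero] at h1
        subst h1
        exact ⟨b, hab, d, hd, h2⟩
      · rintro ⟨b, hb, d, hd, h2⟩
        exact ⟨x, b, hb, 0, d, ⟨rfl, hd⟩, by simp, h2⟩
    rw [hsl]
    by_cases hxm : x ∈ Prod.fst '' C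
    · have hne : (Prod.mk x ⁻¹' C).Nonempty := by
        obtain ⟨⟨a, b⟩, h, rfl⟩ := hxm
        exact ⟨b, h⟩
      have hcc : IsCompact (Prod.mk x ⁻¹' C) := by
        have : Prod.mk x ⁻¹' C = Prod.snd '' (C ∩ ({x} ×ˢ Set.univ)) := by
          ext y; simp
        rw [this]
        exact (hc.inter_right (isClosed_singleton.prod isClosed_univ)).image continuous_snd
      have hcx : Convex ℝ (Prod.mk x ⁻¹' C) := by
        intro y hy z hz a b ha hb hab
        have := hx hy hz ha hb hab
        simp only [Set.mem_preimage]
        convert this using 1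
        ext
        · simp [← add_mul, hab]
        · simp
      have hI := compact_convex_real hcc hcx hne
      set a := sInf (Prod.mk x ⁻¹' C)
      set b := sSup (Prod.mk x ⁻¹' C)
      have hab : a ≤ b := by
        rw [hI] at hne
        exact Set.nonempty_Icc.1 hne
      rw [hI, Icc_add_Icc_real hab hs, Set.indicator_of_mem hxm, Real.volume_Icc, Real.volume_Icc,
        ← ENNReal.ofReal_add (by linarith) (by linarith)]
      congr 1; ring
    · have he : Prod.mk x ⁻¹' C = ∅ := by
        ext y
        simp only [Set.mem_preimage, Set.mem_empty_iff_false, iff_false]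
        intro h
        exact hxm ⟨_, h, rfl⟩
      rw [he, Set.indicator_of_notMem hxm]
      simp
  simp_rw [key]
  rw [lintegral_add_left (measurable_measure_prodMk_left hc.isClosed.measurableSet),
    lintegral_indicator hfst, lintegral_const]
  simp

/-- The linear map `x ↦ (⟪rot v, x⟫, ⟪v, x⟫)`. -/
noncomputable def frameMap (v : E2) : E2 →ₗ[ℝ] E2 where
  toFun x := !₂[inner ℝ (rot v) x, inner ℝ v x]
  map_add' x y := by
    ext i; fin_cases i <;> simp [inner_add_right]
  map_smul' c x := by
    ext i; fin_cases i <;> simp [inner_smul_right]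

lemma frameMap_det (v : E2) : LinearMap.det (frameMap v) = -‖v‖ ^ 2 := by
  rw [← LinearMap.det_toMatrix (EuclideanSpace.basisFun (Fin 2) ℝ).toBasis, Matrix.det_fin_two]
  simp [LinearMap.toMatrix_apply, frameMap, inner2, rot, normsq2]
  ring

lemma vol_prodMap (S : Set (ℝ × ℝ)) :
    volume ((fun x : E2 => (x 0, x 1)) ⁻¹' S) = volume S := by
  have h1 := EuclideanSpace.volume_preserving_symm_measurableEquiv_toLp (Fin 2)
  have h2 := volume_preserving_finTwoArrow ℝ
  have := (h2.comp h1).measure_preimage_equiv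
    (f := (MeasurableEquiv.toLp 2 (Fin 2 → ℝ)).symm.trans (MeasurableEquiv.finTwoArrow)) S
  exact this

lemma vol_add_segment {K : Set E2} (hc : IsCompact K) (hx : Convex ℝ K) (hn : K.Nonempty)
    (v : E2) : (volume (K + segment ℝ (-v) v)).toReal =
      (volume K).toReal + 2 * wd K (rot v) := by
  by_cases hv : v = 0
  · subst hv
    have hr : rot 0 = 0 := by ext i; fin_cases i <;> simp [rot]
    have : wd K (rot 0) = 0 := by
      have : (fun x : E2 => inner ℝ (rot 0) x) '' K = {(0 : ℝ)} := by
        simp [hr, hn]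
      rw [wd, this]; simp
    rw [this]
    simp
  have hvn : 0 < ‖v‖ ^ 2 := by positivity
  -- the product version of the frame map
  set T : E2 → ℝ × ℝ := fun x => (inner ℝ (rot v) x, inner ℝ v x) with hT
  have hTc : Continuous T := by fun_prop
  have hTadd : ∀ x y, T (x + y) = T x + T y := by
    intro x y; simp [hT, inner_add_right]
  have hTsmul : ∀ (a : ℝ) x, T (a • x) = a • T x := by
    intro a x; simp [hT, inner_smul_right]
  have himg : ∀ S : Set E2, volume (T '' S) = ENNReal.ofReal (‖v‖ ^ 2) * volume S := by
    intro S
    have h1 := Measure.addHaar_image_linearMap volume (frameMap v) S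
    rw [frameMap_det, abs_neg, abs_of_pos hvn] at h1
    rw [← h1, ← vol_prodMap]
    congr 1
    ext z
    simp only [Set.mem_preimage, Set.mem_image, hT, Prod.mk.injEq]
    constructor
    · rintro ⟨x, hxS, h0, h1⟩
      refine ⟨x, hxS, ?_⟩
      ext i; fin_cases i <;> simp [frameMap, h0, h1]
    · rintro ⟨x, hxS, rfl⟩
      exact ⟨x, hxS, by simp [frameMap], by simp [frameMap]⟩
  have hTseg : T '' (segment ℝ (-v) v) = ({0} : Set ℝ) ×ˢ Set.Icc (-‖v‖ ^ 2) (‖v‖ ^ 2) := by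
    have hTv : T v = (0, ‖v‖ ^ 2) := by
      simp only [hT, real_inner_self_eq_norm_sq, Prod.mk.injEq, and_true]
      rw [inner2]; simp [rot]; ring
    ext z
    constructor
    · rintro ⟨x, ⟨a, b, ha, hb, hab, rfl⟩, rfl⟩
      have : T (a • -v + b • v) = (0, (b - a) * ‖v‖ ^ 2) := by
        rw [show a • -v + b • v = (b - a) • v by module, hTsmul, hTv]; simp
      rw [this]
      refine ⟨rfl, ?_, ?_⟩ <;> simp only <;> nlinarith
    · rintro ⟨h0, h1, h2⟩
      obtain ⟨z0, z1⟩ := z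
      simp only [Set.mem_singleton_iff] at h0 h1 h2
      subst h0
      refine ⟨(z1 / ‖v‖ ^ 2) • v, ⟨(1 - z1 / ‖v‖ ^ 2) / 2, (1 + z1 / ‖v‖ ^ 2) / 2, ?_, ?_, by ring,
        by module⟩, ?_⟩
      · have : z1 / ‖v‖ ^ 2 ≤ 1 := by rw [div_le_one hvn]; exact h2
        linarith
      · have : -1 ≤ z1 / ‖v‖ ^ 2 := by rw [le_div_iff₀ hvn]; linarith
        linarith
      · rw [hTsmul, hTv]
        simp only [Prod.smul_mk, smul_eq_mul, mul_zero, Prod.mk.injEq, true_and]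
        field_simp
  have hTK : IsCompact (T '' K) := hc.image hTc
  have hTKx : Convex ℝ (T '' K) := by
    rintro _ ⟨x, hxK, rfl⟩ _ ⟨y, hyK, rfl⟩ a b ha hb hab
    exact ⟨a • x + b • y, hx hxK hyK ha hb hab, by rw [hTadd, hTsmul, hTsmul]⟩
  have hsum : T '' (K + segment ℝ (-v) v) = T '' K + T '' (segment ℝ (-v) v) := by
    ext z
    simp only [Set.mem_image, Set.mem_add]
    constructor
    · rintro ⟨_, ⟨x, hx', y, hy, rfl⟩, rfl⟩
      exact ⟨_, ⟨x, hx', rfl⟩, _, ⟨y, hy, rfl⟩, (hTadd x y).symm⟩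
    · rintro ⟨_, ⟨x, hx', rfl⟩, _, ⟨y, hy, rfl⟩, rfl⟩
      exact ⟨_, ⟨x, hx', y, hy, rfl⟩, hTadd x y⟩
  have hmain := vol_add_vert hTK hTKx hvn.le
  rw [show -‖v‖ ^ 2 = -(‖v‖ ^ 2) from rfl] at hTseg
  rw [← hTseg, ← hsum, himg, himg] at hmain
  have hfst : volume (Prod.fst '' (T '' K)) = ENNReal.ofReal (wd K (rot v)) := by
    rw [Set.image_image]
    have hcc : IsCompact ((fun x : E2 => inner ℝ (rot v) x) '' K) := hc.image (by fun_prop)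
    have hcx : Convex ℝ ((fun x : E2 => inner ℝ (rot v) x) '' K) := by
      rintro _ ⟨x, hxK, rfl⟩ _ ⟨y, hyK, rfl⟩ a b ha hb hab
      exact ⟨a • x + b • y, hx hxK hyK ha hb hab, by simp [inner_add_right, inner_smul_right]⟩
    have hI := compact_convex_real hcc hcx (hn.image _)
    change volume ((fun x : E2 => inner ℝ (rot v) x) '' K) = _
    rw [hI, Real.volume_Icc, wd]
  have hwd : 0 ≤ wd K (rot v) := by
    have hcc : IsCompact ((fun x : E2 => inner ℝ (rot v) x) '' K) := hc.image (by fun_prop)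
    rw [wd, sub_nonneg]
    exact Real.sInf_le_sSup _ hcc.bddBelow hcc.bddAbove
  rw [hfst] at hmain
  have h2 := congrArg ENNReal.toReal hmain
  rw [ENNReal.toReal_mul, ENNReal.toReal_add (by
      exact ENNReal.mul_ne_top ENNReal.ofReal_ne_top hc.measure_lt_top.ne)
    (ENNReal.mul_ne_top ENNReal.ofReal_ne_top ENNReal.ofReal_ne_top), ENNReal.toReal_mul,
    ENNReal.toReal_mul, ENNReal.toReal_ofReal hvn.le, ENNReal.toReal_ofReal (by linarith),
    ENNReal.toReal_ofReal hwd] at h2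
  have h3 : ‖v‖ ^ 2 * (volume (K + segment ℝ (-v) v)).toReal =
      ‖v‖ ^ 2 * ((volume K).toReal + 2 * wd K (rot v)) := by rw [h2]; ring
  exact mul_left_cancel₀ hvn.ne' h3


/-! ### Part B: widths and the Steiner formula for zonotopes -/

/-- Planar convex bodies. -/
structure Body (K : Set E2) : Prop where
  cpt : IsCompact K
  cvx : Convex ℝ K
  ne : K.Nonempty

lemma Body.imgc {K : Set E2} (hK : Body K) (u : E2) :
    IsCompact ((fun x : E2 => inner ℝ u x) '' K) := hK.cpt.image (by fun_prop)

lemma Body.exists_max {K : Set E2} (hK : Body K) (u : E2) :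
    ∃ x ∈ K, ∀ y ∈ K, (inner ℝ u y : ℝ) ≤ inner ℝ u x := by
  obtain ⟨x, hx, h⟩ := hK.cpt.exists_isMaxOn hK.ne
    (f := fun x : E2 => (inner ℝ u x : ℝ)) (by fun_prop)
  exact ⟨x, hx, fun y hy => h hy⟩

lemma Body.exists_min {K : Set E2} (hK : Body K) (u : E2) :
    ∃ x ∈ K, ∀ y ∈ K, (inner ℝ u x : ℝ) ≤ inner ℝ u y := by
  obtain ⟨x, hx, h⟩ := hK.cpt.exists_isMinOn hK.ne
    (f := fun x : E2 => (inner ℝ u x : ℝ)) (by fun_prop)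
  exact ⟨x, hx, fun y hy => h hy⟩

lemma Body.le_wd {K : Set E2} (hK : Body K) (u : E2) {x y : E2} (hx : x ∈ K) (hy : y ∈ K) :
    (inner ℝ u x : ℝ) - inner ℝ u y ≤ wd K u := by
  have h1 := le_csSup (hK.imgc u).bddAbove (Set.mem_image_of_mem _ hx)
  have h2 := csInf_le (hK.imgc u).bddBelow (Set.mem_image_of_mem _ hy)
  unfold wd
  linarith

lemma Body.wd_eq {K : Set E2} (hK : Body K) {u : E2} {x y : E2} (hx : x ∈ K) (hy : y ∈ K)
    (hmx : ∀ z ∈ K, (inner ℝ u z : ℝ) ≤ inner ℝ u x)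
    (hmn : ∀ z ∈ K, (inner ℝ u y : ℝ) ≤ inner ℝ u z) :
    wd K u = inner ℝ u x - inner ℝ u y := by
  apply le_antisymm _ (hK.le_wd u hx hy)
  unfold wd
  have h1 : sSup ((fun x : E2 => inner ℝ u x) '' K) ≤ inner ℝ u x :=
    csSup_le (hK.ne.image _) (by rintro _ ⟨z, hz, rfl⟩; exact hmx z hz)
  have h2 : inner ℝ u y ≤ sInf ((fun x : E2 => inner ℝ u x) '' K) :=
    le_csInf (hK.ne.image _) (by rintro _ ⟨z, hz, rfl⟩; exact hmn z hz)
  linarith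

lemma Body.exists_wd {K : Set E2} (hK : Body K) (u : E2) :
    ∃ x ∈ K, ∃ y ∈ K, wd K u = inner ℝ u x - inner ℝ u y := by
  obtain ⟨x, hx, hmx⟩ := hK.exists_max u
  obtain ⟨y, hy, hmn⟩ := hK.exists_min u
  exact ⟨x, hx, y, hy, hK.wd_eq hx hy hmx hmn⟩

lemma Body.wd_le {K : Set E2} (hK : Body K) {u : E2} {c : ℝ}
    (h : ∀ x ∈ K, ∀ y ∈ K, (inner ℝ u x : ℝ) - inner ℝ u y ≤ c) : wd K u ≤ c := by
  obtain ⟨x, hx, y, hy, e⟩ := hK.exists_wd u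
  rw [e]; exact h x hx y hy

lemma Body.wd_nonneg {K : Set E2} (hK : Body K) (u : E2) : 0 ≤ wd K u := by
  obtain ⟨x, hx⟩ := hK.ne
  simpa using hK.le_wd u hx hx

lemma Body.wd_mono {K K' : Set E2} (hK : Body K) (hK' : Body K') (h : K ⊆ K') (u : E2) :
    wd K u ≤ wd K' u :=
  hK.wd_le fun _ hx _ hy => hK'.le_wd u (h hx) (h hy)

lemma Body.add {A B : Set E2} (hA : Body A) (hB : Body B) : Body (A + B) :=
  ⟨hA.cpt.add hB.cpt, hA.cvx.add hB.cvx, hA.ne.add hB.ne⟩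

lemma Body.wd_add {A B : Set E2} (hA : Body A) (hB : Body B) (u : E2) :
    wd (A + B) u = wd A u + wd B u := by
  apply le_antisymm
  · apply (hA.add hB).wd_le
    rintro _ ⟨a, ha, b, hb, rfl⟩ _ ⟨a', ha', b', hb', rfl⟩
    have := hA.le_wd u ha ha'
    have := hB.le_wd u hb hb'
    simp only [inner_add_right]
    linarith
  · obtain ⟨x, hx, y, hy, e⟩ := hA.exists_wd u
    obtain ⟨x', hx', y', hy', e'⟩ := hB.exists_wd u
    have := (hA.add hB).le_wd u (Set.add_mem_add hx hx') (Set.add_mem_add hy hy')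
    simp only [inner_add_right] at this
    linarith

lemma Body.wd_smul {K : Set E2} (hK : Body K) {t : ℝ} (ht : 0 ≤ t) (u : E2) :
    wd K (t • u) = t * wd K u := by
  apply le_antisymm
  · apply hK.wd_le
    intro x hx y hy
    have := hK.le_wd u hx hy
    simp only [real_inner_smul_left]
    nlinarith
  · obtain ⟨x, hx, y, hy, e⟩ := hK.exists_wd u
    have := hK.le_wd (t • u) hx hy
    simp only [real_inner_smul_left] at this
    rw [e]; linarith

lemma body_segment (v w : E2) : Body (segment ℝ v w) := by
  refine ⟨?_, convex_segment v w, ⟨v, left_mem_segment ℝ v w⟩⟩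
  rw [segment_eq_image_lineMap]
  exact isCompact_Icc.image (by fun_prop)

lemma body_singleton (v : E2) : Body {v} :=
  ⟨isCompact_singleton, convex_singleton v, Set.singleton_nonempty v⟩

lemma body_closedBall (c : E2) {r : ℝ} (hr : 0 ≤ r) : Body (closedBall c r) :=
  ⟨isCompact_closedBall c r, convex_closedBall c r, nonempty_closedBall.2 hr⟩

/-- Zonotope generated by a list of vectors. -/
def zono : List E2 → Set E2
  | [] => {0}
  | v :: L => segment ℝ (-v) v + zono L

lemma body_zono : ∀ L, Body (zono L)
  | [] => body_singleton 0
  | v :: L => (body_segment (-v) v).add (body_zono L)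

/-- Sum of widths orthogonal to the vectors of a list. -/
noncomputable def wsum (L : List E2) (K : Set E2) : ℝ := (L.map fun v => wd K (rot v)).sum

lemma wsum_nonneg (L : List E2) {K : Set E2} (hK : Body K) : 0 ≤ wsum L K := by
  apply List.sum_nonneg
  intro x hx
  obtain ⟨v, -, rfl⟩ := List.mem_map.1 hx
  exact hK.wd_nonneg _

lemma wsum_add (L : List E2) {A B : Set E2} (hA : Body A) (hB : Body B) :
    wsum L (A + B) = wsum L A + wsum L B := by
  unfold wsum
  simp_rw [hA.wd_add hB]
  rw [List.sum_map_add]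

lemma vol_zero_segment (v : E2) : (volume (segment ℝ (-v) v)).toReal = 0 := by
  have h := vol_add_segment (K := {0}) isCompact_singleton (convex_singleton _)
    (Set.singleton_nonempty _) v
  rw [Set.singleton_zero, zero_add] at h
  rw [h]
  have : wd (0 : Set E2) (rot v) = 0 := by
    rw [← Set.singleton_zero]; simp [wd]
  rw [this]
  rw [← Set.singleton_zero]
  simp

lemma steiner_zono : ∀ (L : List E2) {K : Set E2}, Body K →
    (volume (K + zono L)).toReal =
      (volume K).toReal + 2 * wsum L K + (volume (zono L)).toReal
  | [], K, hK => by simp [zono, wsum]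
  | v :: L, K, hK => by
    have hs := body_segment (-v) v
    have h1 := steiner_zono L (hK.add hs)
    have h2 := steiner_zono L hs
    rw [zono, ← add_assoc, h1, h2, wsum_add L hK hs, vol_add_segment hK.cpt hK.cvx hK.ne,
      vol_zero_segment]
    simp only [wsum, List.map_cons, List.sum_cons]
    ring

lemma rot_smul (t : ℝ) (v : E2) : rot (t • v) = t • rot v := by
  ext i; fin_cases i <;> simp [rot]

lemma smul_zono (t : ℝ) : ∀ L : List E2, t • zono L = zono (L.map (t • ·))
  | [] => by simp [zono]
  | v :: L => by
    rw [zono, smul_add, smul_zono t L, List.map_cons, zono]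
    congr 1
    rw [← smul_neg]
    have := image_segment ℝ ((LinearMap.lsmul ℝ E2 t).toAffineMap) (-v) v
    have h2 : (fun x : E2 => t • x) '' segment ℝ (-v) v = segment ℝ (t • -v) (t • v) := this
    rw [← h2, Set.image_smul]

lemma wsum_map_smul {t : ℝ} (ht : 0 ≤ t) (L : List E2) {K : Set E2} (hK : Body K) :
    wsum (L.map (t • ·)) K = t * wsum L K := by
  unfold wsum
  rw [List.map_map, ← List.sum_map_mul_left]
  congr 1
  apply List.map_congr_left
  intro v _
  simp only [Function.comp, rot_smul, hK.wd_smul ht]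

lemma steiner_zono_smul {t : ℝ} (ht : 0 ≤ t) (L : List E2) {K : Set E2} (hK : Body K) :
    (volume (K + t • zono L)).toReal =
      (volume K).toReal + t * (2 * wsum L K) + t ^ 2 * (volume (zono L)).toReal := by
  have hv : (volume (t • zono L)).toReal = t ^ 2 * (volume (zono L)).toReal := by
    rw [Measure.addHaar_smul]
    simp [ENNReal.toReal_mul]
    exact Or.inl (by positivity)
  rw [← hv, smul_zono, steiner_zono _ hK, wsum_map_smul ht L hK]
  ring

/-! support function of a zonotope -/

lemma zono_support_le (u : E2) : ∀ (L : List E2) (z : E2), z ∈ zono L →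
    (inner ℝ u z : ℝ) ≤ (L.map fun v => |inner ℝ u v|).sum
  | [], z, hz => by
    simp only [zono, Set.mem_singleton_iff] at hz; simp [hz]
  | v :: L, z, hz => by
    obtain ⟨_, ⟨a, b, ha, hb, hab, rfl⟩, z', hz', rfl⟩ := hz
    have h := zono_support_le u L z' hz'
    have h1 : (inner ℝ u (a • -v + b • v) : ℝ) ≤ |inner ℝ u v| := by
      simp only [inner_add_right, real_inner_smul_right, inner_neg_right]
      nlinarith [le_abs_self (inner ℝ u v : ℝ), neg_abs_le (inner ℝ u v : ℝ)]
    simp only [inner_add_right u _ z', List.map_cons, List.sum_cons]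
    linarith

lemma zono_support_attained (u : E2) : ∀ (L : List E2), ∃ z ∈ zono L,
    (inner ℝ u z : ℝ) = (L.map fun v => |inner ℝ u v|).sum
  | [] => ⟨0, rfl, by simp⟩
  | v :: L => by
    obtain ⟨z, hz, e⟩ := zono_support_attained u L
    rcases le_total 0 (inner ℝ u v : ℝ) with h | h
    · refine ⟨v + z, Set.add_mem_add (right_mem_segment _ _ _) hz, ?_⟩
      simp [inner_add_right, e, abs_of_nonneg h]
    · refine ⟨-v + z, Set.add_mem_add (left_mem_segment _ _ _) hz, ?_⟩
      simp [inner_add_right, e, abs_of_nonpos h]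

lemma closedBall_subset_zono {L : List E2} {ρ : ℝ}
    (h : ∀ u : E2, ρ * ‖u‖ ≤ (L.map fun v => |(inner ℝ u v : ℝ)|).sum) :
    closedBall 0 ρ ⊆ zono L := by
  intro x hx
  by_contra hxz
  have hb := body_zono L
  obtain ⟨f, s, h1, h2⟩ := geometric_hahn_banach_closed_point hb.cvx hb.cpt.isClosed hxz
  set u := (InnerProductSpace.toDual ℝ E2).symm f with hu
  have hf : ∀ y, f y = inner ℝ u y := fun y => by
    rw [hu, InnerProductSpace.toDual_symm_apply]
  obtain ⟨z, hz, e⟩ := zono_support_attained u L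
  have h3 := h1 z hz
  rw [hf, e] at h3
  rw [hf] at h2
  have h4 := real_inner_le_norm u x
  have h5 : ‖x‖ ≤ ρ := by simpa using hx
  have h6 := h u
  nlinarith [norm_nonneg u]

lemma zono_subset_closedBall {L : List E2}
    (h : ∀ u : E2, (L.map fun v => |(inner ℝ u v : ℝ)|).sum ≤ ‖u‖) :
    zono L ⊆ closedBall 0 1 := by
  intro z hz
  have h1 := (zono_support_le z L z hz).trans (h z)
  rw [real_inner_self_eq_norm_sq] at h1
  rw [mem_closedBall_zero_iff]
  nlinarith [norm_nonneg z]

/-! regular polygons -/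

/-- Support function of a regular polygon with an even number of sides. -/
noncomputable def gfun (n : ℕ) (φ : ℝ) : ℝ :=
  ∑ k ∈ Finset.range n, |Real.cos (φ - Real.pi * k / n)|

lemma gfun_periodic {n : ℕ} (hn : 0 < n) : Function.Periodic (gfun n) (Real.pi / n) := by
  intro φ
  have hn' : (n : ℝ) ≠ 0 := by positivity
  set a : ℕ → ℝ := fun j => |Real.cos (φ + Real.pi / n - Real.pi * j / n)| with ha
  have h1 := Finset.sum_range_succ a n
  have h2 := Finset.sum_range_succ' a n
  have h3 : a n = a 0 := by
    simp only [ha]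
    rw [show φ + Real.pi / n - Real.pi * n / n = φ + Real.pi / n - Real.pi by field_simp,
      Real.cos_sub_pi, abs_neg]
    simp
  have h4 : ∑ k ∈ Finset.range n, a (k + 1) = gfun n φ := by
    unfold gfun
    apply Finset.sum_congr rfl
    intro k _
    simp only [ha]
    congr 2
    push_cast
    field_simp
    ring
  have h5 : ∑ k ∈ Finset.range n, a k = gfun n (φ + Real.pi / n) := rfl
  linarith

lemma gfun_lip (n : ℕ) (φ ψ : ℝ) : gfun n φ - gfun n ψ ≤ n * |φ - ψ| := by
  unfold gfun
  rw [← Finset.sum_sub_distrib]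
  have : ∀ k ∈ Finset.range n, |Real.cos (φ - Real.pi * k / n)| -
      |Real.cos (ψ - Real.pi * k / n)| ≤ |φ - ψ| := by
    intro k _
    refine (abs_sub_abs_le_abs_sub _ _).trans ?_
    have h := Real.abs_cos_sub_cos_le (φ - Real.pi * k / n) (ψ - Real.pi * k / n)
    simpa using h
  simpa using Finset.sum_le_sum this

lemma gfun_osc {n : ℕ} (hn : 0 < n) (φ ψ : ℝ) : gfun n φ - gfun n ψ ≤ Real.pi := by
  have hn' : (0 : ℝ) < n := by positivity
  obtain ⟨y, hy, e⟩ := (gfun_periodic hn).exists_mem_Ico (by positivity) φ ψ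
  rw [e]
  refine (gfun_lip n y ψ).trans ?_
  rw [abs_of_nonneg (by linarith [hy.1])]
  have : y - ψ ≤ Real.pi / n := by linarith [hy.2]
  calc (n : ℝ) * (y - ψ) ≤ n * (Real.pi / n) := by gcongr
    _ = Real.pi := by field_simp

lemma gfun_lower {n : ℕ} (hn : 0 < n) (φ : ℝ) : (n - Real.pi) / 2 ≤ gfun n φ := by
  have h1 := gfun_osc hn (φ + Real.pi / 2) φ
  have h2 : (n : ℝ) ≤ gfun n φ + gfun n (φ + Real.pi / 2) := by
    unfold gfun
    rw [← Finset.sum_add_distrib]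
    have : ∀ k ∈ Finset.range n, (1 : ℝ) ≤ |Real.cos (φ - Real.pi * k / n)| +
        |Real.cos (φ + Real.pi / 2 - Real.pi * k / n)| := by
      intro k _
      rw [show φ + Real.pi / 2 - Real.pi * k / n = (φ - Real.pi * k / n) + Real.pi / 2 by ring,
        Real.cos_add_pi_div_two, abs_neg]
      set t := φ - Real.pi * k / n
      have hs := Real.sin_sq_add_cos_sq t
      have h1 := sq_abs (Real.sin t)
      have h2 := sq_abs (Real.cos t)
      nlinarith [abs_nonneg (Real.sin t), abs_nonneg (Real.cos t),
        Real.abs_sin_le_one t, Real.abs_cos_le_one t]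
    simpa using Finset.sum_le_sum this
  linarith

/-- Unit vector with angle `θ`. -/
noncomputable def dir (θ : ℝ) : E2 := !₂[Real.cos θ, Real.sin θ]

lemma exists_polar (u : E2) : ∃ φ, u = ‖u‖ • dir φ := by
  set z : ℂ := ⟨u 0, u 1⟩ with hz
  have hn : ‖z‖ = ‖u‖ := by
    have h1 : ‖z‖ ^ 2 = ‖u‖ ^ 2 := by
      rw [normsq2, Complex.sq_norm, Complex.normSq_apply]; ring
    exact (sq_eq_sq₀ (norm_nonneg _) (norm_nonneg _)).1 h1
  refine ⟨Complex.arg z, ?_⟩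
  rw [← hn]
  ext i
  fin_cases i
  · simp [dir, Complex.norm_mul_cos_arg, hz]
  · simp [dir, Complex.norm_mul_sin_arg, hz]

lemma exists_zono {δ : ℝ} (hδ : 0 < δ) : ∃ L : List E2,
    closedBall 0 (1 - δ) ⊆ zono L ∧ zono L ⊆ closedBall 0 1 := by
  obtain ⟨n, hn⟩ := exists_nat_gt (4 * Real.pi / δ + Real.pi)
  have hpi := Real.pi_pos
  have hnpos' : (0 : ℝ) < n := lt_trans (by positivity) hn
  have hn0 : 0 < n := by exact_mod_cast hnpos'
  have hg0 := gfun_lower hn0 0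
  have hg1 : 2 * Real.pi / δ ≤ gfun n 0 := by
    have : 4 * Real.pi / δ = 2 * (2 * Real.pi / δ) := by ring
    linarith
  have hgpos : 0 < gfun n 0 := lt_of_lt_of_le (by positivity) hg1
  set c := (gfun n 0 + Real.pi)⁻¹ with hc
  have hcpos : 0 < c := by positivity
  have hsum : ∀ u : E2, ∃ φ, ((((List.range n).map fun k : ℕ => c • dir (Real.pi * k / n)).map
      fun v => |(inner ℝ u v : ℝ)|).sum) = ‖u‖ * (c * gfun n φ) := by
    intro u
    obtain ⟨φ, hφ⟩ := exists_polar u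
    refine ⟨φ, ?_⟩
    rw [List.map_map, ← List.sum_toFinset _ List.nodup_range, List.toFinset_range, gfun,
      Finset.mul_sum, Finset.mul_sum]
    apply Finset.sum_congr rfl
    intro k _
    have : (inner ℝ u (c • dir (Real.pi * k / n)) : ℝ) =
        ‖u‖ * (c * Real.cos (φ - Real.pi * k / n)) := by
      conv_lhs => rw [hφ]
      rw [real_inner_smul_left, real_inner_smul_right, inner2, Real.cos_sub]
      simp [dir]
    simp only [Function.comp]
    rw [this, abs_mul, abs_mul, abs_norm, abs_of_pos hcpos]
  refine ⟨(List.range n).map fun k : ℕ => c • dir (Real.pi * k / n),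
    closedBall_subset_zono fun u => ?_, zono_subset_closedBall fun u => ?_⟩
  · obtain ⟨φ, e⟩ := hsum u
    rw [e, mul_comm]
    have h1 := gfun_osc hn0 0 φ
    have h2 : 1 - δ ≤ c * gfun n φ := by
      rw [hc, inv_mul_eq_div, le_div_iff₀ (by positivity)]
      have h3 : 2 * Real.pi ≤ δ * gfun n 0 := by
        rw [div_le_iff₀ hδ] at hg1; linarith
      nlinarith
    gcongr
  · obtain ⟨φ, e⟩ := hsum u
    rw [e]
    have h1 := gfun_osc hn0 φ 0
    have h2 : c * gfun n φ ≤ 1 := by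
      rw [hc, inv_mul_eq_div, div_le_one (by positivity)]
      linarith
    nlinarith [norm_nonneg u]


/-! ### Part C: the functional `V_1` -/

/-- Volume of the outer parallel body at distance `j`. -/
noncomputable def pv (K : Set E2) (j : ℝ) : ℝ := (volume (K + closedBall (0 : E2) j)).toReal

lemma ballVolume_one : ballVolume 1 = 2 := by
  unfold ballVolume
  rw [EuclideanSpace.volume_closedBall]
  have h : Real.Gamma (1 / 2 + 1) = √Real.pi / 2 := by
    rw [Real.Gamma_add_one (by norm_num), Real.Gamma_one_half_eq]; ring
  have h2 : √Real.pi ≠ 0 := by positivity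
  simp
  rw [show (2:ℝ)⁻¹ + 1 = 1 / 2 + 1 by norm_num, h, ENNReal.toReal_ofReal (by positivity)]
  field_simp

open Polynomial in
lemma V_eq (K : Set E2) : intrinsicVolume 2 1 K = (-3 * pv K 0 + 4 * pv K 1 - pv K 2) / 4 := by
  unfold intrinsicVolume
  set f : ℕ → ℝ := fun j => (volume (K + closedBall (0 : E2) (j : ℝ))).toReal with hf
  set P : ℝ[X] := C (f 0) + C ((-3 * f 0 + 4 * f 1 - f 2) / 2) * X
    + C ((f 0 - 2 * f 1 + f 2) / 2) * X ^ 2 with hP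
  have hdeg : P.degree < (Finset.range (2 + 1)).card := by
    rw [Finset.card_range]
    refine lt_of_le_of_lt (b := (2 : WithBot ℕ)) ?_ (by norm_num)
    rw [hP]
    compute_degree
  have h : Lagrange.interpolate (Finset.range (2 + 1)) (fun j : ℕ => (j : ℝ)) f = P := by
    symm
    apply Lagrange.eq_interpolate_of_eval_eq
    · intro a _ b _ hab; exact Nat.cast_injective (R := ℝ) hab
    · exact hdeg
    · intro i hi
      have : i = 0 ∨ i = 1 ∨ i = 2 := by
        rw [Finset.mem_range] at hi; omega
      rcases this with rfl | rfl | rfl <;> simp [hP] <;> ring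
  rw [h]
  have hc : P.coeff 1 = (-3 * f 0 + 4 * f 1 - f 2) / 2 := by
    rw [hP]
    simp [coeff_X, coeff_C, coeff_X_pow]
  show P.coeff 1 / ballVolume 1 = _
  rw [hc, ballVolume_one]
  simp only [hf, pv]
  push_cast
  ring

lemma V_empty : intrinsicVolume 2 1 (∅ : Set E2) = 0 := by
  rw [V_eq]; simp [pv]

lemma pv_zero (K : Set E2) : pv K 0 = (volume K).toReal := by
  simp [pv]

lemma toReal_vol_mono {A B : Set E2} (hB : IsCompact B) (h : A ⊆ B) :
    (volume A).toReal ≤ (volume B).toReal :=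
  ENNReal.toReal_mono hB.measure_lt_top.ne (measure_mono h)

lemma pv_bounds {K : Set E2} (hK : Body K) {δ : ℝ} (hδ0 : 0 < δ) (hδ : δ < 1) {L : List E2}
    (h1 : closedBall 0 (1 - δ) ⊆ zono L) (h2 : zono L ⊆ closedBall 0 1) {t : ℝ} (ht : 0 < t) :
    (volume K).toReal + t * (2 * wsum L K) + t ^ 2 * (volume (zono L)).toReal ≤ pv K t ∧
    pv K t ≤ (volume K).toReal + (t / (1 - δ)) * (2 * wsum L K)
      + (t / (1 - δ)) ^ 2 * (volume (zono L)).toReal := by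
  have hd : 0 < 1 - δ := by linarith
  constructor
  · rw [← steiner_zono_smul ht.le L hK]
    apply toReal_vol_mono (hK.cpt.add (isCompact_closedBall _ _))
    apply Set.add_subset_add_left
    calc t • zono L ⊆ t • closedBall 0 1 := Set.smul_set_mono h2
      _ = closedBall 0 t := by
        rw [_root_.smul_closedBall _ _ zero_le_one]; simp [abs_of_pos ht]
  · rw [← steiner_zono_smul (by positivity) L hK]
    apply toReal_vol_mono (hK.cpt.add ((body_zono L).cpt.smul _))
    apply Set.add_subset_add_left
    calc closedBall 0 t = (t / (1 - δ)) • closedBall (0 : E2) (1 - δ) := by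
          rw [_root_.smul_closedBall _ _ hd.le]
          simp only [smul_zero, Real.norm_eq_abs]
          rw [abs_of_pos (by positivity), div_mul_cancel₀ _ hd.ne']
      _ ⊆ (t / (1 - δ)) • zono L := Set.smul_set_mono h1

lemma V_approx {K : Set E2} (hK : Body K) {δ : ℝ} (hδ0 : 0 < δ) (hδ : δ < 1) {L : List E2}
    (h1 : closedBall 0 (1 - δ) ⊆ zono L) (h2 : zono L ⊆ closedBall 0 1) :
    |wsum L K - intrinsicVolume 2 1 K| ≤
      (((1 - δ)⁻¹ - 1) + ((1 - δ)⁻¹ ^ 2 - 1)) * (4 * pv K 1) := by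
  obtain ⟨a1, a2⟩ := pv_bounds hK hδ0 hδ h1 h2 (t := 1) one_pos
  obtain ⟨b1, b2⟩ := pv_bounds hK hδ0 hδ h1 h2 (t := 2) two_pos
  rw [V_eq, pv_zero]
  have hd : 0 < 1 - δ := by linarith
  have hη : 1 ≤ (1 - δ)⁻¹ := by rw [one_le_inv₀ hd]; linarith
  simp only [div_eq_mul_inv] at a2 b2
  set η := (1 - δ)⁻¹
  set S := wsum L K
  set ζ := (volume (zono L)).toReal
  set f0 := (volume K).toReal
  have hS : 0 ≤ S := wsum_nonneg L hK
  have hζ : 0 ≤ ζ := ENNReal.toReal_nonneg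
  have hf : 0 ≤ f0 := ENNReal.toReal_nonneg
  have hη2 : 0 ≤ η ^ 2 - 1 := by nlinarith
  have e1 := mul_nonneg (sub_nonneg.2 hη) hS
  have e2 := mul_nonneg (sub_nonneg.2 hη) hζ
  have e3 := mul_nonneg hη2 hζ
  have e4 := mul_nonneg hη2 hS
  have e5 := mul_nonneg hη2 hf
  have e6 := mul_nonneg (sub_nonneg.2 hη) hf
  have hM : S ≤ pv K 1 / 2 := by linarith
  have hM2 : ζ ≤ pv K 1 := by linarith
  have g1 := mul_le_mul_of_nonneg_left hM (sub_nonneg.2 hη)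
  have g2 := mul_le_mul_of_nonneg_left hM hη2
  have g3 := mul_le_mul_of_nonneg_left hM2 (sub_nonneg.2 hη)
  have g4 := mul_le_mul_of_nonneg_left hM2 hη2
  rw [abs_le]
  constructor <;> nlinarith

/-- An exhausting sequence of zonotopes. -/
noncomputable def Lseq (n : ℕ) : List E2 :=
  (exists_zono (δ := 1 / ((n : ℝ) + 2)) (by positivity)).choose

lemma Lseq_spec (n : ℕ) : closedBall 0 (1 - 1 / ((n : ℝ) + 2)) ⊆ zono (Lseq n) ∧
    zono (Lseq n) ⊆ closedBall 0 1 :=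
  (exists_zono (δ := 1 / ((n : ℝ) + 2)) (by positivity)).choose_spec

open Filter Topology in
lemma tendsto_wsum {K : Set E2} (hK : Body K) :
    Tendsto (fun n => wsum (Lseq n) K) atTop (𝓝 (intrinsicVolume 2 1 K)) := by
  rw [tendsto_iff_norm_sub_tendsto_zero]
  have h0 : Tendsto (fun n : ℕ => (1 : ℝ) / ((n : ℝ) + 2)) atTop (𝓝 0) := by
    have := tendsto_one_div_add_atTop_nhds_zero_nat (𝕜 := ℝ)
    have h := (tendsto_add_atTop_iff_nat (f := fun n : ℕ => (1 : ℝ) / ((n : ℝ) + 1)) 1).2 this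
    refine h.congr fun n => ?_
    push_cast; ring
  have hi : Tendsto (fun n : ℕ => (1 - (1 : ℝ) / ((n : ℝ) + 2))⁻¹) atTop (𝓝 1) := by
    have := (h0.const_sub 1).inv₀ (by norm_num)
    simpa using this
  have hb : Tendsto (fun n : ℕ => (((1 - (1 : ℝ) / ((n : ℝ) + 2))⁻¹ - 1) +
      ((1 - (1 : ℝ) / ((n : ℝ) + 2))⁻¹ ^ 2 - 1)) * (4 * pv K 1)) atTop (𝓝 0) := by
    have := (((hi.sub_const 1).add ((hi.pow 2).sub_const 1))).mul_const (4 * pv K 1)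
    simpa using this
  refine squeeze_zero (fun _ => norm_nonneg _) (fun n => ?_) hb
  rw [Real.norm_eq_abs]
  refine V_approx hK (by positivity) ?_ (Lseq_spec n).1 (Lseq_spec n).2
  rw [div_lt_one (by positivity)]
  have : (0 : ℝ) ≤ n := by positivity
  linarith

/-- Shorthand for the first intrinsic volume in the plane. -/
noncomputable abbrev V1 (K : Set E2) : ℝ := intrinsicVolume 2 1 K

lemma V1_add {A B : Set E2} (hA : Body A) (hB : Body B) : V1 (A + B) = V1 A + V1 B := by
  refine tendsto_nhds_unique (tendsto_wsum (hA.add hB)) ?_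
  refine ((tendsto_wsum hA).add (tendsto_wsum hB)).congr fun n => ?_
  rw [wsum_add _ hA hB]

lemma V1_le_of_wd {A B : Set E2} (hA : Body A) (hB : Body B)
    (h : ∀ u : E2, ‖u‖ = 1 → wd A u ≤ wd B u) : V1 A ≤ V1 B := by
  refine le_of_tendsto_of_tendsto' (tendsto_wsum hA) (tendsto_wsum hB) fun n => ?_
  apply List.sum_le_sum
  intro v _
  by_cases h0 : rot v = 0
  · have e : rot v = (0 : ℝ) • rot v := by rw [h0]; simp
    rw [e, hA.wd_smul le_rfl, hB.wd_smul le_rfl]; simp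
  · have hn : ‖rot v‖ ≠ 0 := norm_ne_zero_iff.2 h0
    have e : rot v = ‖rot v‖ • (‖rot v‖⁻¹ • rot v) := by
      rw [smul_smul, mul_inv_cancel₀ hn, one_smul]
    rw [e, hA.wd_smul (norm_nonneg _), hB.wd_smul (norm_nonneg _)]
    refine mul_le_mul_of_nonneg_left (h _ ?_) (norm_nonneg _)
    rw [norm_smul, norm_inv, norm_norm, inv_mul_cancel₀ hn]

lemma V1_mono {A B : Set E2} (hA : Body A) (hB : Body B) (h : A ⊆ B) : V1 A ≤ V1 B :=
  V1_le_of_wd hA hB fun u _ => hA.wd_mono hB h u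

lemma V1_nonneg {A : Set E2} (hA : Body A) : 0 ≤ V1 A :=
  ge_of_tendsto' (tendsto_wsum hA) fun n => wsum_nonneg _ hA

lemma pv_ball (c : E2) {r t : ℝ} (hr : 0 ≤ r) (ht : 0 ≤ t) :
    pv (closedBall c r) t = Real.pi * (r + t) ^ 2 := by
  unfold pv
  rw [closedBall_add_closedBall hr ht, add_zero, EuclideanSpace.volume_closedBall_fin_two]
  rw [ENNReal.toReal_mul, ENNReal.toReal_pow, ENNReal.toReal_ofReal (by positivity)]
  rw [ENNReal.toReal_ofReal Real.pi_pos.le]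
  ring

lemma V1_ball (c : E2) {r : ℝ} (hr : 0 ≤ r) : V1 (closedBall c r) = Real.pi * r := by
  rw [V1, V_eq, pv_ball c hr le_rfl, pv_ball c hr zero_le_one, pv_ball c hr zero_le_two]
  ring

lemma wd_ball {r : ℝ} (hr : 0 ≤ r) (c u : E2) : wd (closedBall c r) u = 2 * r * ‖u‖ := by
  have hb := body_closedBall c hr
  apply le_antisymm
  · apply hb.wd_le
    intro x hx y hy
    rw [← inner_sub_right]
    refine (real_inner_le_norm _ _).trans ?_
    have : ‖x - y‖ ≤ 2 * r := by
      rw [← dist_eq_norm]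
      calc dist x y ≤ dist x c + dist y c := dist_triangle_right _ _ _
        _ ≤ r + r := add_le_add hx hy
        _ = 2 * r := by ring
    nlinarith [norm_nonneg u]
  · by_cases h0 : ‖u‖ = 0
    · rw [h0]; simpa using hb.wd_nonneg u
    · have hm : ∀ s : ℝ, |s| = r → c + (s / ‖u‖) • u ∈ closedBall c r := by
        intro s hs
        rw [mem_closedBall, dist_eq_norm, add_sub_cancel_left, norm_smul, norm_div, norm_norm,
          div_mul_cancel₀ _ h0, Real.norm_eq_abs, hs]
      have := hb.le_wd u (hm r (abs_of_nonneg hr)) (hm (-r) (by rw [abs_neg, abs_of_nonneg hr]))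
      rw [← inner_sub_right] at this
      refine le_trans (le_of_eq ?_) this
      rw [show c + (r / ‖u‖) • u - (c + (-r / ‖u‖) • u) = (2 * (r / ‖u‖)) • u by module,
        real_inner_smul_right, real_inner_self_eq_norm_sq]
      field_simp

lemma norm_rot (v : E2) : ‖rot v‖ = ‖v‖ := by
  have : ‖rot v‖ ^ 2 = ‖v‖ ^ 2 := by
    rw [normsq2, normsq2]; simp [rot]; ring
  exact (sq_eq_sq₀ (norm_nonneg _) (norm_nonneg _)).1 this

lemma pv_segment (v : E2) {t : ℝ} (ht : 0 ≤ t) :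
    pv (segment ℝ (-v) v) t = Real.pi * t ^ 2 + 4 * t * ‖v‖ := by
  have hb := body_closedBall (0 : E2) ht
  have h := vol_add_segment hb.cpt hb.cvx hb.ne v
  unfold pv
  rw [add_comm, h, wd_ball ht, norm_rot, EuclideanSpace.volume_closedBall_fin_two,
    ENNReal.toReal_mul, ENNReal.toReal_pow, ENNReal.toReal_ofReal ht]
  rw [ENNReal.toReal_ofReal Real.pi_pos.le]
  ring

lemma V1_segment (v : E2) : V1 (segment ℝ (-v) v) = 2 * ‖v‖ := by
  rw [V1, V_eq, pv_segment v le_rfl, pv_segment v zero_le_one, pv_segment v zero_le_two]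
  ring

lemma wd_segment (v u : E2) : wd (segment ℝ (-v) v) u = 2 * |(inner ℝ v u : ℝ)| := by
  have hb := body_segment (-v) v
  have hl := left_mem_segment ℝ (-v) v
  have hr := right_mem_segment ℝ (-v) v
  rw [real_inner_comm]
  apply le_antisymm
  · apply hb.wd_le
    have key : ∀ x ∈ segment ℝ (-v) v, |(inner ℝ u x : ℝ)| ≤ |(inner ℝ u v : ℝ)| := by
      rintro _ ⟨a, b, ha, hb, hab, rfl⟩
      simp only [inner_add_right, real_inner_smul_right, inner_neg_right]
      rw [abs_le]
      constructor <;> nlinarith [le_abs_self (inner ℝ u v : ℝ), neg_abs_le (inner ℝ u v : ℝ)]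
    intro x hx y hy
    have h1 := abs_le.1 (key x hx)
    have h2 := abs_le.1 (key y hy)
    linarith [h1.2, h2.1]
  · have h1 := hb.le_wd u hl hr
    have h2 := hb.le_wd u hr hl
    simp only [inner_neg_right] at h1 h2
    rcases abs_cases (inner ℝ u v : ℝ) with h | h <;> linarith

lemma pv_image (f : E2 ≃ᵢ E2) (hf : MeasurePreserving f volume volume) (K : Set E2)
    (g : E2 ≃ₗᵢ[ℝ] E2) (hg : ∀ x y, f (x + y) = f x + g y) (t : ℝ) : pv (f '' K) t = pv K t := by
  have : f '' K + closedBall 0 t = f '' (K + closedBall 0 t) := by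
    have hgb : g '' closedBall 0 t = closedBall 0 t := by
      have := g.image_closedBall 0 t
      simpa using this
    conv_lhs => rw [← hgb]
    ext z
    simp only [Set.mem_add, Set.mem_image]
    constructor
    · rintro ⟨_, ⟨x, hx, rfl⟩, _, ⟨y, hy, rfl⟩, rfl⟩
      exact ⟨x + y, ⟨x, hx, y, hy, rfl⟩, hg x y⟩
    · rintro ⟨_, ⟨x, hx, y, hy, rfl⟩, rfl⟩
      exact ⟨_, ⟨x, hx, rfl⟩, _, ⟨y, hy, rfl⟩, (hg x y).symm⟩
  unfold pv
  rw [this]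
  congr 1
  have h := hf.measure_preimage_equiv (f := f.toHomeomorph.toMeasurableEquiv) (f '' (K + closedBall 0 t))
  rw [← h]
  congr 1
  exact f.injective.preimage_image _

lemma V1_translate (c : E2) (K : Set E2) : V1 ((fun x => c + x) '' K) = V1 K := by
  have h : ∀ t, pv ((fun x => c + x) '' K) t = pv K t := fun t =>
    pv_image (IsometryEquiv.addLeft c) (measurePreserving_add_left volume c) K
      (LinearIsometryEquiv.refl ℝ E2) (fun x y => by simp [add_assoc]) t
  unfold V1
  rw [V_eq, V_eq, h, h, h]

lemma V1_isometry (g : E2 ≃ₗᵢ[ℝ] E2) (K : Set E2) : V1 (g '' K) = V1 K := by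
  have h : ∀ t, pv (g '' K) t = pv K t := fun t =>
    pv_image g.toIsometryEquiv g.measurePreserving K g (fun x y => by simp) t
  unfold V1
  rw [V_eq, V_eq, h, h, h]

/-! ### Part D: lenses, elementary bounds, Jung -/

/-- Intersection of two disks. -/
def lens (r : ℝ) (a b : E2) : Set E2 := closedBall a r ∩ closedBall b r

lemma lens_comm (r : ℝ) (a b : E2) : lens r a b = lens r b a := Set.inter_comm _ _

lemma body_lens {r : ℝ} {a b : E2} (h : (lens r a b).Nonempty) : Body (lens r a b) :=
  ⟨(isCompact_closedBall _ _).inter_right isClosed_closedBall,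
    (convex_closedBall _ _).inter (convex_closedBall _ _), h⟩

lemma exists_isometry {v w : E2} (h : ‖v‖ = ‖w‖) : ∃ g : E2 ≃ₗᵢ[ℝ] E2, g v = w :=
  ⟨_, Submodule.reflection_sub h⟩

lemma lens_image_translate (r : ℝ) (c a b : E2) :
    (fun x => c + x) '' lens r a b = lens r (c + a) (c + b) := by
  unfold lens
  rw [Set.image_inter (add_right_injective c)]
  simp [add_comm c]

lemma lens_image_isometry (r : ℝ) (g : E2 ≃ₗᵢ[ℝ] E2) (a b : E2) :
    g '' lens r a b = lens r (g a) (g b) := by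
  unfold lens
  rw [Set.image_inter g.injective, g.image_closedBall, g.image_closedBall]

lemma lens_sub_of_mem {r : ℝ} {a b c : E2} (h : c ∈ segment ℝ a b) :
    lens r a b ⊆ closedBall c r := by
  rintro x ⟨h1, h2⟩
  rw [mem_closedBall_comm] at *
  exact (convex_closedBall x r).segment_subset h1 h2 h

lemma V1_lens_center (r : ℝ) (a b : E2) :
    V1 (lens r a b) = V1 (lens r (-((1 / 2 : ℝ) • (b - a))) ((1 / 2 : ℝ) • (b - a))) := by
  rw [← V1_translate ((1 / 2 : ℝ) • (a + b)) (lens r (-((1 / 2 : ℝ) • (b - a))) _),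
    lens_image_translate]
  congr 2 <;> module

lemma lens_nonempty_of_dist {r : ℝ} {a b : E2} (h : dist a b ≤ 2 * r) :
    (lens r a b).Nonempty := by
  refine ⟨midpoint ℝ a b, ?_, ?_⟩ <;> rw [mem_closedBall]
  · rw [dist_midpoint_left]; simp; linarith
  · rw [dist_midpoint_right]; simp; linarith

lemma dist_of_lens_nonempty {r : ℝ} {a b : E2} (h : (lens r a b).Nonempty) :
    dist a b ≤ 2 * r := by
  obtain ⟨x, h1, h2⟩ := h
  rw [mem_closedBall] at h1 h2
  have := dist_triangle_left a b x
  linarith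

lemma V1_lens_le {r : ℝ} {a b c d : E2} (hne : (lens r a b).Nonempty)
    (h : dist c d ≤ dist a b) : V1 (lens r a b) ≤ V1 (lens r c d) := by
  have hd := dist_of_lens_nonempty hne
  rw [V1_lens_center r a b, V1_lens_center r c d]
  set v := (1 / 2 : ℝ) • (b - a) with hv
  set w := (1 / 2 : ℝ) • (d - c) with hw
  have hnv : ‖v‖ = dist a b / 2 := by
    rw [hv, norm_smul, dist_eq_norm, norm_sub_rev]; norm_num; ring
  have hnw : ‖w‖ = dist c d / 2 := by
    rw [hw, norm_smul, dist_eq_norm, norm_sub_rev]; norm_num; ring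
  have hvw : ‖w‖ ≤ ‖v‖ := by rw [hnv, hnw]; linarith
  have hdist : ∀ z : E2, dist (-z) z = 2 * ‖z‖ := fun z => by
    rw [dist_eq_norm, show -z - z = (-2 : ℝ) • z by module, norm_smul]; norm_num
  have key : ∃ g : E2 ≃ₗᵢ[ℝ] E2, ∃ s : ℝ, 0 ≤ s ∧ s ≤ 1 ∧ w = s • g v := by
    by_cases h0 : v = 0
    · refine ⟨LinearIsometryEquiv.refl ℝ E2, 0, le_rfl, zero_le_one, ?_⟩
      rw [h0, norm_zero] at hvw
      simpa using hvw
    have hv0 : 0 < ‖v‖ := norm_pos_iff.2 h0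
    by_cases h1 : w = 0
    · exact ⟨LinearIsometryEquiv.refl ℝ E2, 0, le_rfl, zero_le_one, by simpa using h1⟩
    · have hw0 : 0 < ‖w‖ := norm_pos_iff.2 h1
      obtain ⟨g, hg⟩ := exists_isometry (v := v) (w := (‖v‖ / ‖w‖) • w) (by
        rw [norm_smul (‖v‖ / ‖w‖), norm_div, norm_norm, norm_norm]; field_simp)
      refine ⟨g, ‖w‖ / ‖v‖, by positivity, (div_le_one hv0).2 hvw, ?_⟩
      rw [hg, smul_smul]
      field_simp
      simp
  obtain ⟨g, s, hs0, hs1, e⟩ := key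
  rw [← V1_isometry g (lens r (-v) v), lens_image_isometry, map_neg]
  apply V1_mono (body_lens (lens_nonempty_of_dist _)) (body_lens (lens_nonempty_of_dist _))
  · rw [e]
    refine Set.subset_inter (lens_sub_of_mem ?_) (lens_sub_of_mem ?_)
    · exact ⟨(1 + s) / 2, (1 - s) / 2, by linarith, by linarith, by ring, by module⟩
    · exact ⟨(1 - s) / 2, (1 + s) / 2, by linarith, by linarith, by ring, by module⟩
  · rw [hdist, g.norm_map, hnv]; linarith
  · rw [hdist, hnw]; linarith

lemma inner_ball {r : ℝ} {u x p : E2} (hu : ‖u‖ = 1) (hx : x ∈ closedBall p r) :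
    |(inner ℝ u x : ℝ) - inner ℝ u p| ≤ r := by
  rw [← inner_sub_right]
  refine (abs_real_inner_le_norm _ _).trans ?_
  rw [hu, one_mul, ← dist_eq_norm]
  exact hx

lemma wd_two {K : Set E2} (hK : Body K) {r : ℝ} {u a b : E2} (hu : ‖u‖ = 1)
    (ha : K ⊆ closedBall a r) (hb : K ⊆ closedBall b r) :
    wd K u + |(inner ℝ u a : ℝ) - inner ℝ u b| ≤ 2 * r := by
  obtain ⟨x, hx, y, hy, e⟩ := hK.exists_wd u
  rw [e]
  have h1 := abs_le.1 (inner_ball hu (ha hx))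
  have h2 := abs_le.1 (inner_ball hu (ha hy))
  have h3 := abs_le.1 (inner_ball hu (hb hx))
  have h4 := abs_le.1 (inner_ball hu (hb hy))
  rcases abs_cases ((inner ℝ u a : ℝ) - inner ℝ u b) with h | h <;> linarith [h1.1, h1.2, h2.1, h2.2, h3.1, h3.2, h4.1, h4.2]

lemma V1_add_segs {B : Set E2} (hB : Body B) : ∀ (L : List E2) {K : Set E2} (_ : Body K)
    (_ : ∀ u : E2, ‖u‖ = 1 → wd K u + (L.map fun e => |(inner ℝ e u : ℝ)|).sum ≤ wd B u),
    V1 K + (L.map fun e => ‖e‖).sum ≤ V1 B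
  | [], K, hK, h => by
    simp only [List.map_nil, List.sum_nil, add_zero] at h ⊢
    exact V1_le_of_wd hK hB h
  | e :: L, K, hK, h => by
    have hs := body_segment (-((1 / 2 : ℝ) • e)) ((1 / 2 : ℝ) • e)
    have := V1_add_segs hB L (hK.add hs) (fun u hu => by
      have h1 := h u hu
      rw [hK.wd_add hs, wd_segment, real_inner_smul_left, abs_mul,
        abs_of_pos (by norm_num : (0 : ℝ) < 1 / 2)]
      simp only [List.map_cons, List.sum_cons] at h1
      linarith)
    rw [V1_add hK hs, V1_segment, norm_smul] at this
    simp only [List.map_cons, List.sum_cons]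
    norm_num at this
    linarith

lemma V1_tri {K : Set E2} (hK : Body K) {r : ℝ} (hr : 0 ≤ r) {a b c : E2}
    (ha : K ⊆ closedBall a r) (hb : K ⊆ closedBall b r) (hc : K ⊆ closedBall c r) :
    V1 K + (dist a b + dist b c + dist a c) / 2 ≤ Real.pi * r := by
  have h := V1_add_segs (body_closedBall (0 : E2) hr)
    [(1 / 2 : ℝ) • (a - b), (1 / 2 : ℝ) • (b - c), (1 / 2 : ℝ) • (a - c)] hK (by
      intro u hu
      have h1 := wd_two hK hu ha hb
      have h2 := wd_two hK hu hb hc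
      have h3 := wd_two hK hu ha hc
      rw [wd_ball hr, hu]
      simp only [List.map_cons, List.map_nil, List.sum_cons, List.sum_nil, real_inner_smul_right,
        abs_mul, abs_of_pos (by norm_num : (0 : ℝ) < 1 / 2), inner_sub_right,
        real_inner_comm u]
      rcases abs_cases ((inner ℝ u a : ℝ) - inner ℝ u b) with h4 | h4 <;>
      rcases abs_cases ((inner ℝ u b : ℝ) - inner ℝ u c) with h5 | h5 <;>
      rcases abs_cases ((inner ℝ u a : ℝ) - inner ℝ u c) with h6 | h6 <;> linarith)
  rw [V1_ball _ hr] at h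
  simp only [List.map_cons, List.map_nil, List.sum_cons, List.sum_nil, norm_smul] at h
  norm_num at h
  simp only [dist_eq_norm]
  linarith

lemma V1_cross {K : Set E2} (hK : Body K) {r : ℝ} (hr : 0 ≤ r) {a b c d z : E2}
    (ha : K ⊆ closedBall a r) (hb : K ⊆ closedBall b r) (hc : K ⊆ closedBall c r)
    (hd : K ⊆ closedBall d r) (hz1 : z ∈ segment ℝ a c) (hz2 : z ∈ segment ℝ b d) :
    V1 K + (dist a b + dist b c + dist c d + dist a d) / 2 ≤ Real.pi * r := by
  have hbt : ∀ u a c : E2, z ∈ segment ℝ a c →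
      ((inner ℝ u a : ℝ) ≤ inner ℝ u z ∧ (inner ℝ u z : ℝ) ≤ inner ℝ u c) ∨
      ((inner ℝ u c : ℝ) ≤ inner ℝ u z ∧ (inner ℝ u z : ℝ) ≤ inner ℝ u a) := by
    rintro u a c ⟨s, t, hs, ht, hst, rfl⟩
    simp only [inner_add_right, real_inner_smul_right]
    have : s = 1 - t := by linarith
    subst this
    rcases le_total (inner ℝ u a : ℝ) (inner ℝ u c) with h | h
    · left; constructor <;> nlinarith
    · right; constructor <;> nlinarith
  have h := V1_add_segs (body_closedBall (0 : E2) hr)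
    [(1 / 2 : ℝ) • (a - b), (1 / 2 : ℝ) • (b - c), (1 / 2 : ℝ) • (c - d), (1 / 2 : ℝ) • (a - d)]
    hK (by
      intro u hu
      have h1 := wd_two hK hu ha hb
      have h2 := wd_two hK hu hb hc
      have h3 := wd_two hK hu hc hd
      have h3' := wd_two hK hu ha hd
      have h8 := wd_two hK hu ha hc
      have h9 := wd_two hK hu hb hd
      have h8' := le_abs_self ((inner ℝ u a : ℝ) - inner ℝ u c)
      have h9' := le_abs_self ((inner ℝ u b : ℝ) - inner ℝ u d)
      have h8'' := neg_le_abs ((inner ℝ u a : ℝ) - inner ℝ u c)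
      have h9'' := neg_le_abs ((inner ℝ u b : ℝ) - inner ℝ u d)
      rw [wd_ball hr, hu]
      simp only [List.map_cons, List.map_nil, List.sum_cons, List.sum_nil, real_inner_smul_right,
        abs_mul, abs_of_pos (by norm_num : (0 : ℝ) < 1 / 2), inner_sub_right,
        real_inner_comm u]
      rcases hbt u a c hz1 with ⟨k1, k2⟩ | ⟨k1, k2⟩ <;>
      rcases hbt u b d hz2 with ⟨k3, k4⟩ | ⟨k3, k4⟩ <;>
      rcases abs_cases ((inner ℝ u a : ℝ) - inner ℝ u b) with h4 | h4 <;>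
      rcases abs_cases ((inner ℝ u b : ℝ) - inner ℝ u c) with h5 | h5 <;>
      rcases abs_cases ((inner ℝ u c : ℝ) - inner ℝ u d) with h6 | h6 <;>
      rcases abs_cases ((inner ℝ u a : ℝ) - inner ℝ u d) with h7 | h7 <;> linarith)
  rw [V1_ball _ hr] at h
  simp only [List.map_cons, List.map_nil, List.sum_cons, List.sum_nil, norm_smul] at h
  norm_num at h
  simp only [dist_eq_norm]
  linarith

/-! ### Part E: Jung theorem and the case of at least four points -/

lemma jung_identity {ι : Type*} [Fintype ι] (q : ι → E2) (t : ι → ℝ) (ht : ∑ i, t i = 1) :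
    ∑ i, ∑ j, t i * t j * ‖q i - q j‖ ^ 2 =
      2 * (∑ i, t i * ‖q i‖ ^ 2 - ‖∑ i, t i • q i‖ ^ 2) := by
  have h1 : ‖∑ i, t i • q i‖ ^ 2 = ∑ i, ∑ j, t i * t j * (inner ℝ (q i) (q j) : ℝ) := by
    rw [← real_inner_self_eq_norm_sq, sum_inner]
    refine Finset.sum_congr rfl fun i _ => ?_
    rw [inner_sum]
    refine Finset.sum_congr rfl fun j _ => ?_
    rw [real_inner_smul_left, real_inner_smul_right]; ring
  have h2 : ∑ i, ∑ j, t i * t j * ‖q i‖ ^ 2 = ∑ i, t i * ‖q i‖ ^ 2 := by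
    refine Finset.sum_congr rfl fun i _ => ?_
    have : ∀ j, t i * t j * ‖q i‖ ^ 2 = (t i * ‖q i‖ ^ 2) * t j := fun j => by ring
    simp_rw [this]
    rw [← Finset.mul_sum, ht, mul_one]
  have h3 : ∑ i, ∑ j, t i * t j * ‖q j‖ ^ 2 = ∑ i, t i * ‖q i‖ ^ 2 := by
    rw [Finset.sum_comm, ← h2]
    refine Finset.sum_congr rfl fun i _ => Finset.sum_congr rfl fun j _ => by ring
  have h4 : ∑ i, ∑ j, t i * t j * ‖q i - q j‖ ^ 2 = ∑ i, ∑ j, t i * t j * ‖q i‖ ^ 2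
      + ∑ i, ∑ j, t i * t j * ‖q j‖ ^ 2
      - 2 * ∑ i, ∑ j, t i * t j * (inner ℝ (q i) (q j) : ℝ) := by
    rw [Finset.mul_sum, ← Finset.sum_add_distrib, ← Finset.sum_sub_distrib]
    refine Finset.sum_congr rfl fun i _ => ?_
    rw [Finset.mul_sum, ← Finset.sum_add_distrib, ← Finset.sum_sub_distrib]
    refine Finset.sum_congr rfl fun j _ => ?_
    rw [norm_sub_sq_real]; ring
  rw [h4, h2, h3, h1]; ring

lemma jung_bound {ι : Type*} [Fintype ι] [Nonempty ι] (hc : Fintype.card ι ≤ 3) (q : ι → E2)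
    {lam : ℝ} (hq : ∀ i j, i ≠ j → dist (q i) (q j) ≤ lam) (t : ι → ℝ)
    (ht0 : ∀ i, 0 ≤ t i) (ht : ∑ i, t i = 1) :
    ∑ i, t i * ‖q i‖ ^ 2 - ‖∑ i, t i • q i‖ ^ 2 ≤ lam ^ 2 / 3 := by
  classical
  have h1 := jung_identity q t ht
  have h2 : ∑ i, ∑ j, t i * t j * ‖q i - q j‖ ^ 2 ≤
      ∑ i, (t i - t i ^ 2) * lam ^ 2 := by
    refine Finset.sum_le_sum fun i _ => ?_
    have : (t i - t i ^ 2) * lam ^ 2 = ∑ j, (if i = j then 0 else t i * t j * lam ^ 2) := by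
      have h3 : ∀ j, (if i = j then 0 else t i * t j * lam ^ 2) =
          (t i * lam ^ 2) * t j - (if i = j then t i * t j * lam ^ 2 else 0) := by
        intro j; split_ifs <;> ring
      simp_rw [h3]
      rw [Finset.sum_sub_distrib, ← Finset.mul_sum, ht]
      simp
      ring
    rw [this]
    refine Finset.sum_le_sum fun j _ => ?_
    split_ifs with h
    · simp [h]
    · have h4 := hq i j h
      rw [dist_eq_norm] at h4
      have := mul_nonneg (ht0 i) (ht0 j)
      gcongr
  have h5 : (∑ i, t i) ^ 2 ≤ (Fintype.card ι : ℝ) * ∑ i, t i ^ 2 := by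
    have := sq_sum_le_card_mul_sum_sq (s := Finset.univ) (f := t)
    simpa using this
  rw [← Finset.sum_mul, Finset.sum_sub_distrib, ht] at h2
  rw [ht] at h5
  have hc' : (Fintype.card ι : ℝ) ≤ 3 := by exact_mod_cast hc
  have h6 : 0 ≤ ∑ i, t i ^ 2 := Finset.sum_nonneg fun i _ => sq_nonneg _
  have h7 : 1 / 3 ≤ ∑ i, t i ^ 2 := by nlinarith
  nlinarith [sq_nonneg lam]

lemma jung_small {ι : Type*} [Fintype ι] [Nonempty ι] (hc : Fintype.card ι ≤ 3) (q : ι → E2)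
    {lam : ℝ} (hq : ∀ i j, i ≠ j → dist (q i) (q j) ≤ lam) :
    ∃ c, ∀ i, ‖q i - c‖ ^ 2 ≤ lam ^ 2 / 3 := by
  classical
  set g : (ι → ℝ) → ℝ := fun t => ∑ i, t i * ‖q i‖ ^ 2 - ‖∑ i, t i • q i‖ ^ 2 with hg
  have hcont : Continuous g := by fun_prop
  obtain ⟨t, ht, hmax⟩ := (isCompact_stdSimplex ℝ ι).exists_isMaxOn
    (by obtain ⟨i⟩ := ‹Nonempty ι›; exact ⟨_, single_mem_stdSimplex ℝ i⟩) hcont.continuousOn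
  set c := ∑ i, t i • q i with hcdef
  have hgt := jung_bound hc q hq t ht.1 ht.2
  refine ⟨c, fun i => ?_⟩
  have key : ∀ s : ℝ, 0 < s → s < 1 → (1 - s) * ‖q i - c‖ ^ 2 ≤ g t := by
    intro s hs0 hs1
    have hm := hmax ((convex_stdSimplex ℝ ι) ht (single_mem_stdSimplex ℝ i)
      (by linarith : 0 ≤ 1 - s) hs0.le (by ring))
    have e : g ((1 - s) • t + s • Pi.single i 1) =
        (1 - s) * g t + s * (1 - s) * ‖q i - c‖ ^ 2 := by
      have e1 : ∑ j, ((1 - s) • t + s • Pi.single i (1 : ℝ) : ι → ℝ) j • q j = (1 - s) • c + s • q i := by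
        simp only [Pi.add_apply, Pi.smul_apply, smul_eq_mul, add_smul, Finset.sum_add_distrib,
          mul_smul, ← Finset.smul_sum]
        simp [Pi.single_apply, ite_smul, hcdef]
      have e2 : ∑ j, ((1 - s) • t + s • Pi.single i (1 : ℝ) : ι → ℝ) j * ‖q j‖ ^ 2 =
          (1 - s) * (∑ j, t j * ‖q j‖ ^ 2) + s * ‖q i‖ ^ 2 := by
        simp only [Pi.add_apply, Pi.smul_apply, smul_eq_mul, add_mul, Finset.sum_add_distrib,
          mul_assoc, ← Finset.mul_sum]
        simp [Pi.single_apply]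
      simp only [hg]
      rw [e1, e2, ← hcdef, norm_add_sq_real, norm_sub_sq_real, norm_smul, norm_smul,
        real_inner_smul_left, real_inner_smul_right, real_inner_comm c, mul_pow, mul_pow,
        Real.norm_eq_abs, Real.norm_eq_abs, sq_abs, sq_abs]
      ring
    have hm' : g ((1 - s) • t + s • Pi.single i 1) ≤ g t := hm
    rw [e] at hm'
    have : s * ((1 - s) * ‖q i - c‖ ^ 2) ≤ s * g t := by linarith
    exact le_of_mul_le_mul_left this hs0
  have : ‖q i - c‖ ^ 2 ≤ g t := by
    by_contra hlt
    push Not at hlt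
    have hpos : 0 < ‖q i - c‖ ^ 2 := by
      have h1 := key (1 / 2) (by norm_num) (by norm_num)
      nlinarith [sq_nonneg ‖q i - c‖]
    have hg0 : 0 ≤ g t := by
      have h1 := key (1 / 2) (by norm_num) (by norm_num)
      nlinarith [sq_nonneg ‖q i - c‖]
    set A := ‖q i - c‖ ^ 2
    have h1 := key ((A - g t) / (2 * A)) (div_pos (by linarith) (by linarith))
      (by rw [div_lt_one (by linarith)]; linarith)
    have h2 : (1 - (A - g t) / (2 * A)) * A = (A + g t) / 2 := by field_simp; ring
    linarith
  exact this.trans hgt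

lemma finrank_E2 : Module.finrank ℝ E2 = 2 := by simp [E2]

lemma jung {N : ℕ} (q : Fin N → E2) {lam : ℝ} (hl : 0 ≤ lam)
    (hq : ∀ i j, i ≠ j → dist (q i) (q j) ≤ lam) :
    ∃ c, ∀ i, dist (q i) c ≤ lam / √3 := by
  have h := Convex.helly_theorem' (𝕜 := ℝ) (F := fun i => closedBall (q i) (lam / √3))
    (s := Finset.univ) (fun i _ => convex_closedBall _ _) (by
      intro I _ hI
      rw [finrank_E2] at hI
      by_cases hne : I.Nonempty
      · have : Nonempty I := hne.to_subtype
        obtain ⟨c, hc⟩ := jung_small (ι := I) (by simpa using hI) (fun i => q i) (lam := lam)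
          (fun i j hij => hq i j (fun h => hij (Subtype.ext h)))
        refine ⟨c, ?_⟩
        simp only [Set.mem_iInter]
        intro i hi
        rw [mem_closedBall, dist_comm, dist_eq_norm]
        refine (sq_le_sq₀ (norm_nonneg _) (by positivity)).1 ?_
        rw [div_pow, Real.sq_sqrt (by norm_num)]
        exact hc ⟨i, hi⟩
      · rw [Finset.not_nonempty_iff_eq_empty] at hne
        simp [hne])
  obtain ⟨c, hc⟩ := h
  simp only [Set.mem_iInter, mem_closedBall] at hc
  exact ⟨c, fun i => by rw [dist_comm]; exact hc i (Finset.mem_univ i)⟩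

/-- The intersection of the disks. -/
def cap {N : ℕ} (r : ℝ) (p : Fin N → E2) : Set E2 := ⋂ i, closedBall (p i) r

lemma cap_sub {N : ℕ} (r : ℝ) (p : Fin N → E2) (i : Fin N) : cap r p ⊆ closedBall (p i) r :=
  Set.iInter_subset _ i

lemma body_cap {N : ℕ} {r : ℝ} {p : Fin N → E2} (hN : 0 < N) (h : (cap r p).Nonempty) :
    Body (cap r p) :=
  ⟨(isCompact_closedBall (p ⟨0, hN⟩) r).of_isClosed_subset
      (isClosed_iInter fun _ => isClosed_closedBall) (cap_sub r p _),
    convex_iInter fun _ => convex_closedBall _ _, h⟩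

lemma jung_V1 {N : ℕ} (hN : 0 < N) (q : Fin N → E2) {lam r : ℝ} (hl : 0 ≤ lam)
    (hlr : lam ^ 2 ≤ 3 * r ^ 2) (hr : 0 ≤ r)
    (hq : ∀ i j, i ≠ j → dist (q i) (q j) ≤ lam) :
    (cap r q).Nonempty ∧ Real.pi * (r - lam / √3) ≤ V1 (cap r q) := by
  obtain ⟨c, hc⟩ := jung q hl hq
  have h0 : 0 ≤ r - lam / √3 := by
    rw [sub_nonneg]
    refine (sq_le_sq₀ (by positivity) hr).1 ?_
    rw [div_pow, Real.sq_sqrt (by norm_num)]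
    linarith
  have hsub : closedBall c (r - lam / √3) ⊆ cap r q := by
    apply Set.subset_iInter
    intro i
    apply closedBall_subset_closedBall'
    have := hc i
    rw [dist_comm] at this
    linarith
  have hne : (cap r q).Nonempty := (nonempty_closedBall.2 h0).mono hsub
  refine ⟨hne, ?_⟩
  rw [← V1_ball c h0]
  exact V1_mono (body_closedBall c h0) (body_cap hN hne) hsub

lemma lam_le {r lam : ℝ} (hl : 0 ≤ lam) {a b c x : E2} (ha : x ∈ closedBall a r)
    (hb : x ∈ closedBall b r) (hc : x ∈ closedBall c r) (h1 : lam ≤ dist a b)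
    (h2 : lam ≤ dist b c) (h3 : lam ≤ dist a c) : lam ^ 2 ≤ 3 * r ^ 2 := by
  rw [mem_closedBall', dist_eq_norm] at ha hb hc
  have e1 : dist a b = ‖(a - x) - (b - x)‖ := by rw [dist_eq_norm]; congr 1; abel
  have e2 : dist b c = ‖(b - x) - (c - x)‖ := by rw [dist_eq_norm]; congr 1; abel
  have e3 : dist a c = ‖(a - x) - (c - x)‖ := by rw [dist_eq_norm]; congr 1; abel
  rw [e1] at h1
  rw [e2] at h2
  rw [e3] at h3
  generalize a - x = a at *
  generalize b - x = b at *
  generalize c - x = c at *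
  have k1 := pow_le_pow_left₀ hl h1 2
  have k2 := pow_le_pow_left₀ hl h2 2
  have k3 := pow_le_pow_left₀ hl h3 2
  have k4 := pow_le_pow_left₀ (norm_nonneg _) ha 2
  have k5 := pow_le_pow_left₀ (norm_nonneg _) hb 2
  have k6 := pow_le_pow_left₀ (norm_nonneg _) hc 2
  have k7 := sq_nonneg ‖a + b + c‖
  rw [norm_add_sq_real, norm_add_sq_real, inner_add_left] at k7
  rw [norm_sub_sq_real] at k1 k2 k3
  linarith

lemma num1 {lam r : ℝ} (hl : 0 ≤ lam) : Real.pi * r - 2 * lam ≤ Real.pi * (r - lam / √3) := by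
  have h3 : (√3 : ℝ) ^ 2 = 3 := Real.sq_sqrt (by norm_num)
  have hp : 0 < √3 := by positivity
  have h : Real.pi / √3 ≤ 2 := by
    rw [div_le_iff₀ hp]
    nlinarith [Real.pi_lt_d2]
  have := mul_le_mul_of_nonneg_right h hl
  have e : Real.pi * (r - lam / √3) = Real.pi * r - Real.pi / √3 * lam := by ring
  linarith

lemma num2 {lam r : ℝ} (hl : 0 ≤ lam) :
    Real.pi * r - (1 + √3 / 2) * lam ≤ Real.pi * (r - lam / √3) := by
  have h3 : (√3 : ℝ) ^ 2 = 3 := Real.sq_sqrt (by norm_num)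
  have hp : 0 < √3 := by positivity
  have h17 : 1.7 ≤ √3 := by
    apply Real.le_sqrt_of_sq_le; norm_num
  have h : Real.pi / √3 ≤ 1 + √3 / 2 := by
    rw [div_le_iff₀ hp]
    nlinarith [Real.pi_lt_d2]
  have := mul_le_mul_of_nonneg_right h hl
  have e : Real.pi * (r - lam / √3) = Real.pi * r - Real.pi / √3 * lam := by ring
  linarith

/-! ### Part F: at least four points -/

lemma wide_pair {a b c d : E2} {lam : ℝ} (hl : 0 < lam) (h : d ∈ convexHull ℝ {a, b, c})
    (ha : lam ≤ dist a d) (hb : lam ≤ dist b d) (hc : lam ≤ dist c d) :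
    √3 * lam ≤ dist a b ∨ √3 * lam ≤ dist b c ∨ √3 * lam ≤ dist a c := by
  rw [convexHull_insert (by simp), convexHull_pair] at h
  simp only [mem_convexJoin, Set.mem_singleton_iff, exists_eq_left] at h
  obtain ⟨e, ⟨s', t', hs', ht', hst', rfl⟩, ⟨s, t, hs, ht, hst, hd⟩⟩ := h
  by_contra hcon
  push Not at hcon
  obtain ⟨k1, k2, k3⟩ := hcon
  set x := a - d with hx
  set y := b - d with hy
  set z := c - d with hz
  have e1 : dist a b = ‖x - y‖ := by rw [dist_eq_norm]; congr 1; rw [hx, hy]; abel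
  have e2 : dist b c = ‖y - z‖ := by rw [dist_eq_norm]; congr 1; rw [hz, hy]; abel
  have e3 : dist a c = ‖x - z‖ := by rw [dist_eq_norm]; congr 1; rw [hx, hz]; abel
  rw [dist_eq_norm, ← hx] at ha
  rw [dist_eq_norm, ← hy] at hb
  rw [dist_eq_norm, ← hz] at hc
  rw [e1] at k1
  rw [e2] at k2
  rw [e3] at k3
  have h3 : (√3 : ℝ) ^ 2 = 3 := Real.sq_sqrt (by norm_num)
  have hsum : s • x + (t * s') • y + (t * t') • z = 0 := by
    have : s • x + (t * s') • y + (t * t') • z =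
        (s • a + t • (s' • b + t' • c)) - (s + t * (s' + t')) • d := by
      rw [hx, hy, hz]; module
    rw [this, hst', mul_one, hst, one_smul, hd, sub_self]
  have htot : s + t * s' + t * t' = 1 := by
    rw [add_assoc, ← mul_add, hst', mul_one, hst]
  have hb0 : 0 ≤ t * s' := mul_nonneg ht hs'
  have hc0 : 0 ≤ t * t' := mul_nonneg ht ht'
  generalize t * s' = β at *
  generalize t * t' = γ at *
  have aux : ∀ v w : E2, lam ≤ ‖v‖ → lam ≤ ‖w‖ → ‖v - w‖ < √3 * lam →
      0 < 2 * (inner ℝ v w : ℝ) + ‖v‖ * ‖w‖ := by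
    intro v w hv hw hvw
    have h1 := pow_lt_pow_left₀ hvw (norm_nonneg _) (two_ne_zero)
    rw [norm_sub_sq_real, mul_pow, h3] at h1
    nlinarith [mul_nonneg (sub_nonneg.2 hv) (sub_nonneg.2 hw)]
  have p1 := aux x y ha hb k1
  have p2 := aux y z hb hc k2
  have p3 := aux x z ha hc k3
  have hn : ‖s • x + β • y + γ • z‖ ^ 2 = 0 := by rw [hsum]; simp
  rw [norm_add_sq_real, norm_add_sq_real, inner_add_left, norm_smul, norm_smul, norm_smul] at hn
  simp only [real_inner_smul_left, real_inner_smul_right, Real.norm_eq_abs, abs_of_nonneg hs,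
    abs_of_nonneg hb0, abs_of_nonneg hc0] at hn
  have hX : 0 < ‖x‖ := by linarith
  have hY : 0 < ‖y‖ := by linarith
  have hZ : 0 < ‖z‖ := by linarith
  have m1 := mul_nonneg (mul_nonneg hs hb0) p1.le
  have m2 := mul_nonneg (mul_nonneg hb0 hc0) p2.le
  have m3 := mul_nonneg (mul_nonneg hs hc0) p3.le
  have S := sq_nonneg (s * ‖x‖ - β * ‖y‖)
  have S2 := sq_nonneg (γ * ‖z‖ - β * ‖y‖)
  have S3 := sq_nonneg (s * ‖x‖ - γ * ‖z‖)
  have tot : ((s * ‖x‖ - β * ‖y‖) ^ 2 + (γ * ‖z‖ - β * ‖y‖) ^ 2 + (s * ‖x‖ - γ * ‖z‖) ^ 2) / 2 +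
      s * β * (2 * (inner ℝ x y : ℝ) + ‖x‖ * ‖y‖) + β * γ * (2 * (inner ℝ y z : ℝ) + ‖y‖ * ‖z‖) +
      s * γ * (2 * (inner ℝ x z : ℝ) + ‖x‖ * ‖z‖) = 0 := by
    linear_combination hn
  have z1 : s * β * (2 * (inner ℝ x y : ℝ) + ‖x‖ * ‖y‖) = 0 := by linarith
  have z2 : β * γ * (2 * (inner ℝ y z : ℝ) + ‖y‖ * ‖z‖) = 0 := by linarith
  have z3 : s * γ * (2 * (inner ℝ x z : ℝ) + ‖x‖ * ‖z‖) = 0 := by linarith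
  have y1 : s * β = 0 := (mul_eq_zero.1 z1).resolve_right p1.ne'
  have y2 : β * γ = 0 := (mul_eq_zero.1 z2).resolve_right p2.ne'
  have y3 : s * γ = 0 := (mul_eq_zero.1 z3).resolve_right p3.ne'
  have hn2 : (s * ‖x‖) ^ 2 + (β * ‖y‖) ^ 2 + (γ * ‖z‖) ^ 2 = 0 := by
    have q1 : s * (β * (inner ℝ x y : ℝ)) = 0 := by rw [← mul_assoc, y1, zero_mul]
    have q2 : β * (γ * (inner ℝ y z : ℝ)) = 0 := by rw [← mul_assoc, y2, zero_mul]
    have q3 : s * (γ * (inner ℝ x z : ℝ)) = 0 := by rw [← mul_assoc, y3, zero_mul]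
    linear_combination hn - 2*q1 - 2*q2 - 2*q3
  have w1 : s * ‖x‖ = 0 := by
    apply pow_eq_zero_iff two_ne_zero |>.1
    linarith [sq_nonneg (s * ‖x‖), sq_nonneg (β * ‖y‖), sq_nonneg (γ * ‖z‖)]
  have w2 : β * ‖y‖ = 0 := by
    apply pow_eq_zero_iff two_ne_zero |>.1
    linarith [sq_nonneg (s * ‖x‖), sq_nonneg (β * ‖y‖), sq_nonneg (γ * ‖z‖)]
  have w3 : γ * ‖z‖ = 0 := by
    apply pow_eq_zero_iff two_ne_zero |>.1
    linarith [sq_nonneg (s * ‖x‖), sq_nonneg (β * ‖y‖), sq_nonneg (γ * ‖z‖)]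
  have v1 := (mul_eq_zero.1 w1).resolve_right hX.ne'
  have v2 := (mul_eq_zero.1 w2).resolve_right hY.ne'
  have v3 := (mul_eq_zero.1 w3).resolve_right hZ.ne'
  linarith

lemma four_tri {K : Set E2} (hK : Body K) {r lam : ℝ} (hr : 0 ≤ r) (hl : 0 < lam)
    {a b c d : E2} (ha : K ⊆ closedBall a r) (hb : K ⊆ closedBall b r)
    (hc : K ⊆ closedBall c r) (hd : K ⊆ closedBall d r) (h : d ∈ convexHull ℝ {a, b, c})
    (had : lam ≤ dist a d) (hbd : lam ≤ dist b d) (hcd : lam ≤ dist c d) :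
    V1 K ≤ Real.pi * (r - lam / √3) := by
  refine le_trans ?_ (num2 hl.le)
  rcases wide_pair hl h had hbd hcd with k | k | k
  · have := V1_tri hK hr ha hb hd; linarith
  · have := V1_tri hK hr hb hc hd; linarith
  · have := V1_tri hK hr ha hc hd; linarith

lemma four_cross {K : Set E2} (hK : Body K) {r lam : ℝ} (hr : 0 ≤ r) (hl : 0 < lam)
    {a b c d z : E2} (ha : K ⊆ closedBall a r) (hb : K ⊆ closedBall b r)
    (hc : K ⊆ closedBall c r) (hd : K ⊆ closedBall d r)
    (hz1 : z ∈ segment ℝ a c) (hz2 : z ∈ segment ℝ b d)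
    (hab : lam ≤ dist a b) (hbc : lam ≤ dist b c) (hcd : lam ≤ dist c d) (had : lam ≤ dist a d) :
    V1 K ≤ Real.pi * (r - lam / √3) := by
  refine le_trans ?_ (num1 hl.le)
  have := V1_cross hK hr ha hb hc hd hz1 hz2
  linarith

lemma four_points {K : Set E2} (hK : Body K) {r lam : ℝ} (hr : 0 ≤ r) (hl : 0 < lam)
    (p : Fin 4 → E2) (hp : ∀ i, K ⊆ closedBall (p i) r)
    (hd : ∀ i j, i ≠ j → lam ≤ dist (p i) (p j)) : V1 K ≤ Real.pi * (r - lam / √3) := by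
  have hna : ¬ AffineIndependent ℝ p := by
    intro h
    have := h.card_le_finrank_succ
    have h2 := Submodule.finrank_le (vectorSpan ℝ (Set.range p))
    rw [finrank_E2] at h2
    simp at this
    omega
  obtain ⟨I, hI⟩ := Convex.radon_partition hna
  wlog h0 : (0 : Fin 4) ∉ I generalizing I
  · refine this Iᶜ ?_ (by simpa using h0)
    rw [compl_compl, Set.inter_comm]
    exact hI
  obtain ⟨z, hz1, hz2⟩ := hI
  have D : ∀ {i j}, i ≠ j → lam ≤ dist (p i) (p j) := fun {i j} h => hd i j h
  by_cases h1 : (1 : Fin 4) ∈ I <;> by_cases h2 : (2 : Fin 4) ∈ I <;>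
    by_cases h3 : (3 : Fin 4) ∈ I
  · have e1 : I = {1, 2, 3} := by ext i; fin_cases i <;> simp [*]
    have e2 : Iᶜ = {0} := by rw [e1]; ext i; fin_cases i <;> simp
    rw [e2, Set.image_singleton, convexHull_singleton] at hz2
    rw [e1, Set.image_insert_eq, Set.image_pair, hz2] at hz1
    exact four_tri hK hr hl (hp 1) (hp 2) (hp 3) (hp 0) hz1 (D (by decide)) (D (by decide))
      (D (by decide))
  · have e1 : I = {1, 2} := by ext i; fin_cases i <;> simp [*]
    have e2 : Iᶜ = {0, 3} := by rw [e1]; ext i; fin_cases i <;> simp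
    rw [e2, Set.image_pair, convexHull_pair] at hz2
    rw [e1, Set.image_pair, convexHull_pair] at hz1
    exact four_cross hK hr hl (hp _) (hp _) (hp _) (hp _) hz1 hz2 (D (by decide)) (D (by decide))
      (D (by decide)) (D (by decide))
  · have e1 : I = {1, 3} := by ext i; fin_cases i <;> simp [*]
    have e2 : Iᶜ = {0, 2} := by rw [e1]; ext i; fin_cases i <;> simp
    rw [e2, Set.image_pair, convexHull_pair] at hz2
    rw [e1, Set.image_pair, convexHull_pair] at hz1
    exact four_cross hK hr hl (hp _) (hp _) (hp _) (hp _) hz1 hz2 (D (by decide)) (D (by decide))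
      (D (by decide)) (D (by decide))
  · have e1 : I = {1} := by ext i; fin_cases i <;> simp [*]
    have e2 : Iᶜ = {0, 2, 3} := by rw [e1]; ext i; fin_cases i <;> simp
    rw [e1, Set.image_singleton, convexHull_singleton] at hz1
    rw [e2, Set.image_insert_eq, Set.image_pair, hz1] at hz2
    exact four_tri hK hr hl (hp _) (hp _) (hp _) (hp _) hz2 (D (by decide)) (D (by decide))
      (D (by decide))
  · have e1 : I = {2, 3} := by ext i; fin_cases i <;> simp [*]
    have e2 : Iᶜ = {0, 1} := by rw [e1]; ext i; fin_cases i <;> simp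
    rw [e2, Set.image_pair, convexHull_pair] at hz2
    rw [e1, Set.image_pair, convexHull_pair] at hz1
    exact four_cross hK hr hl (hp _) (hp _) (hp _) (hp _) hz1 hz2 (D (by decide)) (D (by decide))
      (D (by decide)) (D (by decide))
  · have e1 : I = {2} := by ext i; fin_cases i <;> simp [*]
    have e2 : Iᶜ = {0, 1, 3} := by rw [e1]; ext i; fin_cases i <;> simp
    rw [e1, Set.image_singleton, convexHull_singleton] at hz1
    rw [e2, Set.image_insert_eq, Set.image_pair, hz1] at hz2
    exact four_tri hK hr hl (hp _) (hp _) (hp _) (hp _) hz2 (D (by decide)) (D (by decide))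
      (D (by decide))
  · have e1 : I = {3} := by ext i; fin_cases i <;> simp [*]
    have e2 : Iᶜ = {0, 1, 2} := by rw [e1]; ext i; fin_cases i <;> simp
    rw [e1, Set.image_singleton, convexHull_singleton] at hz1
    rw [e2, Set.image_insert_eq, Set.image_pair, hz1] at hz2
    exact four_tri hK hr hl (hp _) (hp _) (hp _) (hp _) hz2 (D (by decide)) (D (by decide))
      (D (by decide))
  · have e1 : I = ∅ := by ext i; fin_cases i <;> simp [*]
    rw [e1] at hz1
    simp at hz1
/-! ### Part G: three points, directional identity -/

lemma inner_decomp {u : E2} (hu : ‖u‖ = 1) (x z : E2) :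
    (inner ℝ x z : ℝ) = inner ℝ u x * inner ℝ u z + inner ℝ (rot u) x * inner ℝ (rot u) z := by
  have h := normsq2 u
  rw [hu] at h
  simp only [inner2, rot] at *
  simp
  linear_combination (x 0 * z 0 + x 1 * z 1) * h

/-- `H` is the maximum of the linear functional `u` over the lens of `a`, `b`. -/
def MX (u : E2) (r : ℝ) (a b : E2) (H : ℝ) : Prop :=
  (∃ h, dist h a ≤ r ∧ dist h b ≤ r ∧ (inner ℝ u h : ℝ) = H) ∧
    ∀ z, dist z a ≤ r → dist z b ≤ r → (inner ℝ u z : ℝ) ≤ H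

lemma MX.symm {u : E2} {r : ℝ} {a b : E2} {H : ℝ} (h : MX u r a b H) : MX u r b a H := by
  obtain ⟨⟨x, h1, h2, h3⟩, h4⟩ := h
  exact ⟨⟨x, h2, h1, h3⟩, fun z k1 k2 => h4 z k2 k1⟩

lemma refl1 (a b z : E2) : dist (a + b - z) a = dist z b := by
  rw [dist_eq_norm, dist_eq_norm, ← norm_neg]; congr 1; abel

lemma refl2 (a b z : E2) : dist (a + b - z) b = dist z a := by
  rw [dist_eq_norm, dist_eq_norm, ← norm_neg]; congr 1; abel

lemma MX.neg {u : E2} {r : ℝ} {a b : E2} {H : ℝ} (h : MX u r a b H) :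
    MX (-u) r a b (H - inner ℝ u a - inner ℝ u b) := by
  obtain ⟨⟨x, h1, h2, h3⟩, h4⟩ := h
  refine ⟨⟨a + b - x, by rwa [refl1], by rwa [refl2], ?_⟩, fun z k1 k2 => ?_⟩
  · rw [inner_neg_left, inner_sub_right, inner_add_right, h3]; ring
  · have := h4 (a + b - z) (by rwa [refl1]) (by rwa [refl2])
    rw [inner_sub_right, inner_add_right] at this
    rw [inner_neg_left]; linarith

lemma inner_le_ball {u : E2} (hu : ‖u‖ = 1) {a z : E2} {r : ℝ} (h : dist z a ≤ r) :
    (inner ℝ u z : ℝ) ≤ inner ℝ u a + r := by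
  have h1 := real_inner_le_norm u (z - a)
  rw [hu, one_mul, ← dist_eq_norm, inner_sub_right] at h1
  linarith

lemma MX.le {u : E2} (hu : ‖u‖ = 1) {r : ℝ} {a b : E2} {H : ℝ} (h : MX u r a b H) :
    H ≤ inner ℝ u a + r ∧ H ≤ inner ℝ u b + r := by
  obtain ⟨⟨x, h1, h2, h3⟩, h4⟩ := h
  rw [← h3]
  exact ⟨inner_le_ball hu h1, inner_le_ball hu h2⟩

lemma dist_top {u : E2} (hu : ‖u‖ = 1) {r : ℝ} (hr : 0 ≤ r) (a : E2) : dist (a + r • u) a = r := by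
  rw [dist_eq_norm, add_sub_cancel_left, norm_smul, hu, mul_one, Real.norm_of_nonneg hr]

lemma inner_top {u : E2} (hu : ‖u‖ = 1) (r : ℝ) (a : E2) :
    (inner ℝ u (a + r • u) : ℝ) = inner ℝ u a + r := by
  rw [inner_add_right, real_inner_smul_right, real_inner_self_eq_norm_sq, hu]; ring

lemma MX.active {u : E2} (hu : ‖u‖ = 1) {r : ℝ} (hr : 0 ≤ r) {a b x : E2}
    (h : MX u r a b (inner ℝ u x)) (ha : dist x a ≤ r) (hb : dist x b ≤ r)
    (hlt : (inner ℝ u x : ℝ) < inner ℝ u a + r) : dist x b = r := by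
  by_contra hne
  have hlt2 : dist x b < r := lt_of_le_of_ne hb hne
  have hc : Continuous fun t : ℝ => dist (AffineMap.lineMap x (a + r • u) t) b := by
    have : Continuous fun t : ℝ => (AffineMap.lineMap x (a + r • u) t : E2) :=
      AffineMap.lineMap_continuous
    fun_prop
  have hev : ∀ᶠ t in nhdsWithin (0 : ℝ) (Set.Ioi 0),
      dist (AffineMap.lineMap x (a + r • u) t) b < r := by
    apply (hc.tendsto 0).mono_left nhdsWithin_le_nhds |>.eventually_lt_const
    simpa using hlt2
  have hev2 : ∀ᶠ t in nhdsWithin (0 : ℝ) (Set.Ioi 0), t ∈ Set.Ioo (0 : ℝ) 1 :=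
    Ioo_mem_nhdsGT one_pos
  obtain ⟨t, ht, ht0, ht1⟩ := (hev.and hev2).exists
  have hin : dist (AffineMap.lineMap x (a + r • u) t) a ≤ r := by
    have := (convex_closedBall a r).lineMap_mem (mem_closedBall.2 ha)
      (mem_closedBall.2 (dist_top hu hr a).le) ⟨ht0.le, ht1.le⟩
    exact mem_closedBall.1 this
  have := h.2 _ hin ht.le
  rw [AffineMap.lineMap_apply_module, inner_add_right, real_inner_smul_right,
    real_inner_smul_right, inner_top hu] at this
  nlinarith

lemma mid_ball {a x y : E2} {r : ℝ} (hx : dist x a ≤ r) (hy : dist y a ≤ r) :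
    dist (midpoint ℝ x y) a ≤ r := by
  have := (convex_closedBall a r).midpoint_mem (mem_closedBall.2 hx) (mem_closedBall.2 hy)
  exact mem_closedBall.1 this

lemma mid_ball_eq {a x y : E2} {r : ℝ} (hx : dist x a ≤ r) (hy : dist y a ≤ r)
    (h : dist (midpoint ℝ x y) a = r) : x = y := by
  have h1 := parallelogram_law_with_norm ℝ (x - a) (y - a)
  have h2 : x - a + (y - a) = (2 : ℝ) • (midpoint ℝ x y - a) := by
    rw [midpoint_eq_smul_add, invOf_eq_inv]; module
  rw [h2, norm_smul, ← dist_eq_norm _ a, h, sub_sub_sub_cancel_right, ← dist_eq_norm x a,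
    ← dist_eq_norm y a] at h1
  have hx2 := pow_le_pow_left₀ dist_nonneg hx 2
  have hy2 := pow_le_pow_left₀ dist_nonneg hy 2
  have h3 : ‖x - y‖ ^ 2 ≤ 0 := by
    norm_num at h1
    nlinarith
  have h4 : ‖x - y‖ = 0 := by
    apply pow_eq_zero_iff two_ne_zero |>.1
    linarith [sq_nonneg ‖x - y‖]
  exact sub_eq_zero.1 (norm_eq_zero.1 h4)

lemma MX.unique {u : E2} (hu : ‖u‖ = 1) {r : ℝ} (hr : 0 ≤ r) {a b x y : E2}
    (h : MX u r a b (inner ℝ u x)) (hxa : dist x a ≤ r) (hxb : dist x b ≤ r)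
    (hya : dist y a ≤ r) (hyb : dist y b ≤ r) (hxy : (inner ℝ u y : ℝ) = inner ℝ u x)
    (hlt : (inner ℝ u x : ℝ) < inner ℝ u a + r) : x = y := by
  apply mid_ball_eq hxb hyb
  have e : (inner ℝ u (midpoint ℝ x y) : ℝ) = inner ℝ u x := by
    rw [midpoint_eq_smul_add, real_inner_smul_right, inner_add_right, hxy, invOf_eq_inv]; ring
  apply MX.active hu hr (a := a) (by rwa [e]) (mid_ball hxa hya) (mid_ball hxb hyb) (by rwa [e])

/-- Lens lemma. -/
lemma lens_lemma_aux {e g z w : E2} {r : ℝ} (he : (inner ℝ g e : ℝ) = 0)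
    (hr : ‖g‖ ^ 2 + ‖e‖ ^ 2 = r ^ 2)
    (z1 : ‖z - g‖ ^ 2 ≤ r ^ 2) (z2 : ‖z + g‖ ^ 2 ≤ r ^ 2)
    (w1 : ‖w - e‖ ^ 2 ≤ r ^ 2) (w2 : ‖w + e‖ ^ 2 ≤ r ^ 2) : ‖w - z‖ ^ 2 ≤ r ^ 2 := by
  rw [norm_sub_sq_real] at z1 w1 ⊢
  rw [norm_add_sq_real] at z2 w2
  by_cases hg : g = 0
  · have hw : ‖w‖ ^ 2 ≤ 0 := by rw [hg, norm_zero] at hr; nlinarith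
    have hw0 : ‖w‖ = 0 := by
      apply pow_eq_zero_iff two_ne_zero |>.1
      linarith [sq_nonneg ‖w‖]
    rw [norm_eq_zero] at hw0
    rw [hg, norm_zero, inner_zero_right] at z1
    rw [hw0, norm_zero, inner_zero_left]
    linarith
  have hgp : 0 < ‖g‖ := norm_pos_iff.2 hg
  obtain ⟨u, hu, hgu⟩ : ∃ u : E2, ‖u‖ = 1 ∧ g = ‖g‖ • u := by
    refine ⟨‖g‖⁻¹ • g, ?_, ?_⟩
    · rw [norm_smul, norm_inv, norm_norm, inv_mul_cancel₀ hgp.ne']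
    · rw [smul_smul, mul_inv_cancel₀ hgp.ne', one_smul]
  generalize ‖g‖ = G at *
  subst hgu
  rw [real_inner_smul_left] at he
  have he0 : (inner ℝ u e : ℝ) = 0 := (mul_eq_zero.1 he).resolve_left hgp.ne'
  have d1 := inner_decomp hu w z
  have d2 := inner_decomp hu w e
  have d3 := inner_decomp hu w w
  have d4 := inner_decomp hu z z
  have d5 := inner_decomp hu e e
  rw [real_inner_self_eq_norm_sq] at d3 d4 d5
  rw [real_inner_smul_right, real_inner_comm] at z1 z2
  rw [he0] at d2 d5
  rw [d2, d3, d5] at w1 w2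
  rw [d4] at z1 z2
  rw [d1, d3, d4]
  rw [d5] at hr
  generalize (inner ℝ u w : ℝ) = w0 at *
  generalize (inner ℝ (rot u) w : ℝ) = w1' at *
  generalize (inner ℝ u z : ℝ) = z0 at *
  generalize (inner ℝ (rot u) z : ℝ) = z1' at *
  generalize (inner ℝ (rot u) e : ℝ) = f at *
  clear d1 d2 d3 d4 d5 he he0 hg
  have hw0 : |w0| ≤ G := abs_le_of_sq_le_sq (by nlinarith) hgp.le
  have hz1 : |z1'| ≤ |f| := sq_le_sq.1 (by nlinarith)
  have A : -(w0 * z0) ≤ G * |z0| := by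
    calc -(w0 * z0) ≤ |w0 * z0| := neg_le_abs _
      _ = |w0| * |z0| := abs_mul _ _
      _ ≤ _ := by gcongr
  have B : -(w1' * z1') ≤ |w1'| * |f| := by
    calc -(w1' * z1') ≤ |w1' * z1'| := neg_le_abs _
      _ = |w1'| * |z1'| := abs_mul _ _
      _ ≤ _ := by gcongr
  have C : z0 * z0 + z1' * z1' + 2 * (G * |z0|) ≤ f * f := by
    rcases abs_cases z0 with ⟨k, _⟩ | ⟨k, _⟩ <;> rw [k] <;> nlinarith
  have D : w0 * w0 + w1' * w1' + 2 * (|w1'| * |f|) ≤ G ^ 2 := by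
    rw [← abs_mul]
    rcases abs_cases (w1' * f) with ⟨k, _⟩ | ⟨k, _⟩ <;> rw [k] <;> nlinarith
  nlinarith

lemma lens_lemma {a b c x w : E2} {r : ℝ} (h1 : dist x a = r) (h2 : dist x b = r)
    (h3 : dist x c ≤ r) (h4 : dist (a + b - x) c ≤ r) (wa : dist w a ≤ r) (wb : dist w b ≤ r) :
    dist w c ≤ r := by
  have hr : 0 ≤ r := h1 ▸ dist_nonneg
  set m : E2 := (1 / 2 : ℝ) • (a + b) with hm
  set e : E2 := (1 / 2 : ℝ) • (a - b) with he
  rw [dist_eq_norm] at *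
  have e1 : x - a = (x - m) - e := by rw [hm, he]; module
  have e2 : x - b = (x - m) + e := by rw [hm, he]; module
  have e3 : ‖x - c‖ = ‖(c - m) - (x - m)‖ := by rw [← norm_neg]; congr 1; module
  have e4 : ‖a + b - x - c‖ = ‖(c - m) + (x - m)‖ := by
    rw [← norm_neg]; congr 1; rw [hm]; module
  have e5 : w - a = (w - m) - e := by rw [hm, he]; module
  have e6 : w - b = (w - m) + e := by rw [hm, he]; module
  have e7 : w - c = (w - m) - (c - m) := by module
  rw [e1] at h1
  rw [e2] at h2
  rw [e3] at h3
  rw [e4] at h4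
  rw [e5] at wa
  rw [e6] at wb
  rw [e7]
  have s1 : ‖x - m - e‖ ^ 2 = r ^ 2 := by rw [h1]
  have s2 : ‖x - m + e‖ ^ 2 = r ^ 2 := by rw [h2]
  rw [norm_sub_sq_real] at s1
  rw [norm_add_sq_real] at s2
  have := lens_lemma_aux (e := e) (g := x - m) (z := c - m) (w := w - m) (r := r)
    (by linarith) (by linarith) (pow_le_pow_left₀ (norm_nonneg _) h3 2)
    (pow_le_pow_left₀ (norm_nonneg _) h4 2) (pow_le_pow_left₀ (norm_nonneg _) wa 2)
    (pow_le_pow_left₀ (norm_nonneg _) wb 2)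
  exact le_of_sq_le_sq this hr

lemma same_pair {u : E2} (hu : ‖u‖ = 1) {r : ℝ} (hr : 0 ≤ r) {a b c x y : E2} {H : ℝ}
    (h : MX u r a b H) (hxa : dist x a ≤ r) (hxb : dist x b ≤ r) (hxc : dist x c ≤ r)
    (hya : dist y a ≤ r) (hyb : dist y b ≤ r) (hyc : dist y c ≤ r)
    (hX : (inner ℝ u x : ℝ) = H) (hY : (inner ℝ u y : ℝ) = inner ℝ u a + inner ℝ u b - H)
    (nc : ∃ z, dist z a ≤ r ∧ dist z b ≤ r ∧ r < dist z c) :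
    H = inner ℝ u a + r ∨ H = inner ℝ u b + r := by
  by_contra hcon
  push Not at hcon
  obtain ⟨k1, k2⟩ := hcon
  have l1 := lt_of_le_of_ne (h.le hu).1 k1
  have l2 := lt_of_le_of_ne (h.le hu).2 k2
  subst hX
  have A1 := h.active hu hr hxa hxb l1
  have A2 := h.symm.active hu hr hxb hxa l2
  have hxy : x = a + b - y := by
    apply h.unique hu hr hxa hxb (by rwa [refl1]) (by rwa [refl2]) _ l1
    rw [inner_sub_right, inner_add_right, hY]; ring
  obtain ⟨z, hza, hzb, hzc⟩ := nc
  have := lens_lemma A2 A1 hxc (by rw [hxy]; simpa using hyc) hza hzb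
  linarith

lemma bad_far {u : E2} (hu : ‖u‖ = 1) {r : ℝ} (hr : 0 ≤ r) {a b : E2} {H : ℝ}
    (h : MX u r a b H) (h1 : H < inner ℝ u a + r) :
    -(2 * r * (inner ℝ u a - inner ℝ u b)) < ‖b - a‖ ^ 2 := by
  by_contra hcon
  push Not at hcon
  have : dist (a + r • u) b ≤ r := by
    apply le_of_sq_le_sq _ hr
    have e : a + r • u - b = r • u - (b - a) := by module
    rw [dist_eq_norm, e, norm_sub_sq_real, norm_smul, hu, real_inner_smul_left, inner_sub_right,
      mul_one, Real.norm_of_nonneg hr]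
    linarith
  have := h.2 _ (dist_top hu hr a).le this
  rw [inner_top hu] at this
  linarith

lemma side {u : E2} (hu : ‖u‖ = 1) {r : ℝ} (hr : 0 ≤ r) {a b x : E2} {H : ℝ}
    (h : MX u r a b H) (h1 : H < inner ℝ u a + r) (h2 : H < inner ℝ u b + r)
    (hxa : dist x a = r) (hxb : dist x b ≤ r) :
    0 < (inner ℝ (rot u) b - inner ℝ (rot u) a : ℝ) * (inner ℝ (rot u) x - inner ℝ (rot u) a) := by
  have f1 := bad_far hu hr h h1
  have f2 := bad_far hu hr h.symm h2
  rw [norm_sub_rev] at f2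
  have g1 := inner_le_ball hu hxa.le
  have g2 := inner_le_ball hu (a := x) (z := a) (r := r) (by rw [dist_comm]; exact hxa.le)
  have e : x - b = (x - a) - (b - a) := by module
  have s := pow_le_pow_left₀ dist_nonneg hxb 2
  rw [dist_eq_norm] at s hxa
  rw [e, norm_sub_sq_real, hxa, inner_decomp hu] at s
  simp only [inner_sub_right] at s
  rcases le_total (inner ℝ u a : ℝ) (inner ℝ u b) with k | k <;> nlinarith

lemma diff_pair {u : E2} (hu : ‖u‖ = 1) {r : ℝ} (hr : 0 ≤ r) {a b c x y : E2} {H1 H2 H3 : ℝ}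
    (h1 : MX u r a b H1) (h2 : MX u r a c H2) (h3 : MX u r b c H3)
    (hxa : dist x a ≤ r) (hxb : dist x b ≤ r) (hxc : dist x c ≤ r)
    (hya : dist y a ≤ r) (hyb : dist y b ≤ r) (hyc : dist y c ≤ r)
    (hX : (inner ℝ u x : ℝ) = H1) (hY : (inner ℝ u y : ℝ) = inner ℝ u a + inner ℝ u c - H2) :
    H1 = inner ℝ u a + r ∨ H1 = inner ℝ u b + r ∨ H2 = inner ℝ u a + r ∨ H2 = inner ℝ u c + r ∨
    H3 = inner ℝ u b + r ∨ H3 = inner ℝ u c + r := by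
  by_contra hcon
  push Not at hcon
  obtain ⟨k1, k2, k3, k4, k5, k6⟩ := hcon
  have l1 := lt_of_le_of_ne (h1.le hu).1 k1
  have l2 := lt_of_le_of_ne (h1.le hu).2 k2
  have l3 := lt_of_le_of_ne (h2.le hu).1 k3
  have l4 := lt_of_le_of_ne (h2.le hu).2 k4
  have l5 := lt_of_le_of_ne (h3.le hu).1 k5
  have l6 := lt_of_le_of_ne (h3.le hu).2 k6
  have X1 : dist x b = r := by
    subst hX; exact h1.active hu hr hxa hxb l1
  have X2 : dist x a = r := by
    subst hX; exact h1.symm.active hu hr hxb hxa l2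
  have hY2 : (inner ℝ u (a + c - y) : ℝ) = H2 := by
    rw [inner_sub_right, inner_add_right, hY]; ring
  have Y1 : dist y a = r := by
    rw [← refl2 a c y]
    subst hY2; exact h2.active hu hr (by rwa [refl1]) (by rwa [refl2]) l3
  have Y2 : dist y c = r := by
    rw [← refl1 a c y]
    subst hY2; exact h2.symm.active hu hr (by rwa [refl2]) (by rwa [refl1]) l4
  have s1 := side hu hr h1 l1 l2 X2 hxb
  have s2 := side hu hr h1.symm l2 l1 X1 hxa
  have s3 := side hu hr h2 l3 l4 X2 hxc
  have s4 := side hu hr h3 l5 l6 X1 hxc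
  have t1 := side hu hr h2 l3 l4 Y1 hyc
  have t2 := side hu hr h2.symm l4 l3 Y2 hya
  have t3 := side hu hr h1 l1 l2 Y1 hyb
  have t4 := side hu hr h3.symm l6 l5 Y2 hyb
  generalize (inner ℝ (rot u) a : ℝ) = A at *
  generalize (inner ℝ (rot u) b : ℝ) = B at *
  generalize (inner ℝ (rot u) c : ℝ) = C at *
  generalize (inner ℝ (rot u) x : ℝ) = X at *
  generalize (inner ℝ (rot u) y : ℝ) = Y at *
  clear hY2 hY hX hxa hxb hxc hya hyb hyc
  rw [mul_pos_iff] at s1 s2 s3 s4 t1 t2 t3 t4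
  rcases s1 with s1 | s1 <;> rcases s2 with s2 | s2 <;> try linarith
  all_goals rcases s4 with s4 | s4 <;> try linarith
  all_goals rcases t2 with t2 | t2 <;> try linarith
  all_goals rcases t4 with t4 | t4 <;> try linarith
  all_goals rcases s3 with s3 | s3 <;> try linarith

lemma helly_max {u : E2} {r : ℝ} {a b c x : E2} {H1 H2 H3 : ℝ}
    (h1 : MX u r a b H1) (h2 : MX u r a c H2) (h3 : MX u r b c H3)
    (hxa : dist x a ≤ r) (hxb : dist x b ≤ r) (hxc : dist x c ≤ r)
    (hmax : ∀ z, dist z a ≤ r → dist z b ≤ r → dist z c ≤ r → (inner ℝ u z : ℝ) ≤ inner ℝ u x) :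
    (inner ℝ u x : ℝ) = H1 ∨ (inner ℝ u x : ℝ) = H2 ∨ (inner ℝ u x : ℝ) = H3 := by
  by_contra hcon
  push Not at hcon
  obtain ⟨k1, k2, k3⟩ := hcon
  have l1 := lt_of_le_of_ne (h1.2 x hxa hxb) k1
  have l2 := lt_of_le_of_ne (h2.2 x hxa hxc) k2
  have l3 := lt_of_le_of_ne (h3.2 x hxb hxc) k3
  obtain ⟨⟨z1, m1, m1', rfl⟩, -⟩ := h1
  obtain ⟨⟨z2, m2, m2', rfl⟩, -⟩ := h2
  obtain ⟨⟨z3, m3, m3', rfl⟩, -⟩ := h3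
  let F : Fin 4 → Set E2 := ![closedBall a r, closedBall b r, closedBall c r,
    {z | (inner ℝ u x : ℝ) < inner ℝ u z}]
  have hhs : Convex ℝ {z : E2 | (inner ℝ u x : ℝ) < inner ℝ u z} :=
    convex_halfSpace_gt (innerSL ℝ u).toLinearMap.isLinear _
  have key := Convex.helly_theorem' (𝕜 := ℝ) (F := F) (s := Finset.univ)
    (by
      intro i _
      fin_cases i
      · exact convex_closedBall a r
      · exact convex_closedBall b r
      · exact convex_closedBall c r
      · exact hhs)
    (by
      intro I _ hI
      rw [finrank_E2] at hI
      have : ∃ j, j ∉ I := by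
        by_contra hh
        push Not at hh
        have : I = Finset.univ := Finset.eq_univ_iff_forall.2 hh
        rw [this] at hI
        simp at hI
      obtain ⟨j, hj⟩ := this
      have : ∃ z, ∀ i, i ≠ j → z ∈ F i := by
        fin_cases j
        · refine ⟨z3, fun i hi => ?_⟩
          fin_cases i
          · exact absurd rfl hi
          · exact m3
          · exact m3'
          · exact l3
        · refine ⟨z2, fun i hi => ?_⟩
          fin_cases i
          · exact m2
          · exact absurd rfl hi
          · exact m2'
          · exact l2
        · refine ⟨z1, fun i hi => ?_⟩
          fin_cases i
          · exact m1
          · exact m1'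
          · exact absurd rfl hi
          · exact l1
        · refine ⟨x, fun i hi => ?_⟩
          fin_cases i
          · exact hxa
          · exact hxb
          · exact hxc
          · exact absurd rfl hi
      obtain ⟨z, hz⟩ := this
      refine ⟨z, ?_⟩
      simp only [Set.mem_iInter]
      intro i hi
      exact hz i (fun h => hj (h ▸ hi)))
  obtain ⟨z, hz⟩ := key
  simp only [Finset.mem_univ, Set.iInter_true, Set.mem_iInter] at hz
  have := hmax z (hz 0) (hz 1) (hz 2)
  have h4 : (inner ℝ u x : ℝ) < inner ℝ u z := hz 3
  linarith

lemma dir_identity {u : E2} (hu : ‖u‖ = 1) {r : ℝ} (hr : 0 ≤ r) {a b c x y : E2} {H1 H2 H3 : ℝ}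
    (h1 : MX u r a b H1) (h2 : MX u r a c H2) (h3 : MX u r b c H3)
    (hxa : dist x a ≤ r) (hxb : dist x b ≤ r) (hxc : dist x c ≤ r)
    (hmax : ∀ z, dist z a ≤ r → dist z b ≤ r → dist z c ≤ r → (inner ℝ u z : ℝ) ≤ inner ℝ u x)
    (hya : dist y a ≤ r) (hyb : dist y b ≤ r) (hyc : dist y c ≤ r)
    (hmin : ∀ z, dist z a ≤ r → dist z b ≤ r → dist z c ≤ r → (inner ℝ u y : ℝ) ≤ inner ℝ u z)
    (n1 : ∃ z, dist z a ≤ r ∧ dist z b ≤ r ∧ r < dist z c)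
    (n2 : ∃ z, dist z a ≤ r ∧ dist z c ≤ r ∧ r < dist z b)
    (n3 : ∃ z, dist z b ≤ r ∧ dist z c ≤ r ∧ r < dist z a) :
    H1 + H2 + H3 =
      inner ℝ u a + inner ℝ u b + inner ℝ u c + (inner ℝ u x - inner ℝ u y : ℝ) + r := by
  have A := helly_max h1 h2 h3 hxa hxb hxc hmax
  have B := helly_max h1.neg h2.neg h3.neg hya hyb hyc (by
    intro z k1 k2 k3
    rw [inner_neg_left, inner_neg_left]
    linarith [hmin z k1 k2 k3])
  rw [inner_neg_left] at B
  have b1 := h1.le hu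
  have b2 := h2.le hu
  have b3 := h3.le hu
  have x1 := h1.2 x hxa hxb
  have x2 := h2.2 x hxa hxc
  have x3 := h3.2 x hxb hxc
  have y1 := h1.neg.2 y hya hyb
  have y2 := h2.neg.2 y hya hyc
  have y3 := h3.neg.2 y hyb hyc
  rw [inner_neg_left] at y1 y2 y3
  rcases A with A | A | A <;> rcases B with B | B | B
  · rcases same_pair hu hr h1 hxa hxb hxc hya hyb hyc A (by linarith) n1 with k | k <;> linarith
  · rcases diff_pair hu hr h1 h2 h3 hxa hxb hxc hya hyb hyc A (by linarith) with
      k | k | k | k | k | k <;> linarith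
  · rcases diff_pair hu hr h1.symm h3 h2 hxb hxa hxc hyb hya hyc A (by linarith) with
      k | k | k | k | k | k <;> linarith
  · rcases diff_pair hu hr h2 h1 h3.symm hxa hxc hxb hya hyc hyb A (by linarith) with
      k | k | k | k | k | k <;> linarith
  · rcases same_pair hu hr h2 hxa hxc hxb hya hyc hyb A (by linarith) n2 with k | k <;> linarith
  · rcases diff_pair hu hr h2.symm h3.symm h1 hxc hxa hxb hyc hya hyb A (by linarith) with
      k | k | k | k | k | k <;> linarith
  · rcases diff_pair hu hr h3 h1.symm h2.symm hxb hxc hxa hyb hyc hya A (by linarith) with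
      k | k | k | k | k | k <;> linarith
  · rcases diff_pair hu hr h3.symm h2.symm h1.symm hxc hxb hxa hyc hyb hya A (by linarith) with
      k | k | k | k | k | k <;> linarith
  · rcases same_pair hu hr h3 hxb hxc hxa hyb hyc hya A (by linarith) n3 with k | k <;> linarith

/-! ### Part I: three points, conclusion -/

lemma exists_MX {r : ℝ} {a b : E2} (h : (lens r a b).Nonempty) (u : E2) :
    ∃ H, MX u r a b H ∧ wd (lens r a b) u = 2 * H - inner ℝ u a - inner ℝ u b := by
  have hB := body_lens h
  obtain ⟨x, ⟨hxa, hxb⟩, hmax⟩ := hB.exists_max u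
  have hM : MX u r a b (inner ℝ u x) := ⟨⟨x, hxa, hxb, rfl⟩, fun z h1 h2 => hmax z ⟨h1, h2⟩⟩
  refine ⟨_, hM, ?_⟩
  have hm : a + b - x ∈ lens r a b := by
    constructor
    · rw [mem_closedBall, refl1]; exact hxb
    · rw [mem_closedBall, refl2]; exact hxa
  rw [hB.wd_eq ⟨hxa, hxb⟩ hm hmax ?_]
  · rw [inner_sub_right, inner_add_right]; ring
  · intro z hz
    have := hM.neg.2 z hz.1 hz.2
    rw [inner_neg_left] at this
    rw [inner_sub_right, inner_add_right]; linarith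

/-- Intersection of three disks. -/
def tri (r : ℝ) (a b c : E2) : Set E2 := {z | dist z a ≤ r ∧ dist z b ≤ r ∧ dist z c ≤ r}

lemma tri_eq (r : ℝ) (a b c : E2) : tri r a b c = lens r a b ∩ closedBall c r := by
  ext z; simp [tri, lens, and_assoc]

lemma body_tri {r : ℝ} {a b c : E2} (h : (tri r a b c).Nonempty) : Body (tri r a b c) := by
  refine ⟨?_, ?_, h⟩ <;> rw [tri_eq]
  · exact ((isCompact_closedBall _ _).inter_right isClosed_closedBall).inter_right
      isClosed_closedBall
  · exact ((convex_closedBall _ _).inter (convex_closedBall _ _)).inter (convex_closedBall _ _)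

lemma V1_triple {r : ℝ} (hr : 0 ≤ r) {a b c : E2} (h : (tri r a b c).Nonempty)
    (n1 : ∃ z, dist z a ≤ r ∧ dist z b ≤ r ∧ r < dist z c)
    (n2 : ∃ z, dist z a ≤ r ∧ dist z c ≤ r ∧ r < dist z b)
    (n3 : ∃ z, dist z b ≤ r ∧ dist z c ≤ r ∧ r < dist z a) :
    V1 (lens r a b) + V1 (lens r a c) + V1 (lens r b c) = 2 * V1 (tri r a b c) + Real.pi * r := by
  have hK := body_tri h
  obtain ⟨k, ka, kb, kc⟩ := h
  have e1 : (lens r a b).Nonempty := ⟨k, ka, kb⟩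
  have e2 : (lens r a c).Nonempty := ⟨k, ka, kc⟩
  have e3 : (lens r b c).Nonempty := ⟨k, kb, kc⟩
  have B1 := body_lens e1
  have B2 := body_lens e2
  have B3 := body_lens e3
  have BB := body_closedBall (0 : E2) hr
  have key : ∀ u : E2, ‖u‖ = 1 → wd (lens r a b + lens r a c + lens r b c) u =
      wd (tri r a b c + tri r a b c + closedBall 0 r) u := by
    intro u hu
    rw [(B1.add B2).wd_add B3, B1.wd_add B2, (hK.add hK).wd_add BB, hK.wd_add hK, wd_ball hr, hu]
    obtain ⟨H1, M1, w1⟩ := exists_MX e1 u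
    obtain ⟨H2, M2, w2⟩ := exists_MX e2 u
    obtain ⟨H3, M3, w3⟩ := exists_MX e3 u
    obtain ⟨x, hx, hmax⟩ := hK.exists_max u
    obtain ⟨y, hy, hmin⟩ := hK.exists_min u
    rw [w1, w2, w3, hK.wd_eq hx hy hmax hmin]
    have := dir_identity hu hr M1 M2 M3 hx.1 hx.2.1 hx.2.2
      (fun z z1 z2 z3 => hmax z ⟨z1, z2, z3⟩) hy.1 hy.2.1 hy.2.2
      (fun z z1 z2 z3 => hmin z ⟨z1, z2, z3⟩) n1 n2 n3
    linarith
  have L := (B1.add B2).add B3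
  have R := (hK.add hK).add BB
  have := le_antisymm (V1_le_of_wd L R fun u hu => (key u hu).le)
    (V1_le_of_wd R L fun u hu => (key u hu).ge)
  rw [V1_add (B1.add B2) B3, V1_add B1 B2, V1_add (hK.add hK) BB, V1_add hK hK, V1_ball 0 hr] at this
  linarith

lemma lens_P {r lam : ℝ} (hr : 0 ≤ r) (hl : 0 < lam) {a b c : E2} {K : Set E2} (hK : Body K)
    (hKs : K ⊆ lens r a b) (n : ∀ z, dist z a ≤ r → dist z b ≤ r → dist z c ≤ r)
    (h2 : lam ≤ dist a c) (h3 : lam ≤ dist b c) :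
    V1 K ≤ Real.pi * (r - lam / √3) := by
  have d1 : dist a (a + b - c) = dist b c := by
    rw [dist_comm, refl1, dist_comm]
  have d2 : dist b (a + b - c) = dist a c := by
    rw [dist_comm, refl2, dist_comm]
  have hs : midpoint ℝ a b = midpoint ℝ c (a + b - c) := by
    rw [midpoint_eq_smul_add, midpoint_eq_smul_add]; congr 1; abel
  refine four_cross (a := a) (b := c) (c := b) (d := a + b - c) (z := midpoint ℝ a b) hK hr hl
    (fun z hz => (hKs hz).1)
    (fun z hz => n z (hKs hz).1 (hKs hz).2) (fun z hz => (hKs hz).2) ?_ (midpoint_mem_segment _ _)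
    ?_ h2 (by rwa [dist_comm]) (by rwa [d2]) (by rwa [d1])
  · intro z hz
    have := n (a + b - z) (by rw [refl1]; exact (hKs hz).2) (by rw [refl2]; exact (hKs hz).1)
    rw [mem_closedBall]
    convert this using 1
    rw [dist_eq_norm, dist_eq_norm, ← norm_neg]; congr 1; abel
  · rw [hs]; exact midpoint_mem_segment _ _

lemma lens_Q {r : ℝ} {a b a' b' : E2} {K K' : Set E2} (hK : Body K)
    (hKs : K ⊆ lens r a b) (e : K' = lens r a' b')
    (h : dist a' b' ≤ dist a b) : V1 K ≤ V1 K' := by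
  rw [e]
  have hne := hK.ne.mono hKs
  exact (V1_mono hK (body_lens hne) hKs).trans (V1_lens_le hne h)

lemma three {r lam : ℝ} (hr : 0 < r) (hl : 0 < lam) (p q : Fin 3 → E2)
    (hc : ∀ i j, i ≠ j → dist (q i) (q j) ≤ lam ∧ lam ≤ dist (p i) (p j))
    (hne : (cap r p).Nonempty) : V1 (cap r p) ≤ V1 (cap r q) := by
  have tcap : ∀ s : Fin 3 → E2, cap r s = tri r (s 0) (s 1) (s 2) := by
    intro s; ext z; simp [cap, tri, Fin.forall_fin_succ]
  have D : ∀ {i j}, i ≠ j → dist (q i) (q j) ≤ dist (p i) (p j) := fun {i j} h =>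
    (hc i j h).1.trans (hc i j h).2
  have hK := body_cap (by norm_num) hne
  obtain ⟨k, hk⟩ := hne
  have kk := fun i => cap_sub r p i hk
  have hlr := lam_le hl.le (kk 0) (kk 1) (kk 2) (hc 0 1 (by decide)).2 (hc 1 2 (by decide)).2
    (hc 0 2 (by decide)).2
  obtain ⟨qne, J⟩ := jung_V1 (by norm_num) q hl.le hlr hr.le (fun i j h => (hc i j h).1)
  have C := fun i => cap_sub r p i
  by_cases q1 : ∀ z, dist z (q 0) ≤ r → dist z (q 1) ≤ r → dist z (q 2) ≤ r
  · refine lens_Q hK (fun z hz => ⟨C 0 hz, C 1 hz⟩) ?_ (D (i := 0) (j := 1) (by decide))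
    rw [tcap]; ext z
    exact ⟨fun h => ⟨h.1, h.2.1⟩, fun h => ⟨h.1, h.2, q1 z h.1 h.2⟩⟩
  by_cases q2 : ∀ z, dist z (q 0) ≤ r → dist z (q 2) ≤ r → dist z (q 1) ≤ r
  · refine lens_Q hK (fun z hz => ⟨C 0 hz, C 2 hz⟩) ?_ (D (i := 0) (j := 2) (by decide))
    rw [tcap]; ext z
    exact ⟨fun h => ⟨h.1, h.2.2⟩, fun h => ⟨h.1, q2 z h.1 h.2, h.2⟩⟩
  by_cases q3 : ∀ z, dist z (q 1) ≤ r → dist z (q 2) ≤ r → dist z (q 0) ≤ r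
  · refine lens_Q hK (fun z hz => ⟨C 1 hz, C 2 hz⟩) ?_ (D (i := 1) (j := 2) (by decide))
    rw [tcap]; ext z
    exact ⟨fun h => ⟨h.2.1, h.2.2⟩, fun h => ⟨q3 z h.1 h.2, h.1, h.2⟩⟩
  by_cases p1 : ∀ z, dist z (p 0) ≤ r → dist z (p 1) ≤ r → dist z (p 2) ≤ r
  · exact (lens_P hr.le hl hK (fun z hz => ⟨C 0 hz, C 1 hz⟩) p1 (hc _ _ (by decide)).2
      (hc _ _ (by decide)).2).trans J
  by_cases p2 : ∀ z, dist z (p 0) ≤ r → dist z (p 2) ≤ r → dist z (p 1) ≤ r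
  · exact (lens_P hr.le hl hK (fun z hz => ⟨C 0 hz, C 2 hz⟩) p2 (hc _ _ (by decide)).2
      (hc _ _ (by decide)).2).trans J
  by_cases p3 : ∀ z, dist z (p 1) ≤ r → dist z (p 2) ≤ r → dist z (p 0) ≤ r
  · exact (lens_P hr.le hl hK (fun z hz => ⟨C 1 hz, C 2 hz⟩) p3 (hc _ _ (by decide)).2
      (hc _ _ (by decide)).2).trans J
  push Not at q1 q2 q3 p1 p2 p3
  have P := V1_triple hr.le (tcap p ▸ ⟨k, hk⟩) p1 p2 p3
  have Q := V1_triple hr.le (tcap q ▸ qne) q1 q2 q3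
  have L1 := V1_lens_le (r := r) ⟨k, kk 0, kk 1⟩ (D (i := 0) (j := 1) (by decide))
  have L2 := V1_lens_le (r := r) ⟨k, kk 0, kk 2⟩ (D (i := 0) (j := 2) (by decide))
  have L3 := V1_lens_le (r := r) ⟨k, kk 1, kk 2⟩ (D (i := 1) (j := 2) (by decide))
  rw [tcap, tcap]
  linarith


lemma rDual_eq_cap {N : ℕ} (r : ℝ) (p : Fin N → E2) : rDual r (Set.range p) = cap r p := by
  unfold rDual cap
  rw [Set.biInter_range]

theorem stmt_12 (N : ℕ) (hN : 1 < N) (p q : Fin N → EuclideanSpace ℝ (Fin 2))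
    (lam : ℝ) (hlam : 0 < lam)
    (hcontr : ∀ i j, i ≠ j → dist (q i) (q j) ≤ lam ∧ lam ≤ dist (p i) (p j)) :
    ∀ r : ℝ, 0 < r →
      intrinsicVolume 2 1 (rDual r (Set.range p))
        ≤ intrinsicVolume 2 1 (rDual r (Set.range q)) := by
  intro r hr
  rw [rDual_eq_cap, rDual_eq_cap]
  have hN0 : 0 < N := by omega
  rcases Set.eq_empty_or_nonempty (cap r p) with hemp | hne
  · rw [hemp, V_empty]
    rcases Set.eq_empty_or_nonempty (cap r q) with he | he
    · rw [he, V_empty]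
    · exact V1_nonneg (body_cap hN0 he)
  by_cases h2 : N = 2
  · subst h2
    have lcap : ∀ s : Fin 2 → E2, cap r s = lens r (s 0) (s 1) := by
      intro s; ext z; simp [cap, lens, Fin.forall_fin_succ]
    rw [lcap] at hne
    rw [lcap, lcap]
    obtain ⟨h1, h2⟩ := hcontr 0 1 (by decide)
    exact V1_lens_le hne (h1.trans h2)
  by_cases h3 : N = 3
  · subst h3
    exact three hr hlam p q hcontr hne
  have h4 : 4 ≤ N := by omega
  have hK := body_cap hN0 hne
  obtain ⟨k, hk⟩ := hne
  have kk := fun i => cap_sub r p i hk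
  have hd : ∀ i j : Fin 4, i ≠ j → lam ≤ dist (p (Fin.castLE h4 i)) (p (Fin.castLE h4 j)) :=
    fun i j hij => (hcontr _ _ (fun h => hij (Fin.castLE_injective h4 h))).2
  have hlr := lam_le hlam.le (kk (Fin.castLE h4 0)) (kk (Fin.castLE h4 1)) (kk (Fin.castLE h4 2))
    (hd 0 1 (by decide)) (hd 1 2 (by decide)) (hd 0 2 (by decide))
  obtain ⟨-, J⟩ := jung_V1 hN0 q hlam.le hlr hr.le (fun i j h => (hcontr i j h).1)
  exact (four_points hK hr.le hlam (fun i => p (Fin.castLE h4 i)) (fun i => cap_sub r p _) hd).trans J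
end

section
/- Let r>0, d>1, 1≤k≤d, N ≥ (1+√(2d/(d+1)))^d, and suppose P = {p_1,…,p_N} ⊆ ℝ^d has all pairwise distances at least λ>0 and cr(P) ≤ r. Then V_k(P^r) ≤ (r − (N^{1/d}−1)·λ/2)^k · V_k(B[0,1]), and in particular r − (N^{1/d}−1)·λ/2 ≥ 0. -/
open MeasureTheory Metric Pointwise

lemma KP_slab_meas {d : ℕ} (v : EuclideanSpace ℝ (Fin d)) :
    MeasurableSet {x : EuclideanSpace ℝ (Fin d) | 0 ≤ inner ℝ x v ∧ inner ℝ x v < ‖v‖ ^ 2} := by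
  have hc : Continuous fun x : EuclideanSpace ℝ (Fin d) => (inner ℝ x v : ℝ) := by fun_prop
  exact (isClosed_le continuous_const hc).measurableSet.inter
    (isOpen_lt hc continuous_const).measurableSet

lemma KP_vol_fiber {d : ℕ} {v : EuclideanSpace ℝ (Fin d)} (hv : v ≠ 0)
    {S : Set (EuclideanSpace ℝ (Fin d))} (hS : MeasurableSet S) :
    volume S = ∫⁻ x in {x | 0 ≤ inner ℝ x v ∧ inner ℝ x v < ‖v‖ ^ 2},
      volume {t : ℝ | x + t • v ∈ S} := by
  have hv2 : 0 < ‖v‖ ^ 2 := by positivity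
  set Q : Set (EuclideanSpace ℝ (Fin d)) := {x | 0 ≤ inner ℝ x v ∧ inner ℝ x v < ‖v‖ ^ 2} with hQ
  have hQm : MeasurableSet Q := KP_slab_meas v
  have e1 : ∀ x, volume {t : ℝ | x + t • v ∈ S} = ∫⁻ t : ℝ, S.indicator 1 (x + t • v) := by
    intro x
    have hm : MeasurableSet {t : ℝ | x + t • v ∈ S} :=
      hS.preimage (by fun_prop : Measurable fun t : ℝ => x + t • v)
    rw [← lintegral_indicator_one hm]
    rfl
  have e3 : ∀ y : EuclideanSpace ℝ (Fin d), ∫⁻ t : ℝ, Q.indicator (1 : EuclideanSpace ℝ (Fin d) → ENNReal) (y - t • v) = 1 := by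
    intro y
    have hset : {t : ℝ | y - t • v ∈ Q} = Set.Ioc (inner ℝ y v / ‖v‖ ^ 2 - 1) (inner ℝ y v / ‖v‖ ^ 2) := by
      ext t
      simp only [hQ, Set.mem_ofPred_eq, Set.mem_Ioc, inner_sub_left, real_inner_smul_left,
        real_inner_self_eq_norm_sq, le_div_iff₀ hv2, sub_lt_iff_lt_add, div_lt_iff₀ hv2]
      constructor
      · rintro ⟨h1, h2⟩; constructor <;> nlinarith
      · rintro ⟨h1, h2⟩; constructor <;> nlinarith
    have hm : MeasurableSet {t : ℝ | y - t • v ∈ Q} := by rw [hset]; exact measurableSet_Ioc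
    calc _ = ∫⁻ t : ℝ, {t : ℝ | y - t • v ∈ Q}.indicator 1 t := rfl
      _ = 1 := by rw [lintegral_indicator_one hm, hset]; simp
  have hSi : Measurable (S.indicator (1 : EuclideanSpace ℝ (Fin d) → ENNReal)) := measurable_one.indicator hS
  have hQi : Measurable (Q.indicator (1 : EuclideanSpace ℝ (Fin d) → ENNReal)) := measurable_one.indicator hQm
  rw [← lintegral_indicator hQm]
  calc volume S = ∫⁻ y, S.indicator 1 y := by rw [lintegral_indicator_one hS]
    _ = ∫⁻ y, ∫⁻ t : ℝ, S.indicator 1 y * Q.indicator (1 : EuclideanSpace ℝ (Fin d) → ENNReal) (y - t • v) := by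
        congr 1; ext y
        rw [lintegral_const_mul _ (show Measurable (fun t : ℝ => Q.indicator (1 : EuclideanSpace ℝ (Fin d) → ENNReal) (y - t • v)) from
            hQi.comp (by fun_prop)), e3, mul_one]
    _ = ∫⁻ t : ℝ, ∫⁻ y, S.indicator 1 y * Q.indicator (1 : EuclideanSpace ℝ (Fin d) → ENNReal) (y - t • v) := by
        apply lintegral_lintegral_swap
        apply Measurable.aemeasurable
        exact (hSi.comp measurable_fst).mul (hQi.comp (by fun_prop))
    _ = ∫⁻ t : ℝ, ∫⁻ x, S.indicator 1 (x + t • v) * Q.indicator (1 : EuclideanSpace ℝ (Fin d) → ENNReal) x := by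
        congr 1; ext t
        rw [← lintegral_add_right_eq_self _ (t • v)]
        simp
    _ = ∫⁻ x, ∫⁻ t : ℝ, S.indicator 1 (x + t • v) * Q.indicator (1 : EuclideanSpace ℝ (Fin d) → ENNReal) x := by
        apply lintegral_lintegral_swap
        apply Measurable.aemeasurable
        exact (hSi.comp (by fun_prop)).mul (hQi.comp measurable_snd)
    _ = _ := by
        congr 1; ext x
        rw [lintegral_mul_const _ (show Measurable (fun t : ℝ => S.indicator (1 : EuclideanSpace ℝ (Fin d) → ENNReal) (x + t • v)) from
            hSi.comp (by fun_prop))]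
        by_cases hx : x ∈ Q
        · simp only [Set.indicator_of_mem hx, e1, Pi.one_apply, mul_one]
        · simp [hx]

lemma KP_fiber {d : ℕ} {v : EuclideanSpace ℝ (Fin d)} (hv : v ≠ 0)
    {K : Set (EuclideanSpace ℝ (Fin d))} (hK : IsCompact K) (hc : Convex ℝ K)
    (x : EuclideanSpace ℝ (Fin d)) (hne : {t : ℝ | x + t • v ∈ K}.Nonempty) :
    ∃ a b : ℝ, a ≤ b ∧ {t : ℝ | x + t • v ∈ K} = Set.Icc a b := by
  set F := {t : ℝ | x + t • v ∈ K} with hF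
  have hcl : IsClosed F := hK.isClosed.preimage (by fun_prop : Continuous fun t : ℝ => x + t • v)
  have hconv : Convex ℝ F := by
    intro s hs t ht a b ha hb hab
    have := hc hs ht ha hb hab
    show x + _ ∈ K
    convert this using 1
    rw [smul_add, smul_add, add_add_add_comm, ← add_smul, hab, one_smul, add_smul, smul_smul,
      smul_smul]
    simp
  have hb : Bornology.IsBounded F := by
    obtain ⟨C, hC⟩ := hK.isBounded.exists_norm_le
    have hvp : 0 < ‖v‖ := norm_pos_iff.mpr hv
    refine (isBounded_iff_forall_norm_le).mpr ⟨(C + ‖x‖) / ‖v‖, fun t ht => ?_⟩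
    rw [le_div_iff₀ hvp, ← norm_smul]
    have := hC _ ht
    calc ‖t • v‖ = ‖(x + t • v) - x‖ := by simp
      _ ≤ ‖x + t • v‖ + ‖x‖ := norm_sub_le _ _
      _ ≤ C + ‖x‖ := by linarith
  have hcp : IsCompact F := isCompact_of_isClosed_isBounded hcl hb
  refine ⟨sInf F, sSup F, ?_, eq_Icc_of_connected_compact ⟨hne, hconv.isPreconnected⟩ hcp⟩
  exact csInf_le_csSup hne hcp.bddBelow hcp.bddAbove

/-- Adding a segment: affine. -/
lemma KP_add_seg {d : ℕ} (v : EuclideanSpace ℝ (Fin d))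
    {K : Set (EuclideanSpace ℝ (Fin d))} (hK : IsCompact K) (hc : Convex ℝ K) :
    ∃ c : ℝ, ∀ s : ℝ, 0 ≤ s →
      (volume (K + s • segment ℝ (-v) v)).toReal = (volume K).toReal + s * c := by
  by_cases hv : v = 0
  · refine ⟨0, fun s hs => ?_⟩
    subst hv
    simp
  set Q : Set (EuclideanSpace ℝ (Fin d)) := {x | 0 ≤ inner ℝ x v ∧ inner ℝ x v < ‖v‖ ^ 2} with hQ
  have hQm : MeasurableSet Q := KP_slab_meas v
  have hIc : IsCompact (segment ℝ (-v) v) := by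
    rw [segment_eq_image]
    exact isCompact_Icc.image (by fun_prop)
  have hmem : ∀ s : ℝ, 0 ≤ s → ∀ y, y ∈ s • segment ℝ (-v) v ↔ ∃ c : ℝ, |c| ≤ s ∧ y = c • v := by
    intro s hs y
    constructor
    · rintro ⟨z, ⟨a, b, ha, hb, hab, rfl⟩, rfl⟩
      refine ⟨s * (b - a), ?_, by simp only []; module⟩
      rw [abs_mul, abs_of_nonneg hs]
      have : |b - a| ≤ 1 := abs_le.mpr ⟨by linarith, by linarith⟩
      nlinarith
    · rintro ⟨c, hcs, rfl⟩
      rcases hs.eq_or_lt with rfl | hs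
      · have : c = 0 := abs_nonpos_iff.mp hcs
        subst this
        exact ⟨0, ⟨1/2, 1/2, by norm_num, by norm_num, by norm_num, by module⟩, by simp⟩
      · rw [abs_le] at hcs
        have h1 : c / s ≤ 1 := by rw [div_le_one hs]; exact hcs.2
        have h2 : -1 ≤ c / s := by rw [le_div_iff₀ hs]; linarith
        refine ⟨(c / s) • v, ⟨(1 - c / s) / 2, (1 + c / s) / 2, by linarith, by linarith, by ring,
          by module⟩, ?_⟩
        simp only [smul_smul]
        congr 1; field_simp
  have hfib : ∀ s : ℝ, 0 ≤ s → ∀ x, volume {t : ℝ | x + t • v ∈ K + s • segment ℝ (-v) v}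
      = volume {t : ℝ | x + t • v ∈ K} +
        ENNReal.ofReal (2 * s) * {x | {t : ℝ | x + t • v ∈ K}.Nonempty}.indicator 1 x := by
    intro s hs x
    by_cases hne : {t : ℝ | x + t • v ∈ K}.Nonempty
    · obtain ⟨a, b, hab, hF⟩ := KP_fiber hv hK hc x hne
      have hF2 : {t : ℝ | x + t • v ∈ K + s • segment ℝ (-v) v} = Set.Icc (a - s) (b + s) := by
        ext t
        simp only [Set.mem_ofPred_eq, Set.mem_add]
        constructor
        · rintro ⟨y, hy, z, hz, hyz⟩
          obtain ⟨c, hcs, rfl⟩ := (hmem s hs z).mp hz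
          have : t - c ∈ {t : ℝ | x + t • v ∈ K} := by
            show x + (t - c) • v ∈ K
            convert hy using 1
            rw [sub_smul, ← add_sub_assoc, ← hyz]; simp
          rw [hF] at this
          rw [abs_le] at hcs
          exact ⟨by linarith [this.1, hcs.1], by linarith [this.2, hcs.2]⟩
        · rintro ⟨h1, h2⟩
          have hmx : max a (min t b) ∈ {t : ℝ | x + t • v ∈ K} := by
            rw [hF]; exact ⟨le_max_left _ _, max_le hab (min_le_right _ _)⟩
          refine ⟨_, hmx, (t - max a (min t b)) • v, (hmem s hs _).mpr ⟨_, ?_, rfl⟩, by module⟩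
          rw [abs_le]
          rcases le_total t b with h | h
          · rw [min_eq_left h]
            rcases le_total a t with h' | h'
            · rw [max_eq_right h']; constructor <;> linarith
            · rw [max_eq_left h']; constructor <;> linarith
          · rw [min_eq_right h, max_eq_right hab]; constructor <;> linarith
      rw [hF2, hF, Set.indicator_of_mem (by exact hne), Real.volume_Icc, Real.volume_Icc,
        Pi.one_apply, mul_one, ← ENNReal.ofReal_add (by linarith) (by linarith)]
      congr 1; ring
    · have h0 : {t : ℝ | x + t • v ∈ K + s • segment ℝ (-v) v} = ∅ := by
        rw [Set.eq_empty_iff_forall_notMem]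
        rintro t ⟨y, hy, z, hz, hyz⟩
        obtain ⟨c, hcs, rfl⟩ := (hmem s hs z).mp hz
        apply hne
        refine ⟨t - c, ?_⟩
        show x + (t - c) • v ∈ K
        convert hy using 1
        rw [sub_smul, ← add_sub_assoc]
        simp only [] at hyz
        rw [← hyz]; simp
      rw [h0, Set.not_nonempty_iff_eq_empty.mp hne, Set.indicator_of_notMem (by exact hne)]
      simp
  have hPm : MeasurableSet {x | {t : ℝ | x + t • v ∈ K}.Nonempty} := by
    have : {x | {t : ℝ | x + t • v ∈ K}.Nonempty} = K + Set.range (fun t : ℝ => t • v) := by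
      ext x
      constructor
      · rintro ⟨t, ht⟩
        exact ⟨_, ht, _, ⟨-t, rfl⟩, by module⟩
      · rintro ⟨y, hy, _, ⟨t, rfl⟩, rfl⟩
        refine ⟨-t, ?_⟩
        show _ ∈ K
        convert hy using 1
        module
    rw [this]
    apply IsClosed.measurableSet
    refine IsClosed.add_left_of_isCompact ?_ hK
    have : Set.range (fun t : ℝ => t • v) = (Submodule.span ℝ {v} : Set _) := by
      ext; simp [Submodule.mem_span_singleton]
    rw [this]
    exact Submodule.closed_of_finiteDimensional _
  set W := volume.restrict Q {x | {t : ℝ | x + t • v ∈ K}.Nonempty} with hW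
  have key : ∀ s : ℝ, 0 ≤ s → volume (K + s • segment ℝ (-v) v) = volume K + ENNReal.ofReal (2 * s) * W := by
    intro s hs
    have hmeas : MeasurableSet (K + s • segment ℝ (-v) v) :=
      (hK.add (hIc.smul s)).isClosed.measurableSet
    rw [KP_vol_fiber hv hmeas, KP_vol_fiber hv hK.isClosed.measurableSet]
    simp_rw [hfib s hs]
    rw [lintegral_add_right _ (by
      exact (measurable_one.indicator hPm).const_mul _),
      lintegral_const_mul _ (measurable_one.indicator hPm), lintegral_indicator_one hPm]
  refine ⟨2 * W.toReal, fun s hs => ?_⟩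
  have hfin : volume (K + s • segment ℝ (-v) v) ≠ ⊤ := (hK.add (hIc.smul s)).measure_ne_top
  rw [key s hs] at hfin ⊢
  rw [ENNReal.toReal_add (ENNReal.add_ne_top.mp hfin).1 (ENNReal.add_ne_top.mp hfin).2,
    ENNReal.toReal_mul, ENNReal.toReal_ofReal (by linarith)]
  ring

/-- Bonnesen-type concavity. -/
lemma KP_bonnesen {d : ℕ} {v : EuclideanSpace ℝ (Fin d)} (hv : v ≠ 0)
    {X Y : Set (EuclideanSpace ℝ (Fin d))} (hX : IsCompact X) (hXc : Convex ℝ X)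
    (hY : IsCompact Y) (hYc : Convex ℝ Y)
    (hXY : ∀ x ∈ X, ∃ t : ℝ, x + t • v ∈ Y) (hYX : ∀ x ∈ Y, ∃ t : ℝ, x + t • v ∈ X) :
    (volume X).toReal + (volume Y).toReal ≤ 2 * (volume ((1/2 : ℝ) • (X + Y))).toReal := by
  have hZ : IsCompact ((1/2 : ℝ) • (X + Y)) := (hX.add hY).smul _
  have hmain : volume X + volume Y ≤ 2 * volume ((1/2 : ℝ) • (X + Y)) := by
    have hmeasX : Measurable fun x => volume {t : ℝ | x + t • v ∈ X} := by
      exact measurable_measure_prodMk_left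
        (s := {p : EuclideanSpace ℝ (Fin d) × ℝ | p.1 + p.2 • v ∈ X})
        (hX.isClosed.measurableSet.preimage (by fun_prop))
    rw [KP_vol_fiber hv hX.isClosed.measurableSet, KP_vol_fiber hv hY.isClosed.measurableSet,
      KP_vol_fiber hv hZ.isClosed.measurableSet, ← lintegral_add_left hmeasX,
      ← lintegral_const_mul' _ _ (by simp)]
    apply lintegral_mono
    intro x
    simp only []
    by_cases hne : {t : ℝ | x + t • v ∈ X}.Nonempty
    · have hne2 : {t : ℝ | x + t • v ∈ Y}.Nonempty := by
        obtain ⟨t, ht⟩ := hne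
        obtain ⟨s, hs⟩ := hXY _ ht
        refine ⟨t + s, ?_⟩
        show _ ∈ Y
        convert hs using 1
        module
      obtain ⟨a, b, hab, hF⟩ := KP_fiber hv hX hXc x hne
      obtain ⟨a', b', hab', hF'⟩ := KP_fiber hv hY hYc x hne2
      have hsub : Set.Icc ((a + a') / 2) ((b + b') / 2) ⊆
          {t : ℝ | x + t • v ∈ (1/2 : ℝ) • (X + Y)} := by
        have hconv : Convex ℝ {t : ℝ | x + t • v ∈ (1/2 : ℝ) • (X + Y)} := by
          intro s hs t ht p q hp hq hpq
          have := ((hXc.add hYc).smul (1/2 : ℝ)) hs ht hp hq hpq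
          show x + _ ∈ (1/2 : ℝ) • (X + Y)
          convert this using 1
          rw [smul_add, smul_add, add_add_add_comm, ← add_smul, hpq, one_smul, add_smul, smul_smul,
            smul_smul]
          simp
        have hmem : ∀ s t : ℝ, s ∈ Set.Icc a b → t ∈ Set.Icc a' b' →
            (s + t) / 2 ∈ {t : ℝ | x + t • v ∈ (1/2 : ℝ) • (X + Y)} := by
          intro s t hs ht
          rw [← hF] at hs
          rw [← hF'] at ht
          refine ⟨_, ⟨_, hs, _, ht, rfl⟩, ?_⟩
          simp only []
          module
        have := hconv.ordConnected
        exact this.out (hmem a a' ⟨le_rfl, hab⟩ ⟨le_rfl, hab'⟩) (hmem b b' ⟨hab, le_rfl⟩ ⟨hab', le_rfl⟩)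
      calc _ = ENNReal.ofReal (b - a) + ENNReal.ofReal (b' - a') := by
            rw [hF, hF', Real.volume_Icc, Real.volume_Icc]
        _ = 2 * volume (Set.Icc ((a + a') / 2) ((b + b') / 2)) := by
            rw [Real.volume_Icc, ← ENNReal.ofReal_add (by linarith) (by linarith),
              show (2 : ENNReal) = ENNReal.ofReal 2 by simp, ← ENNReal.ofReal_mul (by norm_num)]
            congr 1; ring
        _ ≤ _ := by gcongr
    · have hne2 : ¬ {t : ℝ | x + t • v ∈ Y}.Nonempty := by
        rintro ⟨t, ht⟩
        obtain ⟨s, hs⟩ := hYX _ ht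
        apply hne
        refine ⟨t + s, ?_⟩
        show _ ∈ X
        convert hs using 1
        module
      rw [Set.not_nonempty_iff_eq_empty.mp hne, Set.not_nonempty_iff_eq_empty.mp hne2]
      simp
  have h2 : (2 * volume ((1/2 : ℝ) • (X + Y))) ≠ ⊤ :=
    ENNReal.mul_ne_top (by simp) hZ.measure_ne_top
  have := ENNReal.toReal_mono h2 hmain
  rwa [ENNReal.toReal_add hX.measure_ne_top hY.measure_ne_top, ENNReal.toReal_mul,
    ENNReal.toReal_ofNat] at this

open Polynomial in
lemma KP_poly : ∀ (n : ℕ) (f : (Fin n → ℝ) → ℝ),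
    (∀ t, (∀ i, 0 ≤ t i) → 0 ≤ f t) →
    (∀ (i : Fin n) t, (∀ i, 0 ≤ t i) → ∃ c : ℝ, ∀ s : ℝ, 0 ≤ s →
      f (Function.update t i s) = f (Function.update t i 0) + s * c) →
    ∃ P : ℝ[X], (∀ i, 0 ≤ P.coeff i) ∧ ∀ e : ℝ, 0 ≤ e → P.eval e = f (fun _ => e) := by
  intro n
  induction n with
  | zero =>
    intro f h0 _
    refine ⟨C (f default), fun i => ?_, fun e _ => ?_⟩
    · rw [coeff_C]
      split_ifs
      · exact h0 _ (fun i => i.elim0)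
      · exact le_rfl
    · simp only [eval_C]
      congr 1
      exact Subsingleton.elim _ _
  | succ n ih =>
    intro f h0 haff
    have hcons : ∀ (s : ℝ) (t : Fin n → ℝ), 0 ≤ s → (∀ i, 0 ≤ t i) →
        ∀ i, 0 ≤ (Fin.cons s t : Fin (n+1) → ℝ) i := by
      intro s t hs ht i
      refine Fin.cases ?_ (fun j => ?_) i
      · simpa using hs
      · simpa using ht j
    have hupd : ∀ (s s' : ℝ) (t : Fin n → ℝ), Function.update (Fin.cons s' t : Fin (n+1) → ℝ) 0 s = Fin.cons s t := by
      intro s s' t; simp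
    have hline : ∀ t : Fin n → ℝ, (∀ i, 0 ≤ t i) → ∀ s : ℝ, 0 ≤ s → f (Fin.cons s t) =
        f (Fin.cons 0 t) + s * (f (Fin.cons 1 t) - f (Fin.cons 0 t)) := by
      intro t ht s hs
      obtain ⟨c, hc⟩ := haff 0 (Fin.cons 0 t) (hcons 0 t le_rfl ht)
      have h1 := hc 1 zero_le_one
      have h2 := hc s hs
      rw [hupd, hupd] at h1 h2
      rw [h2, h1]; ring
    obtain ⟨P0, hP0, hP0e⟩ := ih (fun t => f (Fin.cons 0 t)) (fun t ht => h0 _ (hcons 0 t le_rfl ht))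
      (by
        intro i t ht
        obtain ⟨c, hc⟩ := haff i.succ (Fin.cons 0 t) (hcons 0 t le_rfl ht)
        refine ⟨c, fun s hs => ?_⟩
        have := hc s hs
        rwa [← Fin.cons_update, ← Fin.cons_update] at this)
    obtain ⟨P1, hP1, hP1e⟩ := ih (fun t => f (Fin.cons 1 t) - f (Fin.cons 0 t))
      (by
        intro t ht
        by_contra hneg
        push Not at hneg
        have hA := h0 _ (hcons 0 t le_rfl ht)
        set A := f (Fin.cons 0 t)
        set D := f (Fin.cons 1 t) - A
        have hs : 0 ≤ (A + 1) / (-D) := by apply div_nonneg <;> linarith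
        have h3 := h0 _ (hcons _ t hs ht)
        rw [hline t ht _ hs] at h3
        have hD : D ≠ 0 := ne_of_lt hneg
        have : (A + 1) / (-D) * D = -(A + 1) := by
          rw [div_neg, neg_mul, div_mul_cancel₀ _ hD]
        change 0 ≤ A + (A + 1) / (-D) * D at h3
        linarith)
      (by
        intro i t ht
        obtain ⟨c, hc⟩ := haff i.succ (Fin.cons 0 t) (hcons 0 t le_rfl ht)
        obtain ⟨c', hc'⟩ := haff i.succ (Fin.cons 1 t) (hcons 1 t zero_le_one ht)
        refine ⟨c' - c, fun s hs => ?_⟩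
        have h1 := hc s hs
        have h2 := hc' s hs
        rw [← Fin.cons_update, ← Fin.cons_update] at h1 h2
        rw [h1, h2]; ring)
    refine ⟨P0 + X * P1, fun i => ?_, fun e he => ?_⟩
    · rw [coeff_add]
      cases i with
      | zero => simpa using hP0 0
      | succ i => rw [coeff_X_mul]; exact add_nonneg (hP0 _) (hP1 _)
    · rw [eval_add, eval_mul, eval_X, hP0e e he, hP1e e he]
      have : (fun _ : Fin (n+1) => e) = Fin.cons e (fun _ => e) := by
        ext i; refine Fin.cases ?_ (fun j => ?_) i <;> simp
      rw [this, hline _ (fun _ => he) e he]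

open Polynomial in
lemma KP_degree (P : ℝ[X]) (hP : ∀ i, 0 ≤ P.coeff i) (d : ℕ) (M : ℝ)
    (hM : ∀ e : ℝ, 0 ≤ e → P.eval e ≤ M * (1 + e) ^ d) : P.natDegree ≤ d := by
  rw [natDegree_le_iff_coeff_eq_zero]
  intro i hi
  by_contra hne
  have hpos : 0 < P.coeff i := lt_of_le_of_ne (hP i) (Ne.symm hne)
  have hM0 : 0 ≤ M := by
    have := hM 0 le_rfl
    have h2 : 0 ≤ P.eval 0 := by rw [← coeff_zero_eq_eval_zero]; exact hP 0
    simp at this; linarith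
  have key : ∀ e : ℝ, 1 ≤ e → P.coeff i * e ≤ M * 2 ^ d := by
    intro e he
    have he0 : 0 ≤ e := by linarith
    have h1 : P.coeff i * e ^ i ≤ P.eval e := by
      rw [eval_eq_sum_range]
      exact Finset.single_le_sum (f := fun i => P.coeff i * e ^ i)
        (fun j _ => mul_nonneg (hP j) (pow_nonneg he0 j))
        (Finset.mem_range.mpr (Nat.lt_succ_of_le (le_natDegree_of_ne_zero hne)))
    have h2 : (1 + e) ^ d ≤ 2 ^ d * e ^ d := by
      rw [← mul_pow]; gcongr; linarith
    have h3 : e ^ (d + 1) ≤ e ^ i := pow_le_pow_right₀ he hi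
    have h4 : 0 < e ^ d := by positivity
    have h5 : (P.coeff i * e) * e ^ d ≤ (M * 2 ^ d) * e ^ d := by
      calc (P.coeff i * e) * e ^ d = P.coeff i * e ^ (d + 1) := by ring
        _ ≤ P.coeff i * e ^ i := by gcongr
        _ ≤ M * (1 + e) ^ d := h1.trans (hM e he0)
        _ ≤ M * (2 ^ d * e ^ d) := by gcongr
        _ = _ := by ring
    exact le_of_mul_le_mul_right h5 h4
  have h := key (M * 2 ^ d / P.coeff i + 1) (by
    have : 0 ≤ M * 2 ^ d / P.coeff i := by positivity
    linarith)
  have : P.coeff i * (M * 2 ^ d / P.coeff i + 1) = M * 2 ^ d + P.coeff i := by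
    field_simp
  linarith

open Polynomial in
lemma KP_interp (P : ℝ[X]) (d : ℕ) (hd : P.natDegree ≤ d) (g : ℕ → ℝ)
    (hg : ∀ j : ℕ, g j = P.eval (j : ℝ)) :
    (Lagrange.interpolate (Finset.range (d + 1)) (fun j : ℕ => (j : ℝ))) g = P := by
  symm
  apply Lagrange.eq_interpolate_of_eval_eq
  · intro a _ b _ h; exact Nat.cast_injective (R := ℝ) h
  · rw [Finset.card_range]
    exact lt_of_le_of_lt degree_le_natDegree (by exact_mod_cast Nat.lt_succ_of_le hd)
  · intro i _
    exact (hg i).symm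

lemma KP_vol_closedBall {d : ℕ} (x : EuclideanSpace ℝ (Fin d)) {r : ℝ} (hr : 0 ≤ r) :
    (volume (closedBall x r)).toReal = r ^ d * ballVolume d := by
  rw [Measure.addHaar_closedBall' _ _ hr, ENNReal.toReal_mul,
    ENNReal.toReal_ofReal (by positivity), ballVolume]
  simp

lemma KP_ballVolume_nonneg (m : ℕ) : 0 ≤ ballVolume m := ENNReal.toReal_nonneg

lemma KP_seg_compact {d : ℕ} (v : EuclideanSpace ℝ (Fin d)) : IsCompact (segment ℝ (-v) v) := by
  rw [segment_eq_image]
  exact isCompact_Icc.image (by fun_prop)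

lemma KP_sum_cc {d : ℕ} {ι : Type*} (s : Finset ι) (S : ι → Set (EuclideanSpace ℝ (Fin d)))
    (hS : ∀ i, IsCompact (S i) ∧ Convex ℝ (S i)) :
    IsCompact (∑ i ∈ s, S i) ∧ Convex ℝ (∑ i ∈ s, S i) := by
  apply Finset.sum_induction (M := Set (EuclideanSpace ℝ (Fin d))) S (fun X => IsCompact X ∧ Convex ℝ X)
  · rintro a b ⟨h1, h2⟩ ⟨h3, h4⟩
    exact ⟨h1.add h3, h2.add h4⟩
  · exact ⟨isCompact_singleton, convex_singleton 0⟩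
  · intro i _; exact hS i

/-- Coefficientwise inequality for zonotopes. -/
lemma KP_zono {d : ℕ} {K₁ K₂ K₃ : Set (EuclideanSpace ℝ (Fin d))}
    (h₁ : IsCompact K₁) (c₁ : Convex ℝ K₁) (h₂ : IsCompact K₂) (c₂ : Convex ℝ K₂)
    (h₃ : IsCompact K₃) (c₃ : Convex ℝ K₃) (a₁ a₂ a₃ : ℝ)
    (H : ∀ Y : Set (EuclideanSpace ℝ (Fin d)), IsCompact Y → Convex ℝ Y →
      0 ≤ a₁ * (volume (K₁ + Y)).toReal + a₂ * (volume (K₂ + Y)).toReal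
        + a₃ * (volume (K₃ + Y)).toReal)
    (n : ℕ) (v : Fin n → EuclideanSpace ℝ (Fin d)) (i : ℕ) :
    0 ≤ ((Lagrange.interpolate (Finset.range (d + 1)) (fun j : ℕ => (j : ℝ)))
      (fun j : ℕ => a₁ * (volume (K₁ + (j : ℝ) • ∑ i, segment ℝ (-v i) (v i))).toReal
        + a₂ * (volume (K₂ + (j : ℝ) • ∑ i, segment ℝ (-v i) (v i))).toReal
        + a₃ * (volume (K₃ + (j : ℝ) • ∑ i, segment ℝ (-v i) (v i))).toReal)).coeff i := by
  classical
  set S : Fin n → Set (EuclideanSpace ℝ (Fin d)) := fun i => segment ℝ (-v i) (v i) with hS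
  have hScc : ∀ i, IsCompact (S i) ∧ Convex ℝ (S i) :=
    fun i => ⟨KP_seg_compact _, convex_segment _ _⟩
  have hScc' : ∀ t : Fin n → ℝ, ∀ i, IsCompact (t i • S i) ∧ Convex ℝ (t i • S i) :=
    fun t i => ⟨(hScc i).1.smul _, (hScc i).2.smul _⟩
  set g : Set (EuclideanSpace ℝ (Fin d)) → (Fin n → ℝ) → ℝ := fun K t =>
    (volume (K + ∑ i, t i • S i)).toReal with hg
  have haff : ∀ K, IsCompact K → Convex ℝ K → ∀ (i : Fin n) (t : Fin n → ℝ),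
      ∃ c : ℝ, ∀ s : ℝ, 0 ≤ s →
      g K (Function.update t i s) = g K (Function.update t i 0) + s * c := by
    intro K hK hc i t
    have hsplit : ∀ s, K + ∑ j, Function.update t i s j • S j =
        (K + ∑ j ∈ Finset.univ.erase i, t j • S j) + s • S i := by
      intro s
      rw [← Finset.sum_erase_add _ _ (Finset.mem_univ i), Function.update_self, add_assoc]
      congr 2
      apply Finset.sum_congr rfl
      intro j hj
      rw [Function.update_of_ne (Finset.ne_of_mem_erase hj)]
    obtain ⟨k1, k2⟩ := KP_sum_cc (Finset.univ.erase i) (fun j => t j • S j) (hScc' t)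
    obtain ⟨c, hc⟩ := KP_add_seg (v i) (hK.add k1) (hc.add k2)
    refine ⟨c, fun s hs => ?_⟩
    simp only [hg]
    rw [hsplit, hsplit, hc s hs, hc 0 le_rfl]
    ring
  have hH : ∀ t : Fin n → ℝ, 0 ≤ a₁ * g K₁ t + a₂ * g K₂ t + a₃ * g K₃ t := by
    intro t
    obtain ⟨k1, k2⟩ := KP_sum_cc Finset.univ (fun j => t j • S j) (hScc' t)
    exact H _ k1 k2
  obtain ⟨P, hP0, hPe⟩ := KP_poly n (fun t => a₁ * g K₁ t + a₂ * g K₂ t + a₃ * g K₃ t)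
    (fun t _ => hH t) (by
      intro i t _
      obtain ⟨e₁, he₁⟩ := haff K₁ h₁ c₁ i t
      obtain ⟨e₂, he₂⟩ := haff K₂ h₂ c₂ i t
      obtain ⟨e₃, he₃⟩ := haff K₃ h₃ c₃ i t
      refine ⟨a₁ * e₁ + a₂ * e₂ + a₃ * e₃, fun s hs => ?_⟩
      simp only [he₁ s hs, he₂ s hs, he₃ s hs]
      ring)
  have hZ := (KP_sum_cc Finset.univ S hScc).1
  have hdil : ∀ K (e : ℝ), g K (fun _ => e) = (volume (K + e • ∑ i, S i)).toReal := by
    intro K e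
    simp only [hg, Finset.smul_sum]
  obtain ⟨ρ, hρ0, hρ⟩ : ∃ ρ : ℝ, 0 ≤ ρ ∧ ∀ x ∈ K₁ ∪ K₂ ∪ K₃ ∪ ∑ i, S i, ‖x‖ ≤ ρ := by
    obtain ⟨C, hC⟩ := (((h₁.union h₂).union h₃).union hZ).isBounded.exists_norm_le
    exact ⟨max C 0, le_max_right _ _, fun x hx => (hC x hx).trans (le_max_left _ _)⟩
  have hgrow : ∀ K, K ⊆ K₁ ∪ K₂ ∪ K₃ ∪ ∑ i, S i → ∀ e : ℝ, 0 ≤ e →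
      g K (fun _ => e) ≤ (ρ ^ d * ballVolume d) * (1 + e) ^ d := by
    intro K hK e he
    rw [hdil]
    have hsub : K + e • ∑ i, S i ⊆ closedBall 0 (ρ * (1 + e)) := by
      rintro _ ⟨x, hx, _, ⟨y, hy, rfl⟩, rfl⟩
      rw [mem_closedBall_zero_iff]
      have e1 := hρ x (hK hx)
      have e2 := hρ y (Or.inr hy)
      calc ‖x + e • y‖ ≤ ‖x‖ + ‖e • y‖ := norm_add_le _ _
        _ = ‖x‖ + e * ‖y‖ := by rw [norm_smul, Real.norm_of_nonneg he]
        _ ≤ ρ + e * ρ := by gcongr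
        _ = _ := by ring
    calc _ ≤ (volume (closedBall (0 : EuclideanSpace ℝ (Fin d)) (ρ * (1 + e)))).toReal :=
          ENNReal.toReal_mono (isCompact_closedBall _ _).measure_ne_top (measure_mono hsub)
      _ = _ := by rw [KP_vol_closedBall _ (by positivity), mul_pow]; ring
  have hg0 : ∀ K t, 0 ≤ g K t := fun K t => ENNReal.toReal_nonneg
  have hdeg : P.natDegree ≤ d := by
    apply KP_degree P hP0 d ((|a₁| + |a₂| + |a₃|) * (ρ ^ d * ballVolume d))
    intro e he
    rw [hPe e he]
    have s₁ := hgrow K₁ (fun x hx => Or.inl (Or.inl (Or.inl hx))) e he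
    have s₂ := hgrow K₂ (fun x hx => Or.inl (Or.inl (Or.inr hx))) e he
    have s₃ := hgrow K₃ (fun x hx => Or.inl (Or.inr hx)) e he
    have t₁ : a₁ * g K₁ (fun _ => e) ≤ |a₁| * ((ρ ^ d * ballVolume d) * (1 + e) ^ d) :=
      mul_le_mul (le_abs_self _) s₁ (hg0 _ _) (abs_nonneg _)
    have t₂ : a₂ * g K₂ (fun _ => e) ≤ |a₂| * ((ρ ^ d * ballVolume d) * (1 + e) ^ d) :=
      mul_le_mul (le_abs_self _) s₂ (hg0 _ _) (abs_nonneg _)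
    have t₃ : a₃ * g K₃ (fun _ => e) ≤ |a₃| * ((ρ ^ d * ballVolume d) * (1 + e) ^ d) :=
      mul_le_mul (le_abs_self _) s₃ (hg0 _ _) (abs_nonneg _)
    linarith
  rw [KP_interp P d hdeg]
  · exact hP0 i
  · intro j
    rw [hPe _ (Nat.cast_nonneg j)]
    simp only [hdil]

/-- `σ` is a reflection, in a hyperplane with normal `v`. -/
def KPRefl {d : ℕ} (σ : EuclideanSpace ℝ (Fin d) ≃ₗᵢ[ℝ] EuclideanSpace ℝ (Fin d)) : Prop :=
  (∀ x, σ (σ x) = x) ∧ ∃ v, v ≠ 0 ∧ ∀ x, ∃ t : ℝ, σ x = x + t • v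

lemma KP_exists_refl {d : ℕ} {x y : EuclideanSpace ℝ (Fin d)} (hne : x ≠ y) (h : ‖x‖ = ‖y‖) :
    ∃ σ : EuclideanSpace ℝ (Fin d) ≃ₗᵢ[ℝ] EuclideanSpace ℝ (Fin d), KPRefl σ ∧ σ x = y := by
  refine ⟨(Submodule.span ℝ {x - y})ᗮ.reflection, ⟨?_, x - y, sub_ne_zero.mpr hne, ?_⟩,
    Submodule.reflection_sub h⟩
  · intro z; exact Submodule.reflection_reflection _ z
  · intro z
    rw [Submodule.reflection_orthogonal_apply, Submodule.reflection_singleton_apply]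
    refine ⟨-(2 * (inner ℝ (x - y) z / ‖x - y‖ ^ 2)), ?_⟩
    simp only [RCLike.ofReal_real_eq_id, id_eq]
    module

/-- Minkowski symmetrization. -/
def KPSym {d : ℕ} (σ : EuclideanSpace ℝ (Fin d) ≃ₗᵢ[ℝ] EuclideanSpace ℝ (Fin d))
    (K : Set (EuclideanSpace ℝ (Fin d))) : Set (EuclideanSpace ℝ (Fin d)) :=
  (1/2 : ℝ) • (K + σ '' K)

lemma KP_sym_compact {d : ℕ} (σ : EuclideanSpace ℝ (Fin d) ≃ₗᵢ[ℝ] EuclideanSpace ℝ (Fin d))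
    {K : Set (EuclideanSpace ℝ (Fin d))} (h : IsCompact K) : IsCompact (KPSym σ K) :=
  (h.add (h.image σ.continuous)).smul _

lemma KP_image_convex {d : ℕ} (σ : EuclideanSpace ℝ (Fin d) ≃ₗᵢ[ℝ] EuclideanSpace ℝ (Fin d))
    {K : Set (EuclideanSpace ℝ (Fin d))} (h : Convex ℝ K) : Convex ℝ (σ '' K) :=
  h.linear_image σ.toLinearEquiv.toLinearMap

lemma KP_sym_convex {d : ℕ} (σ : EuclideanSpace ℝ (Fin d) ≃ₗᵢ[ℝ] EuclideanSpace ℝ (Fin d))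
    {K : Set (EuclideanSpace ℝ (Fin d))} (h : Convex ℝ K) : Convex ℝ (KPSym σ K) :=
  (h.add (KP_image_convex σ h)).smul _

lemma KP_sym_nonempty {d : ℕ} (σ : EuclideanSpace ℝ (Fin d) ≃ₗᵢ[ℝ] EuclideanSpace ℝ (Fin d))
    {K : Set (EuclideanSpace ℝ (Fin d))} (h : K.Nonempty) : (KPSym σ K).Nonempty :=
  (h.add (h.image σ)).smul_set

/-- Function level symmetrization. -/
lemma KP_fun_sym {d : ℕ} (hd : 1 < d) (F : Set (EuclideanSpace ℝ (Fin d) → ℝ)) (hne : F.Nonempty)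
    (ρ : ℝ) (hb : ∀ f ∈ F, ∀ u, ‖u‖ = 1 → -ρ ≤ f u ∧ f u ≤ ρ)
    (hL : ∀ f ∈ F, ∀ x y, f x ≤ f y + ρ * ‖x - y‖)
    (hs : ∀ f ∈ F, ∀ σ, KPRefl σ → ∃ g ∈ F, ∀ u, g u = (f u + f (σ u)) / 2)
    (δ : ℝ) (hδ : 0 < δ) :
    ∃ f ∈ F, ∃ m : ℝ, ∀ u, ‖u‖ = 1 → m ≤ f u ∧ f u ≤ m + δ := by
  by_contra hcon
  push Not at hcon
  have hunit : ∃ u : EuclideanSpace ℝ (Fin d), ‖u‖ = 1 :=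
    ⟨EuclideanSpace.single ⟨0, by omega⟩ 1, by simp⟩
  obtain ⟨u₀, hu₀⟩ := hunit
  have hρ : 0 ≤ ρ := by
    obtain ⟨f, hf⟩ := hne
    have := hb f hf u₀ hu₀
    linarith
  set s : ℝ := δ / (2 * (ρ + 1)) with hsdef
  have hs0 : 0 < s := by positivity
  obtain ⟨T, hTS, hTfin, hT⟩ := (isCompact_sphere (0 : EuclideanSpace ℝ (Fin d)) 1).finite_cover_balls hs0
  have step : ∃ c : ℝ, 0 < c ∧ ∀ f ∈ F, ∀ B : ℝ, (∀ u, ‖u‖ = 1 → f u ≤ B) →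
      ∃ g ∈ F, ∀ u, ‖u‖ = 1 → g u ≤ B - c := by
    refine ⟨δ / 2 / 2 ^ hTfin.toFinset.card, by positivity, ?_⟩
    intro f hf B hB
    obtain ⟨v, hv1, hv2⟩ := hcon f hf (B - δ)
    have hv3 : f v < B - δ := by
      by_contra h
      push Not at h
      have := hv2 h
      have := hB v hv1
      linarith
    have hcap : ∀ u, dist u v < s → f u ≤ B - δ / 2 := by
      intro u hu
      have h1 := hL f hf u v
      rw [dist_eq_norm] at hu
      have h2 : ρ * ‖u - v‖ ≤ (ρ + 1) * s := by
        apply mul_le_mul (by linarith) hu.le (norm_nonneg _) (by linarith)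
      have h3 : (ρ + 1) * s = δ / 2 := by rw [hsdef]; field_simp
      linarith
    have ind : ∀ W : Finset (EuclideanSpace ℝ (Fin d)), (∀ y ∈ W, ‖y‖ = 1) →
        ∃ g ∈ F, (∀ u, ‖u‖ = 1 → g u ≤ B) ∧
        ∀ u, ‖u‖ = 1 → (dist u v < s ∨ ∃ y ∈ W, dist u y < s) → g u ≤ B - δ / 2 / 2 ^ W.card := by
      intro W
      induction W using Finset.induction_on with
      | empty =>
        intro _
        refine ⟨f, hf, hB, ?_⟩
        rintro u _ (h | ⟨y, hy, _⟩)
        · simpa using hcap u h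
        · simp at hy
      | insert y W hyW ih =>
        intro hW
        obtain ⟨g, hg, hgB, hgW⟩ := ih (fun z hz => hW z (Finset.mem_insert_of_mem hz))
        have hy1 := hW y (Finset.mem_insert_self y W)
        have hp : δ / 2 / 2 ^ (insert y W).card = (δ / 2 / 2 ^ W.card) / 2 := by
          rw [Finset.card_insert_of_notMem hyW, pow_succ]; field_simp
        have hq : 0 < δ / 2 / 2 ^ W.card := by positivity
        rw [hp]
        by_cases hvy : v = y
        · refine ⟨g, hg, hgB, fun u hu h => ?_⟩
          have : g u ≤ B - δ / 2 / 2 ^ W.card := by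
            apply hgW u hu
            rcases h with h | ⟨z, hz, h⟩
            · exact Or.inl h
            · rcases Finset.mem_insert.mp hz with rfl | hz
              · left; rw [hvy]; exact h
              · exact Or.inr ⟨z, hz, h⟩
          linarith
        · obtain ⟨σ, hσ, hσv⟩ := KP_exists_refl hvy (hv1.trans hy1.symm)
          obtain ⟨k, hk, hkσ⟩ := hs g hg σ hσ
          have hσn : ∀ u, ‖u‖ = 1 → ‖σ u‖ = 1 := fun u hu => by rw [σ.norm_map, hu]
          refine ⟨k, hk, fun u hu => ?_, fun u hu h => ?_⟩
          · rw [hkσ]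
            have := hgB u hu
            have := hgB _ (hσn u hu)
            linarith
          · rw [hkσ]
            have a1 := hgB u hu
            have a2 := hgB _ (hσn u hu)
            have hcase : (dist u v < s ∨ ∃ y ∈ W, dist u y < s) ∨ dist u y < s := by
              rcases h with h | ⟨z, hz, h⟩
              · exact Or.inl (Or.inl h)
              · rcases Finset.mem_insert.mp hz with rfl | hz
                · exact Or.inr h
                · exact Or.inl (Or.inr ⟨z, hz, h⟩)
            rcases hcase with h | h
            · have := hgW u hu h
              linarith
            · have h5 : dist (σ u) v < s := by
                rw [← hσ.1 v, σ.dist_map, hσv]; exact h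
              have := hgW _ (hσn u hu) (Or.inl h5)
              linarith
    obtain ⟨g, hg, _, hgT⟩ := ind hTfin.toFinset (fun y hy => by
      have := hTS (hTfin.mem_toFinset.mp hy)
      simpa using this)
    refine ⟨g, hg, fun u hu => hgT u hu (Or.inr ?_)⟩
    have := hT (show u ∈ sphere (0 : EuclideanSpace ℝ (Fin d)) 1 by simpa using hu)
    simp only [Set.mem_iUnion, mem_ball, exists_prop] at this
    obtain ⟨y, hy, h⟩ := this
    exact ⟨y, hTfin.mem_toFinset.mpr hy, h⟩
  obtain ⟨c, hc, hstep⟩ := step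
  have iter : ∀ n : ℕ, ∃ g ∈ F, ∀ u, ‖u‖ = 1 → g u ≤ ρ - n * c := by
    intro n
    induction n with
    | zero =>
      obtain ⟨f, hf⟩ := hne
      exact ⟨f, hf, fun u hu => by simpa using (hb f hf u hu).2⟩
    | succ n ih =>
      obtain ⟨g, hg, hgB⟩ := ih
      obtain ⟨k, hk, hkB⟩ := hstep g hg _ hgB
      refine ⟨k, hk, fun u hu => ?_⟩
      have := hkB u hu
      push_cast
      linarith
  obtain ⟨n, hn⟩ := exists_nat_gt ((2 * ρ) / c)
  obtain ⟨g, hg, hgn⟩ := iter n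
  have h1 := hgn u₀ hu₀
  have h2 := (hb g hg u₀ hu₀).1
  rw [div_lt_iff₀ hc] at hn
  linarith

/-- Support function. -/
noncomputable def KPsupp {d : ℕ} (K : Set (EuclideanSpace ℝ (Fin d))) (u : EuclideanSpace ℝ (Fin d)) : ℝ :=
  sSup ((fun x => (inner ℝ x u : ℝ)) '' K)

lemma KP_supp_greatest {d : ℕ} {K : Set (EuclideanSpace ℝ (Fin d))} (hK : IsCompact K)
    (hne : K.Nonempty) (u : EuclideanSpace ℝ (Fin d)) :
    IsGreatest ((fun x => (inner ℝ x u : ℝ)) '' K) (KPsupp K u) := by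
  have : IsCompact ((fun x => (inner ℝ x u : ℝ)) '' K) := hK.image (by fun_prop)
  exact this.isGreatest_sSup (hne.image _)

lemma KP_supp_sym {d : ℕ} {K : Set (EuclideanSpace ℝ (Fin d))} (hK : IsCompact K)
    (hne : K.Nonempty) {σ} (hσ : KPRefl σ) (u : EuclideanSpace ℝ (Fin d)) :
    KPsupp (KPSym σ K) u = (KPsupp K u + KPsupp K (σ u)) / 2 := by
  have hin : ∀ x, (inner ℝ (σ x) u : ℝ) = inner ℝ x (σ u) := by
    intro x
    rw [← σ.inner_map_map x (σ u), hσ.1]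
  apply IsGreatest.csSup_eq
  obtain ⟨⟨x, hx, hxu⟩, hx2⟩ := KP_supp_greatest hK hne u
  obtain ⟨⟨y, hy, hyu⟩, hy2⟩ := KP_supp_greatest hK hne (σ u)
  constructor
  · refine ⟨(1/2 : ℝ) • (x + σ y), ⟨_, ⟨x, hx, _, ⟨y, hy, rfl⟩, rfl⟩, rfl⟩, ?_⟩
    simp only [] at hxu hyu ⊢
    rw [real_inner_smul_left, inner_add_left, hin, hxu, hyu]; ring
  · rintro _ ⟨_, ⟨_, ⟨x', hx', _, ⟨y', hy', rfl⟩, rfl⟩, rfl⟩, rfl⟩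
    have h1 := hx2 ⟨x', hx', rfl⟩
    have h2 := hy2 ⟨y', hy', rfl⟩
    simp only [] at h1 h2 ⊢
    rw [real_inner_smul_left, inner_add_left, hin]; linarith

/-- Set level symmetrization principle. -/
lemma KP_symmetrize {d : ℕ} (hd : 1 < d) (Pr : Set (EuclideanSpace ℝ (Fin d)) → Prop)
    (hPc : ∀ K, Pr K → IsCompact K ∧ K.Nonempty)
    (hPs : ∀ K σ, Pr K → KPRefl σ → Pr (KPSym σ K))
    (K₀ : Set (EuclideanSpace ℝ (Fin d))) (hK₀ : Pr K₀) (δ : ℝ) (hδ : 0 < δ) :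
    ∃ K, Pr K ∧ ∃ m : ℝ, ∀ u, ‖u‖ = 1 → m ≤ KPsupp K u ∧ KPsupp K u ≤ m + δ := by
  obtain ⟨ρ, hρ⟩ := (hPc K₀ hK₀).1.isBounded.exists_norm_le
  have := KP_fun_sym hd {f | ∃ K, Pr K ∧ (∀ x ∈ K, ‖x‖ ≤ ρ) ∧ f = KPsupp K}
    ⟨_, K₀, hK₀, hρ, rfl⟩ ρ ?_ ?_ ?_ δ hδ
  · obtain ⟨f, ⟨K, hK, _, rfl⟩, m, hm⟩ := this
    exact ⟨K, hK, m, hm⟩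
  · rintro f ⟨K, hK, hKρ, rfl⟩ u hu
    obtain ⟨⟨x, hx, hxu⟩, hx2⟩ := KP_supp_greatest (hPc K hK).1 (hPc K hK).2 u
    rw [← hxu]
    have := abs_real_inner_le_norm x u
    rw [hu, mul_one] at this
    exact abs_le.mp (this.trans (hKρ x hx))
  · rintro f ⟨K, hK, hKρ, rfl⟩ u w
    obtain ⟨⟨x, hx, hxu⟩, _⟩ := KP_supp_greatest (hPc K hK).1 (hPc K hK).2 u
    have h2 := (KP_supp_greatest (hPc K hK).1 (hPc K hK).2 w).2 ⟨x, hx, rfl⟩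
    simp only [] at hxu h2
    rw [← hxu]
    have h3 : (inner ℝ x u : ℝ) = inner ℝ x w + inner ℝ x (u - w) := by
      rw [← inner_add_right]; simp
    have h4 := real_inner_le_norm x (u - w)
    have h5 : ‖x‖ * ‖u - w‖ ≤ ρ * ‖u - w‖ := by gcongr; exact hKρ x hx
    linarith
  · rintro f ⟨K, hK, hKρ, rfl⟩ σ hσ
    refine ⟨_, ⟨KPSym σ K, hPs K σ hK hσ, ?_, rfl⟩, fun u => KP_supp_sym (hPc K hK).1 (hPc K hK).2 hσ u⟩
    rintro _ ⟨_, ⟨x, hx, _, ⟨y, hy, rfl⟩, rfl⟩, rfl⟩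
    simp only []
    rw [norm_smul]
    have h1 := norm_add_le x (σ y)
    rw [σ.norm_map] at h1
    have := hKρ x hx
    have := hKρ y hy
    norm_num
    linarith

def KPZ {d : ℕ} (Z : Set (EuclideanSpace ℝ (Fin d))) : Prop :=
  Z ∈ AddSubmonoid.closure {S : Set (EuclideanSpace ℝ (Fin d)) | ∃ v, S = segment ℝ (-v) v}

lemma KPZ_image {d : ℕ} (f : EuclideanSpace ℝ (Fin d) →ₗ[ℝ] EuclideanSpace ℝ (Fin d))
    {Z : Set (EuclideanSpace ℝ (Fin d))} (hZ : KPZ Z) : KPZ (f '' Z) := by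
  unfold KPZ at hZ
  induction hZ using AddSubmonoid.closure_induction with
  | mem S hS =>
    obtain ⟨v, rfl⟩ := hS
    apply AddSubmonoid.subset_closure
    refine ⟨f v, ?_⟩
    have := image_segment ℝ f.toAffineMap (-v) v
    simpa using this
  | zero =>
    have : f '' (0 : Set (EuclideanSpace ℝ (Fin d))) = 0 := by
      rw [← Set.singleton_zero, Set.image_singleton, map_zero, Set.singleton_zero]
    rw [this]
    exact AddSubmonoid.zero_mem _
  | add X Y _ _ hX hY =>
    rw [Set.image_add]
    exact AddSubmonoid.add_mem _ hX hY

lemma KPZ_smul {d : ℕ} (c : ℝ) {Z : Set (EuclideanSpace ℝ (Fin d))} (hZ : KPZ Z) : KPZ (c • Z) :=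
  KPZ_image (c • LinearMap.id) hZ

lemma KPZ_sym {d : ℕ} (σ) {Z : Set (EuclideanSpace ℝ (Fin d))} (hZ : KPZ Z) : KPZ (KPSym σ Z) :=
  KPZ_smul _ (AddSubmonoid.add_mem _ hZ (KPZ_image σ.toLinearEquiv.toLinearMap hZ))

lemma KPZ_exists {d : ℕ} {Z : Set (EuclideanSpace ℝ (Fin d))} (hZ : KPZ Z) :
    ∃ (n : ℕ) (v : Fin n → EuclideanSpace ℝ (Fin d)), Z = ∑ i, segment ℝ (-v i) (v i) := by
  unfold KPZ at hZ
  obtain ⟨l, hl, rfl⟩ := AddSubmonoid.exists_list_of_mem_closure hZ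
  have h : ∀ i : Fin l.length, ∃ v, l.get i = segment ℝ (-v) v := fun i => hl _ (List.get_mem l i)
  choose v hv using h
  refine ⟨l.length, v, ?_⟩
  simp_rw [← hv]
  rw [← List.sum_ofFn]
  simp

lemma KP_sum_seg_cc {d n : ℕ} (v : Fin n → EuclideanSpace ℝ (Fin d)) :
    IsCompact (∑ i, segment ℝ (-v i) (v i)) ∧ Convex ℝ (∑ i, segment ℝ (-v i) (v i)) :=
  KP_sum_cc _ _ fun i => ⟨KP_seg_compact _, convex_segment _ _⟩

lemma KPZ_cc {d : ℕ} {Z : Set (EuclideanSpace ℝ (Fin d))} (hZ : KPZ Z) :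
    IsCompact Z ∧ Convex ℝ Z := by
  obtain ⟨n, v, rfl⟩ := KPZ_exists hZ
  exact KP_sum_seg_cc v

lemma KPZ_cube {d : ℕ} : ∃ Z : Set (EuclideanSpace ℝ (Fin d)), KPZ Z ∧ closedBall 0 1 ⊆ Z := by
  refine ⟨∑ i : Fin d, segment ℝ (-(EuclideanSpace.single i (1:ℝ))) (EuclideanSpace.single i 1), ?_, ?_⟩
  · exact AddSubmonoid.sum_mem _ fun i _ => AddSubmonoid.subset_closure ⟨_, rfl⟩
  · intro x hx
    rw [mem_closedBall_zero_iff] at hx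
    have hx' : x = ∑ i, x i • EuclideanSpace.single i (1:ℝ) := by
      ext j
      simp [Finset.sum_apply, Pi.single_apply]
    rw [hx']
    apply Set.finset_sum_mem_finset_sum
    intro i _
    have h1 : |x i| ≤ 1 := by
      have := EuclideanSpace.norm_sq_eq x
      have h2 := PiLp.norm_apply_le x i
      rw [Real.norm_eq_abs] at h2
      linarith
    rw [abs_le] at h1
    exact ⟨(1 - x i) / 2, (1 + x i) / 2, by linarith, by linarith, by ring, by module⟩

lemma KP_ball_subset {d : ℕ} {Z : Set (EuclideanSpace ℝ (Fin d))} (hZ : IsCompact Z)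
    (hc : Convex ℝ Z) (hne : Z.Nonempty) (m : ℝ) (h : ∀ u, ‖u‖ = 1 → m ≤ KPsupp Z u) :
    closedBall 0 m ⊆ Z := by
  intro x hx
  rw [mem_closedBall_zero_iff] at hx
  by_contra hxZ
  obtain ⟨f, u, hu, hux⟩ := geometric_hahn_banach_closed_point hc hZ.isClosed hxZ
  set w := (InnerProductSpace.toDual ℝ (EuclideanSpace ℝ (Fin d))).symm f with hw
  have hf : ∀ y, f y = inner ℝ y w := by
    intro y
    rw [real_inner_comm, hw, InnerProductSpace.toDual_symm_apply]
  by_cases hw0 : w = 0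
  · obtain ⟨z, hz⟩ := hne
    have := hu z hz
    rw [hf, hw0, inner_zero_right] at this
    rw [hf, hw0, inner_zero_right] at hux
    linarith
  have hwp : 0 < ‖w‖ := norm_pos_iff.mpr hw0
  have hun : ‖(‖w‖⁻¹ • w)‖ = 1 := norm_smul_inv_norm hw0
  obtain ⟨⟨z, hz, hzu⟩, _⟩ := KP_supp_greatest hZ hne (‖w‖⁻¹ • w)
  have h1 := h _ hun
  rw [← hzu] at h1
  simp only [real_inner_smul_right] at h1
  have h2 := hu z hz
  rw [hf] at h2 hux
  have h3 := real_inner_le_norm x w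
  have h4 : m * ‖w‖ ≤ inner ℝ z w := by
    have := mul_le_mul_of_nonneg_right h1 hwp.le
    rwa [mul_comm ‖w‖⁻¹, mul_assoc, inv_mul_cancel₀ hwp.ne', mul_one] at this
  have h5 : ‖x‖ * ‖w‖ ≤ m * ‖w‖ := by gcongr
  linarith

lemma KP_subset_ball {d : ℕ} (hd : 1 < d) {Z : Set (EuclideanSpace ℝ (Fin d))} (hZ : IsCompact Z)
    (hne : Z.Nonempty) (m : ℝ) (h : ∀ u, ‖u‖ = 1 → KPsupp Z u ≤ m) :
    Z ⊆ closedBall 0 m := by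
  intro x hx
  rw [mem_closedBall_zero_iff]
  by_cases hx0 : x = 0
  · subst hx0
    have hu : ‖(EuclideanSpace.single ⟨0, by omega⟩ 1 : EuclideanSpace ℝ (Fin d))‖ = 1 := by simp
    have h1 := (KP_supp_greatest hZ hne (EuclideanSpace.single ⟨0, by omega⟩ 1)).2 ⟨0, hx, rfl⟩
    simp only [inner_zero_left] at h1
    rw [norm_zero]
    exact h1.trans (h _ hu)
  · have hxp : 0 < ‖x‖ := norm_pos_iff.mpr hx0
    have h1 := (KP_supp_greatest hZ hne (‖x‖⁻¹ • x)).2 ⟨x, hx, rfl⟩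
    simp only [real_inner_smul_right, real_inner_self_eq_norm_sq] at h1
    have h2 := h (‖x‖⁻¹ • x) (norm_smul_inv_norm hx0)
    have : ‖x‖⁻¹ * ‖x‖ ^ 2 = ‖x‖ := by field_simp
    linarith

lemma KP_ball_zono {d : ℕ} (hd : 1 < d) (η : ℝ) (hη : 0 < η) :
    ∃ (n : ℕ) (v : Fin n → EuclideanSpace ℝ (Fin d)),
      closedBall 0 1 ⊆ ∑ i, segment ℝ (-v i) (v i) ∧
      ∑ i, segment ℝ (-v i) (v i) ⊆ closedBall 0 (1 + η) := by
  obtain ⟨Z₀, hZ₀, hB₀⟩ := KPZ_cube (d := d)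
  have hne : ∀ Z : Set (EuclideanSpace ℝ (Fin d)), closedBall 0 1 ⊆ Z → Z.Nonempty :=
    fun Z h => ⟨0, h (by simp)⟩
  obtain ⟨Z, ⟨hZ, hB⟩, m, hm⟩ := KP_symmetrize hd (fun Z => KPZ Z ∧ closedBall 0 1 ⊆ Z)
    (fun K hK => ⟨(KPZ_cc hK.1).1, hne K hK.2⟩)
    (fun K σ hK hσ => ⟨KPZ_sym σ hK.1, fun x hx => by
      refine ⟨x + x, ⟨x, hK.2 hx, x, ⟨σ x, hK.2 ?_, hσ.1 x⟩, rfl⟩, by simp only []; module⟩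
      rw [mem_closedBall_zero_iff] at hx ⊢
      rwa [σ.norm_map]⟩)
    Z₀ ⟨hZ₀, hB₀⟩ η hη
  obtain ⟨hc, hcv⟩ := KPZ_cc hZ
  have h1 : ∀ u, ‖u‖ = 1 → 1 ≤ KPsupp Z u := by
    intro u hu
    have := (KP_supp_greatest hc (hne Z hB) u).2 ⟨u, hB (by simp [hu]), rfl⟩
    simpa [real_inner_self_eq_norm_sq, hu] using this
  set M := max m 1 with hM
  have hM1 : 1 ≤ M := le_max_right _ _
  have hM0 : 0 < M := by linarith
  have hin : closedBall 0 M ⊆ Z := KP_ball_subset hc hcv (hne Z hB) M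
    (fun u hu => max_le (hm u hu).1 (h1 u hu))
  have hout : Z ⊆ closedBall 0 (M + η) := KP_subset_ball hd hc (hne Z hB) _
    (fun u hu => (hm u hu).2.trans (by linarith [le_max_left m 1]))
  obtain ⟨n, v, hv⟩ := KPZ_exists (KPZ_smul M⁻¹ hZ)
  refine ⟨n, v, ?_, ?_⟩
  · rw [← hv]
    intro x hx
    rw [mem_closedBall_zero_iff] at hx
    refine ⟨M • x, hin ?_, ?_⟩
    · rw [mem_closedBall_zero_iff, norm_smul, Real.norm_of_nonneg hM0.le]
      nlinarith
    · simp only [smul_smul]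
      rw [inv_mul_cancel₀ hM0.ne', one_smul]
  · rw [← hv]
    rintro _ ⟨x, hx, rfl⟩
    have := hout hx
    rw [mem_closedBall_zero_iff] at this ⊢
    simp only [norm_smul, norm_inv, Real.norm_of_nonneg hM0.le]
    rw [inv_mul_le_iff₀ hM0]
    nlinarith

open Filter Topology in
lemma KP_general {d : ℕ} (hd : 1 < d) {K₁ K₂ K₃ : Set (EuclideanSpace ℝ (Fin d))}
    (h₁ : IsCompact K₁) (c₁ : Convex ℝ K₁) (h₂ : IsCompact K₂) (c₂ : Convex ℝ K₂)
    (h₃ : IsCompact K₃) (c₃ : Convex ℝ K₃) (a₁ a₂ a₃ : ℝ)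
    (H : ∀ Y : Set (EuclideanSpace ℝ (Fin d)), IsCompact Y → Convex ℝ Y →
      0 ≤ a₁ * (volume (K₁ + Y)).toReal + a₂ * (volume (K₂ + Y)).toReal
        + a₃ * (volume (K₃ + Y)).toReal) (k : ℕ) :
    0 ≤ a₁ * intrinsicVolume d k K₁ + a₂ * intrinsicVolume d k K₂ + a₃ * intrinsicVolume d k K₃ := by
  set Φ : (ℕ → ℝ) → ℝ := fun g => ((Lagrange.interpolate (Finset.range (d + 1))
    (fun j : ℕ => (j : ℝ))) g).coeff (d - k) with hΦ
  have hΦs : ∀ g, Φ g = ∑ j ∈ Finset.range (d + 1), g j *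
      (Lagrange.basis (Finset.range (d + 1)) (fun j : ℕ => (j : ℝ)) j).coeff (d - k) := by
    intro g
    simp only [hΦ, Lagrange.interpolate_apply, Polynomial.finset_sum_coeff, Polynomial.coeff_C_mul]
  have hlim : ∀ (G : ℕ → ℕ → ℝ) (g : ℕ → ℝ), (∀ j, Tendsto (fun n => G n j) atTop (𝓝 (g j))) →
      Tendsto (fun n => Φ (G n)) atTop (𝓝 (Φ g)) := by
    intro G g hG
    simp_rw [hΦs]
    exact tendsto_finset_sum _ fun j _ => (hG j).mul_const _
  have hz : ∀ n : ℕ, ∃ Z : Set (EuclideanSpace ℝ (Fin d)), closedBall 0 1 ⊆ Z ∧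
      Z ⊆ closedBall 0 (1 + 1 / ((n : ℝ) + 1)) ∧ IsCompact Z ∧
      0 ≤ Φ (fun j : ℕ => a₁ * (volume (K₁ + (j : ℝ) • Z)).toReal
        + a₂ * (volume (K₂ + (j : ℝ) • Z)).toReal
        + a₃ * (volume (K₃ + (j : ℝ) • Z)).toReal) := by
    intro n
    obtain ⟨N, v, hv1, hv2⟩ := KP_ball_zono hd (1 / ((n : ℝ) + 1)) (by positivity)
    exact ⟨_, hv1, hv2, (KP_sum_seg_cc v).1, KP_zono h₁ c₁ h₂ c₂ h₃ c₃ a₁ a₂ a₃ H N v (d - k)⟩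
  choose Z hZ1 hZ2 hZc hZ0 using hz
  have hconv : ∀ K : Set (EuclideanSpace ℝ (Fin d)), IsCompact K → ∀ j : ℕ,
      Tendsto (fun n => (volume (K + (j : ℝ) • Z n)).toReal) atTop
        (𝓝 (volume (K + closedBall (0 : EuclideanSpace ℝ (Fin d)) (j : ℝ))).toReal) := by
    intro K hK j
    have hj : (0 : ℝ) ≤ j := Nat.cast_nonneg j
    have hKj : IsCompact (K + closedBall (0 : EuclideanSpace ℝ (Fin d)) (j : ℝ)) :=
      hK.add (isCompact_closedBall _ _)
    refine (ENNReal.tendsto_toReal hKj.measure_ne_top).comp ?_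
    have hc := (tendsto_measure_cthickening_of_isCompact (μ := volume) hKj)
    have hs : Tendsto (fun n : ℕ => (j : ℝ) * (1 / ((n : ℝ) + 1))) atTop (𝓝 0) := by
      have := (tendsto_one_div_add_atTop_nhds_zero_nat (𝕜 := ℝ)).const_mul (j : ℝ)
      simpa using this
    refine tendsto_of_tendsto_of_tendsto_of_le_of_le tendsto_const_nhds (hc.comp hs) ?_ ?_
    · intro n
      apply measure_mono
      apply Set.add_subset_add_left
      rw [show closedBall (0 : EuclideanSpace ℝ (Fin d)) (j : ℝ) = (j : ℝ) • closedBall 0 1 by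
        rw [smul_unitClosedBall, Real.norm_of_nonneg hj]]
      exact Set.smul_set_mono (hZ1 n)
    · intro n
      apply measure_mono
      rw [← hKj.add_closedBall_zero (by positivity), add_assoc,
        closedBall_add_closedBall hj (by positivity)]
      apply Set.add_subset_add_left
      rintro _ ⟨x, hx, rfl⟩
      have := hZ2 n hx
      rw [mem_closedBall_zero_iff] at this
      rw [add_zero, mem_closedBall_zero_iff]
      simp only [norm_smul, Real.norm_of_nonneg hj]
      calc (j : ℝ) * ‖x‖ ≤ j * (1 + 1 / ((n : ℝ) + 1)) := by gcongr
        _ = _ := by ring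
  have hfin : 0 ≤ Φ (fun j : ℕ =>
      a₁ * (volume (K₁ + closedBall (0 : EuclideanSpace ℝ (Fin d)) (j : ℝ))).toReal
      + a₂ * (volume (K₂ + closedBall (0 : EuclideanSpace ℝ (Fin d)) (j : ℝ))).toReal
      + a₃ * (volume (K₃ + closedBall (0 : EuclideanSpace ℝ (Fin d)) (j : ℝ))).toReal) := by
    refine ge_of_tendsto' (hlim _ _ fun j => ?_) hZ0
    exact (((hconv K₁ h₁ j).const_mul a₁).add ((hconv K₂ h₂ j).const_mul a₂)).add
      ((hconv K₃ h₃ j).const_mul a₃)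
  have hiv : ∀ K, intrinsicVolume d k K = Φ (fun j : ℕ =>
      (volume (K + closedBall (0 : EuclideanSpace ℝ (Fin d)) (j : ℝ))).toReal) / ballVolume (d - k) :=
    fun K => rfl
  have hlin : ∀ f g h : ℕ → ℝ, Φ (fun j => a₁ * f j + a₂ * g j + a₃ * h j)
      = a₁ * Φ f + a₂ * Φ g + a₃ * Φ h := by
    intro f g h
    simp only [hΦs, Finset.mul_sum, ← Finset.sum_add_distrib]
    exact Finset.sum_congr rfl fun j _ => by ring
  rw [hlin] at hfin
  rw [hiv, hiv, hiv]
  have := div_nonneg hfin (KP_ballVolume_nonneg (d - k))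
  calc _ ≤ _ := this
    _ = _ := by ring

lemma KP_mono_vol {d : ℕ} {A B : Set (EuclideanSpace ℝ (Fin d))} (hB : IsCompact B) (h : A ⊆ B) :
    (volume A).toReal ≤ (volume B).toReal :=
  ENNReal.toReal_mono hB.measure_lt_top.ne (measure_mono h)

lemma KP_iv_mono {d : ℕ} (hd : 1 < d) {K L : Set (EuclideanSpace ℝ (Fin d))}
    (hK : IsCompact K) (cK : Convex ℝ K) (hL : IsCompact L) (cL : Convex ℝ L) (h : K ⊆ L) (k : ℕ) :
    intrinsicVolume d k K ≤ intrinsicVolume d k L := by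
  have := KP_general hd hL cL hK cK hK cK 1 (-1) 0 (fun Y hY _ => by
    have := KP_mono_vol (hL.add hY) (Set.add_subset_add_right (t := Y) h)
    linarith) k
  linarith

lemma KP_vol_image {d : ℕ} (σ : EuclideanSpace ℝ (Fin d) ≃ₗᵢ[ℝ] EuclideanSpace ℝ (Fin d))
    (K : Set (EuclideanSpace ℝ (Fin d))) : volume (σ '' K) = volume K := by
  have h := (σ.measurePreserving).measure_preimage_equiv (f := σ.toHomeomorph.toMeasurableEquiv) (σ '' K)
  rw [← h]
  congr 1
  exact Set.preimage_image_eq K σ.injective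

lemma KP_iv_image {d : ℕ} (σ : EuclideanSpace ℝ (Fin d) ≃ₗᵢ[ℝ] EuclideanSpace ℝ (Fin d))
    (K : Set (EuclideanSpace ℝ (Fin d))) (k : ℕ) :
    intrinsicVolume d k (σ '' K) = intrinsicVolume d k K := by
  have h : ∀ j : ℕ, volume (σ '' K + closedBall (0 : EuclideanSpace ℝ (Fin d)) (j : ℝ))
      = volume (K + closedBall (0 : EuclideanSpace ℝ (Fin d)) (j : ℝ)) := by
    intro j
    rw [← KP_vol_image σ (K + closedBall 0 (j : ℝ)), Set.image_add, σ.image_closedBall, map_zero]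
  simp only [intrinsicVolume, h]

lemma KP_sym_step {d : ℕ} {σ : EuclideanSpace ℝ (Fin d) ≃ₗᵢ[ℝ] EuclideanSpace ℝ (Fin d)}
    (hσ : KPRefl σ) {K Y : Set (EuclideanSpace ℝ (Fin d))}
    (hK : IsCompact K) (cK : Convex ℝ K) (hY : IsCompact Y) (cY : Convex ℝ Y) :
    (volume (K + Y)).toReal + (volume (σ '' K + Y)).toReal
      ≤ 2 * (volume (KPSym σ K + Y)).toReal := by
  obtain ⟨h2, v, hv, ht⟩ := hσ
  have hS : IsCompact (σ '' K) := hK.image σ.continuous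
  have := KP_bonnesen hv (hK.add hY) (cK.add cY) (hS.add hY) ((KP_image_convex σ cK).add cY)
    (by
      rintro _ ⟨x, hx, y, hy, rfl⟩
      obtain ⟨t, h⟩ := ht x
      refine ⟨t, σ x, ⟨x, hx, rfl⟩, y, hy, ?_⟩
      simp only [h]; abel)
    (by
      rintro _ ⟨_, ⟨x, hx, rfl⟩, y, hy, rfl⟩
      obtain ⟨t, h⟩ := ht (σ x)
      rw [h2] at h
      refine ⟨t, x, hx, y, hy, ?_⟩
      show x + y = _ 
      conv_lhs => rw [h]
      simp only []; abel)
  refine this.trans ?_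
  have hsub : (1 / 2 : ℝ) • ((K + Y) + (σ '' K + Y)) ⊆ KPSym σ K + Y := by
    rintro _ ⟨_, ⟨_, ⟨x, hx, y, hy, rfl⟩, _, ⟨z, hz, w, hw, rfl⟩, rfl⟩, rfl⟩
    refine ⟨(1 / 2 : ℝ) • (x + z), ⟨x + z, ⟨x, hx, z, hz, rfl⟩, rfl⟩,
      (1 / 2 : ℝ) • y + (1 / 2 : ℝ) • w, cY hy hw (by norm_num) (by norm_num) (by norm_num), ?_⟩
    simp only [smul_add]; abel
  have := KP_mono_vol ((KP_sym_compact σ hK).add hY) hsub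
  linarith

lemma KP_iv_sym {d : ℕ} (hd : 1 < d)
    {σ : EuclideanSpace ℝ (Fin d) ≃ₗᵢ[ℝ] EuclideanSpace ℝ (Fin d)}
    (hσ : KPRefl σ) {K : Set (EuclideanSpace ℝ (Fin d))}
    (hK : IsCompact K) (cK : Convex ℝ K) (k : ℕ) :
    intrinsicVolume d k K ≤ intrinsicVolume d k (KPSym σ K) := by
  have hS : IsCompact (σ '' K) := hK.image σ.continuous
  have := KP_general hd (KP_sym_compact σ hK) (KP_sym_convex σ cK) hK cK hS (KP_image_convex σ cK)
    2 (-1) (-1) (fun Y hY cY => by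
      have := KP_sym_step hσ hK cK hY cY
      linarith) k
  rw [KP_iv_image] at this
  linarith

lemma KP_vol_sym {d : ℕ} {σ : EuclideanSpace ℝ (Fin d) ≃ₗᵢ[ℝ] EuclideanSpace ℝ (Fin d)}
    (hσ : KPRefl σ) {K : Set (EuclideanSpace ℝ (Fin d))}
    (hK : IsCompact K) (cK : Convex ℝ K) :
    (volume K).toReal ≤ (volume (KPSym σ K)).toReal := by
  have := KP_sym_step hσ hK cK (isCompact_singleton (x := 0)) (convex_singleton 0)
  simp only [Set.add_singleton, add_zero, Set.image_id', KP_vol_image] at this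
  linarith

open Polynomial in
lemma KP_iv_ball {d : ℕ} {k : ℕ} (hkd : k ≤ d) {ρ : ℝ} (hρ : 0 ≤ ρ) :
    intrinsicVolume d k (closedBall (0 : EuclideanSpace ℝ (Fin d)) ρ)
      = ρ ^ k * (d.choose (d - k) * ballVolume d / ballVolume (d - k)) := by
  have h := KP_interp (C (ballVolume d) * (X + C ρ) ^ d) d (by
      refine (natDegree_C_mul_le _ _).trans ?_
      simp [natDegree_pow_X_add_C]) (fun j : ℕ => (volume (closedBall (0 : EuclideanSpace ℝ (Fin d)) ρ +
        closedBall (0 : EuclideanSpace ℝ (Fin d)) (j : ℝ))).toReal) (fun j => by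
      rw [closedBall_add_closedBall hρ (by positivity), KP_vol_closedBall _ (by positivity)]
      simp; ring)
  rw [intrinsicVolume, h, coeff_C_mul, coeff_X_add_C_pow, Nat.sub_sub_self hkd]
  ring

lemma KP_iv_ball' {d : ℕ} {k : ℕ} (hkd : k ≤ d) {ρ : ℝ} (hρ : 0 ≤ ρ) :
    intrinsicVolume d k (closedBall (0 : EuclideanSpace ℝ (Fin d)) ρ)
      = ρ ^ k * intrinsicVolume d k (closedBall (0 : EuclideanSpace ℝ (Fin d)) 1) := by
  rw [KP_iv_ball hkd hρ, KP_iv_ball hkd zero_le_one]; ring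

lemma KP_iv_ball_nonneg {d : ℕ} {k : ℕ} (hkd : k ≤ d) :
    0 ≤ intrinsicVolume d k (closedBall (0 : EuclideanSpace ℝ (Fin d)) 1) := by
  rw [KP_iv_ball hkd zero_le_one]
  have := KP_ballVolume_nonneg d
  have := KP_ballVolume_nonneg (d - k)
  positivity

lemma KP_rDual {d N : ℕ} (hN : 0 < N) {r : ℝ} (p : Fin N → EuclideanSpace ℝ (Fin d))
    (hcr : circumradius (Set.range p) ≤ r) :
    IsCompact (rDual r (Set.range p)) ∧ Convex ℝ (rDual r (Set.range p)) ∧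
      (rDual r (Set.range p)).Nonempty := by
  have hc : ∀ s, IsCompact (rDual s (Set.range p)) := by
    intro s
    refine (isCompact_closedBall (p ⟨0, hN⟩) s).of_isClosed_subset ?_ ?_
    · exact isClosed_biInter fun _ _ => isClosed_closedBall
    · exact Set.biInter_subset_of_mem (Set.mem_range_self _)
  refine ⟨hc r, convex_iInter₂ fun _ _ => convex_closedBall _ _, ?_⟩
  have hmem : ∀ s x, x ∈ rDual s (Set.range p) ↔ ∀ i, dist x (p i) ≤ s := by
    intro s x; simp [rDual]
  have hS : ({r : ℝ | 0 < r ∧ ∃ q, Set.range p ⊆ closedBall q r}).Nonempty := by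
    obtain ⟨s, hs⟩ := (Set.finite_range p).isBounded.subset_closedBall 0
    exact ⟨max s 1, by positivity, 0, hs.trans (closedBall_subset_closedBall (le_max_left _ _))⟩
  have hne : ∀ n : ℕ, (rDual (r + 1 / ((n : ℝ) + 1)) (Set.range p)).Nonempty := by
    intro n
    have hpos : 0 < 1 / ((n : ℝ) + 1) := by positivity
    obtain ⟨s, ⟨_, q, hq⟩, hs⟩ := exists_lt_of_csInf_lt hS
      (lt_of_le_of_lt hcr (by linarith : r < r + 1 / ((n : ℝ) + 1)))
    refine ⟨q, (hmem _ _).2 fun i => ?_⟩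
    have := hq (Set.mem_range_self i)
    rw [mem_closedBall, dist_comm] at this
    linarith
  obtain ⟨x, hx⟩ := IsCompact.nonempty_iInter_of_sequence_nonempty_isCompact_isClosed
    (fun n : ℕ => rDual (r + 1 / ((n : ℝ) + 1)) (Set.range p))
    (fun n x hx => by
      rw [hmem] at hx ⊢
      intro i
      refine (hx i).trans ?_
      have : 1 / (((n + 1 : ℕ) : ℝ) + 1) ≤ 1 / ((n : ℝ) + 1) := by
        apply one_div_le_one_div_of_le (by positivity); push_cast; linarith
      linarith) hne (hc _) (fun n => (hc _).isClosed)
  refine ⟨x, (hmem _ _).2 fun i => ?_⟩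
  rw [Set.mem_iInter] at hx
  refine le_of_forall_pos_le_add fun ε hε => ?_
  obtain ⟨n, hn⟩ := exists_nat_one_div_lt hε
  have := (hmem _ _).1 (hx n) i
  linarith

lemma KP_packing {d N : ℕ} {r lam : ℝ} (hlam : 0 < lam)
    (p : Fin N → EuclideanSpace ℝ (Fin d))
    (hsep : ∀ i j, i ≠ j → lam ≤ dist (p i) (p j)) {A : Set (EuclideanSpace ℝ (Fin d))}
    (hA : IsCompact A) (hsub : ∀ i, ball (-p i) (lam / 2) ⊆ A) :
    N * ((lam / 2) ^ d * ballVolume d) ≤ (volume A).toReal := by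
  have hdis : Pairwise (Function.onFun Disjoint fun i => ball (-p i) (lam / 2)) := by
    intro i j hij
    apply ball_disjoint_ball
    rw [dist_neg_neg]
    linarith [hsep i j hij]
  have h1 : volume (⋃ i, ball (-p i) (lam / 2)) ≤ volume A :=
    measure_mono (Set.iUnion_subset hsub)
  rw [measure_iUnion hdis (fun _ => measurableSet_ball), tsum_fintype] at h1
  have h2 := ENNReal.toReal_mono hA.measure_lt_top.ne h1
  rw [ENNReal.toReal_sum (fun i _ => measure_ball_lt_top.ne)] at h2
  refine le_trans (le_of_eq ?_) h2
  have : ∀ i, (volume (ball (-p i) (lam / 2))).toReal = (lam / 2) ^ d * ballVolume d := by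
    intro i
    rw [← KP_vol_closedBall (-p i) (by positivity : 0 ≤ lam / 2),
      Measure.addHaar_closedBall _ _ (by positivity), Measure.addHaar_ball_of_pos _ _ (by positivity)]
  simp [this]

lemma KP_ballVolume_pos (m : ℕ) : 0 < ballVolume m :=
  ENNReal.toReal_pos (measure_closedBall_pos _ _ one_pos).ne' measure_closedBall_lt_top.ne

lemma KP_key {d : ℕ} (hd : 1 < d) (k : ℕ) (hkd : k ≤ d)
    (r lam : ℝ) (hlam : 0 < lam) (N : ℕ) (hN : 0 < N)
    (p : Fin N → EuclideanSpace ℝ (Fin d))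
    (hsep : ∀ i j, i ≠ j → lam ≤ dist (p i) (p j))
    (hcr : circumradius (Set.range p) ≤ r) (δ : ℝ) (hδ : 0 < δ) :
    0 ≤ r - ((N : ℝ) ^ ((1 : ℝ) / d) - 1) * (lam / 2) + δ
      ∧ intrinsicVolume d k (rDual r (Set.range p))
          ≤ (r - ((N : ℝ) ^ ((1 : ℝ) / d) - 1) * (lam / 2) + δ) ^ k
            * intrinsicVolume d k (closedBall (0 : EuclideanSpace ℝ (Fin d)) 1) := by
  obtain ⟨hKc, hKv, hKn⟩ := KP_rDual hN p hcr
  set K₀ := rDual r (Set.range p) with hK₀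
  set R := r + lam / 2 with hR
  set A₀ : Set (EuclideanSpace ℝ (Fin d)) := ⋂ x ∈ K₀, closedBall (-x) R with hA₀
  have hA₀mem : ∀ a, a ∈ A₀ ↔ ∀ x ∈ K₀, ‖a + x‖ ≤ R := by
    intro a; simp [hA₀, dist_eq_norm]
  have hA₀c : IsCompact A₀ := by
    obtain ⟨x, hx⟩ := hKn
    refine (isCompact_closedBall (-x) R).of_isClosed_subset ?_ ?_
    · exact isClosed_biInter fun _ _ => isClosed_closedBall
    · exact Set.biInter_subset_of_mem hx
  have hA₀v : Convex ℝ A₀ := convex_iInter₂ fun _ _ => convex_closedBall _ _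
  have hvol : N * ((lam / 2) ^ d * ballVolume d) ≤ (volume A₀).toReal := by
    refine KP_packing (r := r) hlam p hsep hA₀c fun i a ha => ?_
    rw [hA₀mem]
    intro x hx
    have h1 : dist x (p i) ≤ r := by
      have := hx
      simp only [hK₀, rDual, Set.mem_iInter, Set.mem_range, forall_exists_index, mem_closedBall] at this
      exact this _ i rfl
    rw [mem_ball, dist_eq_norm] at ha
    rw [dist_eq_norm] at h1
    calc ‖a + x‖ = ‖(x - p i) + (a - -p i)‖ := by congr 1; abel
      _ ≤ ‖x - p i‖ + ‖a - -p i‖ := norm_add_le _ _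
      _ ≤ R := by rw [hR]; linarith
  obtain ⟨K, ⟨hc, hv, hn, hiv, A, hAc, hAv, hAvol, hAK⟩, m, hm⟩ := KP_symmetrize hd
    (fun K => IsCompact K ∧ Convex ℝ K ∧ K.Nonempty ∧
      intrinsicVolume d k K₀ ≤ intrinsicVolume d k K ∧
      ∃ A : Set (EuclideanSpace ℝ (Fin d)), IsCompact A ∧ Convex ℝ A ∧
        (volume A₀).toReal ≤ (volume A).toReal ∧ ∀ a ∈ A, ∀ x ∈ K, ‖a + x‖ ≤ R)
    (fun K h => ⟨h.1, h.2.2.1⟩)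
    (by
      rintro K σ ⟨hc, hv, hn, hiv, A, hAc, hAv, hAvol, hAK⟩ hσ
      refine ⟨KP_sym_compact σ hc, KP_sym_convex σ hv, KP_sym_nonempty σ hn,
        hiv.trans (KP_iv_sym hd hσ hc hv k), KPSym σ A, KP_sym_compact σ hAc,
        KP_sym_convex σ hAv, hAvol.trans (KP_vol_sym hσ hAc hAv), ?_⟩
      rintro _ ⟨_, ⟨a, ha, _, ⟨b, hb, rfl⟩, rfl⟩, rfl⟩ _ ⟨_, ⟨x, hx, _, ⟨y, hy, rfl⟩, rfl⟩, rfl⟩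
      have e : (1 / 2 : ℝ) • (a + σ b) + (1 / 2 : ℝ) • (x + σ y)
          = (1 / 2 : ℝ) • (a + x) + (1 / 2 : ℝ) • σ (b + y) := by
        rw [map_add]; module
      show ‖(1 / 2 : ℝ) • (a + σ b) + (1 / 2 : ℝ) • (x + σ y)‖ ≤ R
      rw [e]
      refine (norm_add_le _ _).trans ?_
      rw [norm_smul, norm_smul, σ.norm_map]
      have h1 := hAK a ha x hx
      have h2 := hAK b hb y hy
      norm_num
      linarith)
    K₀ ⟨hKc, hKv, hKn, le_rfl, A₀, hA₀c, hA₀v, le_rfl, fun a ha => (hA₀mem a).1 ha⟩ δ hδ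
  have hω := KP_ballVolume_pos d
  have hNr : (0 : ℝ) < N := by exact_mod_cast hN
  have hApos : 0 < (volume A).toReal :=
    lt_of_lt_of_le (by positivity) (hvol.trans hAvol)
  have hAne : A.Nonempty := by
    rw [Set.nonempty_iff_ne_empty]
    rintro rfl
    simp at hApos
  have key : ∀ u : EuclideanSpace ℝ (Fin d), ‖u‖ = 1 → ∀ a ∈ A, inner ℝ a u + m ≤ R := by
    intro u hu a ha
    obtain ⟨x, hx, hxu⟩ := (KP_supp_greatest hc hn u).1
    have h1 := (hm u hu).1
    have h2 := real_inner_le_norm (a + x) u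
    rw [inner_add_left, hu, mul_one] at h2
    have h3 := hAK a ha x hx
    simp only at hxu
    linarith
  have hAsub : A ⊆ closedBall 0 (R - m) := by
    apply KP_subset_ball hd hAc hAne
    intro u hu
    obtain ⟨a, ha, hau⟩ := (KP_supp_greatest hAc hAne u).1
    have := key u hu a ha
    simp only at hau
    linarith
  have hRm : 0 ≤ R - m := by
    obtain ⟨a, ha⟩ := hAne
    have := hAsub ha
    rw [mem_closedBall] at this
    exact dist_nonneg.trans this
  have h1 : (N : ℝ) * (lam / 2) ^ d ≤ (R - m) ^ d := by
    have := (hvol.trans hAvol).trans (KP_mono_vol (isCompact_closedBall _ _) hAsub)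
    rw [KP_vol_closedBall _ hRm, ← mul_assoc] at this
    exact le_of_mul_le_mul_right this hω
  have hd0 : d ≠ 0 := by omega
  have h2 : (N : ℝ) ^ ((1 : ℝ) / d) * (lam / 2) ≤ R - m := by
    refine le_of_pow_le_pow_left₀ hd0 hRm ?_
    rw [mul_pow, one_div, Real.rpow_inv_natCast_pow hNr.le hd0]
    exact h1
  have hKsub : K ⊆ closedBall 0 (m + δ) := KP_subset_ball hd hc hn _ fun u hu => (hm u hu).2
  have hmδ : 0 ≤ m + δ := by
    obtain ⟨x, hx⟩ := hn
    have := hKsub hx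
    rw [mem_closedBall] at this
    exact dist_nonneg.trans this
  have hle : m + δ ≤ r - ((N : ℝ) ^ ((1 : ℝ) / d) - 1) * (lam / 2) + δ := by
    rw [hR] at h2; linarith
  refine ⟨hmδ.trans hle, hiv.trans ?_⟩
  refine (KP_iv_mono hd hc hv (isCompact_closedBall _ _) (convex_closedBall _ _) hKsub k).trans ?_
  rw [KP_iv_ball' hkd hmδ]
  exact mul_le_mul_of_nonneg_right (pow_le_pow_left₀ hmδ hle k) (KP_iv_ball_nonneg hkd)

theorem stmt_16 {d : ℕ} (hd : 1 < d) (k : ℕ) (hk : 1 ≤ k) (hkd : k ≤ d)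
    (r lam : ℝ) (hr : 0 < r) (hlam : 0 < lam) (N : ℕ)
    (hN : (1 + Real.sqrt (2 * d / (d + 1))) ^ d ≤ (N : ℝ))
    (p : Fin N → EuclideanSpace ℝ (Fin d))
    (hsep : ∀ i j, i ≠ j → lam ≤ dist (p i) (p j))
    (hcr : circumradius (Set.range p) ≤ r) :
    0 ≤ r - ((N : ℝ) ^ ((1 : ℝ) / d) - 1) * (lam / 2)
      ∧ intrinsicVolume d k (rDual r (Set.range p))
          ≤ (r - ((N : ℝ) ^ ((1 : ℝ) / d) - 1) * (lam / 2)) ^ k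
            * intrinsicVolume d k (closedBall (0 : EuclideanSpace ℝ (Fin d)) 1) := by
  have hN0 : 0 < N := by
    have : (0 : ℝ) < (1 + Real.sqrt (2 * d / (d + 1))) ^ d := by positivity
    exact_mod_cast this.trans_le hN
  have H := KP_key hd k hkd r lam hlam N hN0 p hsep hcr
  refine ⟨le_of_forall_pos_le_add fun δ hδ => (H δ hδ).1, ?_⟩
  set ρ := r - ((N : ℝ) ^ ((1 : ℝ) / d) - 1) * (lam / 2)
  set V := intrinsicVolume d k (closedBall (0 : EuclideanSpace ℝ (Fin d)) 1)
  have hcont : Filter.Tendsto (fun δ : ℝ => (ρ + δ) ^ k * V) (nhdsWithin 0 (Set.Ioi 0))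
      (nhds ((ρ + 0) ^ k * V)) :=
    ((by fun_prop : Continuous fun δ : ℝ => (ρ + δ) ^ k * V).tendsto 0).mono_left nhdsWithin_le_nhds
  rw [add_zero] at hcont
  exact ge_of_tendsto hcont (Filter.eventually_of_mem self_mem_nhdsWithin fun δ hδ => (H δ hδ).2)
end
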